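/- arXiv:1909.01833 — 3 statements merged into one kernel-verified Lean document; each statement's English description precedes it below -/
import Mathlib

section
/- For any positive integer m, there are only finitely many isometry classes of strongly s-regular positive definite integral binary quadratic forms L with m_s(L) = m; that is, there exists a finite list of such forms so that every strongly s-regular binary form L with m_s(L) = m is equivalent over GL₂(ℤ) to one of them. -/
open Finset

/-- The value of the binary quadratic form `a x² + b x y + c y²`. -/
def bVal (a b c x y : ℤ) : ℤ := a * x ^ 2 + b * x * y + c * y ^ 2

/-- Positive definiteness of a binary quadratic form. -/
def bPosDef (a b c : ℤ) : Prop := ∀ x y : ℤ, ¬(x = 0 ∧ y = 0) → 0 < bVal a b c x y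

/-- The number of representations of `n` by the binary form `a x² + b x y + c y²`. -/
noncomputable def bRep (a b c : ℤ) (n : ℤ) : ℕ :=
  Set.ncard {v : ℤ × ℤ | bVal a b c v.1 v.2 = n}

/-- The discriminant `4ac - b²` of a binary quadratic form. -/
def bDisc (a b c : ℤ) : ℤ := 4 * a * c - b ^ 2

/-- The local factor `h_p(d, μ) = ∑_{t=0}^{2μ} χ(p)^t` with `χ(p) = (-d | p)` for binary forms. -/
def bHp (d : ℤ) (p : ℕ) (μ : ℕ) : ℤ :=
  ∑ t ∈ Finset.range (2 * μ + 1), (jacobiSym (-d) p) ^ t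

/-- Almost strong s-regularity of a binary form with respect to a finite set `P` of primes. -/
def bASSR (a b c : ℤ) (P : Finset ℕ) : Prop :=
  ∀ n₁ n₂ : ℕ, 0 < n₁ → 0 < n₂ →
    (∀ p : ℕ, p.Prime → p ∣ n₁ → p ∈ P ∨ (p : ℤ) ∣ 2 * bDisc a b c) →
    IsCoprime (n₂ : ℤ) (2 * bDisc a b c) → (∀ p ∈ P, ¬ p ∣ n₂) →
    (bRep a b c (((n₁ : ℤ) * (n₂ : ℤ)) ^ 2) : ℤ) =
      (bRep a b c ((n₁ : ℤ) ^ 2) : ℤ) *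
        ∏ p ∈ n₂.primeFactors, bHp (bDisc a b c) p (n₂.factorization p)

/-- The minimum of positive integers `n` such that `n²` is represented by the binary form. -/
noncomputable def bMs (a b c : ℤ) : ℕ :=
  sInf {n : ℕ | 0 < n ∧ bRep a b c ((n : ℤ) ^ 2) ≠ 0}

/-- `GL₂(ℤ)`-equivalence of binary quadratic forms. -/
def bEquiv (a b c a' b' c' : ℤ) : Prop :=
  ∃ M : Matrix (Fin 2) (Fin 2) ℤ, IsUnit M.det ∧
    ∀ x y : ℤ, bVal a' b' c' x y =
      bVal a b c (M 0 0 * x + M 0 1 * y) (M 1 0 * x + M 1 1 * y)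

open Filter Topology

/-- The Kronecker-type character `n ↦ (4D | n)`, with values in `ℝ`. -/
noncomputable def kron (D : ℤ) (n : ℕ) : ℝ := (jacobiSym (4 * D) n : ℝ)

lemma kron_one (D : ℤ) : kron D 1 = 1 := by simp [kron]

lemma kron_mul (D : ℤ) {m n : ℕ} (hm : m ≠ 0) (hn : n ≠ 0) :
    kron D (m * n) = kron D m * kron D n := by
  simp [kron, jacobiSym.mul_right' _ hm hn]

lemma kron_trichotomy (D : ℤ) (n : ℕ) : kron D n = 0 ∨ kron D n = 1 ∨ kron D n = -1 := by
  rcases jacobiSym.trichotomy (4 * D) n with h | h | h <;> simp [kron, h]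

lemma abs_kron_le_one (D : ℤ) (n : ℕ) : |kron D n| ≤ 1 := by
  rcases kron_trichotomy D n with h | h | h <;> simp [h]

lemma kron_mul_kron (D E : ℤ) {n : ℕ} (hn : n ≠ 0) : kron D n * kron E n = kron (D * E) n := by
  rcases Nat.even_or_odd n with he | ho
  · have h0 : ∀ F : ℤ, kron F n = 0 := fun F ↦ by
      simp only [kron, Int.cast_eq_zero]
      refine jacobiSym.eq_zero_iff.2 ⟨hn, fun h ↦ ?_⟩
      have : (2 : ℤ) ∣ ((4 * F).gcd n : ℤ) :=
        Int.dvd_coe_gcd ⟨2 * F, by ring⟩ (by exact_mod_cast he.two_dvd)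
      rw [h] at this
      norm_num at this
    simp [h0]
  · simp only [kron, ← Int.cast_mul, jacobiSym.mul_left, jacobiSym.at_four ho]
    ring_nf

lemma kron_eq_zero_iff (D : ℤ) {n : ℕ} (hn : n ≠ 0) :
    kron D n = 0 ↔ ¬ n.Coprime (2 * D.natAbs) := by
  have h1 : (4 * D).gcd n = (4 * D.natAbs).gcd n := by
    simp [Int.gcd_def, Int.natAbs_mul]
  have h2 : kron D n = 0 ↔ (4 * D.natAbs).gcd n ≠ 1 := by
    simp only [kron, Int.cast_eq_zero]
    rw [jacobiSym.eq_zero_iff, h1]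
    simp [hn]
  rw [h2, not_iff_not, ← Nat.coprime_iff_gcd_eq_one, Nat.coprime_comm,
    show 4 * D.natAbs = 2 * (2 * D.natAbs) by ring, Nat.coprime_mul_iff_right]
  exact ⟨fun h ↦ h.2, fun h ↦ ⟨(Nat.coprime_mul_iff_right.1 h).1, h⟩⟩

lemma kron_sq (e : ℕ) {n : ℕ} (hn : n ≠ 0) :
    kron ((e : ℤ) ^ 2) n = if n.Coprime (2 * e) then 1 else 0 := by
  have hz := kron_eq_zero_iff (e : ℤ) hn
  rw [Int.natAbs_natCast] at hz
  rw [pow_two, ← kron_mul_kron _ _ hn]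
  split_ifs with h
  · rcases kron_trichotomy e n with h' | h' | h'
    · exact absurd h (hz.1 h')
    · simp [h']
    · simp [h']
  · simp [hz.2 h]

lemma kron_add_period (D : ℤ) {n : ℕ} (hn : n ≠ 0) : kron D (n + 4 * D.natAbs) = kron D n := by
  rcases Nat.even_or_odd n with he | ho
  · rw [(kron_eq_zero_iff D hn).2, (kron_eq_zero_iff D (by omega)).2]
    · intro h
      have := (Nat.coprime_mul_iff_right.1 h).1
      rw [Nat.coprime_two_right] at this
      have h3 : Even (n + 4 * D.natAbs) := he.add ⟨2 * D.natAbs, by ring⟩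
      exact (Nat.not_even_iff_odd.2 this) h3
    · intro h
      have := (Nat.coprime_mul_iff_right.1 h).1
      rw [Nat.coprime_two_right] at this
      exact (Nat.not_even_iff_odd.2 this) he
  · have ho' : Odd (n + 4 * D.natAbs) := ho.add_even ⟨2 * D.natAbs, by ring⟩
    simp only [kron, jacobiSym.mul_left, jacobiSym.at_four ho, jacobiSym.at_four ho']
    rw [jacobiSym.mod_right D ho', jacobiSym.mod_right D ho]
    simp

lemma kron_congr (D : ℤ) {m n : ℕ} (hm : m ≠ 0) (hn : n ≠ 0) (h : m ≡ n [MOD 4 * D.natAbs]) :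
    kron D m = kron D n := by
  have key : ∀ k a : ℕ, a ≠ 0 → kron D (a + 4 * D.natAbs * k) = kron D a := by
    intro k a ha
    induction k with
    | zero => simp
    | succ k ih =>
      rw [mul_add, mul_one, ← add_assoc, kron_add_period D (by omega), ih]
  wlog hle : m ≤ n generalizing m n
  · exact (this hn hm h.symm (by omega)).symm
  obtain ⟨k, hk⟩ := (Nat.modEq_iff_dvd' hle).1 h
  rw [show n = m + 4 * D.natAbs * k by omega, key k m hm]

/-- The Dirichlet character underlying `kron D`. -/
noncomputable def kronChar (D : ℤ) (hD : D ≠ 0) : DirichletCharacter ℂ (4 * D.natAbs) :=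
  have : NeZero (4 * D.natAbs) := ⟨by omega⟩
  { toFun := fun a ↦ (kron D (a.val + 4 * D.natAbs) : ℂ)
    map_one' := by
      rw [← Complex.ofReal_one, ← kron_one D]
      congr 1
      refine kron_congr D (by omega) (by omega) ?_
      rw [ZMod.val_one'' (by omega)]
      simp [Nat.ModEq]
    map_mul' := fun a b ↦ by
      rw [← Complex.ofReal_mul, ← kron_mul D (by omega) (by omega)]
      congr 1
      refine kron_congr D (by omega) (Nat.mul_ne_zero (by omega) (by omega)) ?_
      simp [Nat.ModEq, ZMod.val_mul, Nat.mul_mod]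
    map_nonunit' := fun a ha ↦ by
      rw [Complex.ofReal_eq_zero, kron_eq_zero_iff D (by omega)]
      intro h
      apply ha
      have h' : (a.val).Coprime (2 * D.natAbs) :=
        (Nat.coprime_add_mul_left_left a.val (2 * D.natAbs) 2).1 (by convert h using 2; ring)
      rw [← ZMod.natCast_zmod_val a, ZMod.isUnit_iff_coprime]
      have h2 := Nat.coprime_mul_iff_right.2 ⟨(Nat.coprime_mul_iff_right.1 h').1, h'⟩
      convert h2 using 1
      ring }

lemma kronChar_natCast (D : ℤ) (hD : D ≠ 0) {n : ℕ} (hn : n ≠ 0) :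
    kronChar D hD (n : ZMod (4 * D.natAbs)) = (kron D n : ℂ) := by
  have : NeZero (4 * D.natAbs) := ⟨by omega⟩
  change ((kron D ((n : ZMod (4 * D.natAbs)).val + 4 * D.natAbs) : ℝ) : ℂ) = _
  congr 1
  refine kron_congr D (by omega) hn ?_
  simp [Nat.ModEq, ZMod.val_natCast]

lemma kronChar_ne_one (D : ℤ) (hD : D ≠ 0) {a : ℕ} (ha : a ≠ 0) (h : kron D a = -1) :
    kronChar D hD ≠ 1 := by
  intro h1
  have h2 := kronChar_natCast D hD ha
  have hu : IsUnit (a : ZMod (4 * D.natAbs)) := by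
    by_contra hu
    rw [MulChar.map_nonunit _ hu, h] at h2
    norm_num at h2
  rw [h1, MulChar.one_apply hu, h] at h2
  norm_num at h2

lemma sum_kron_period (D : ℤ) (hD : D ≠ 0) {a : ℕ} (ha : a ≠ 0) (h : kron D a = -1) :
    ∑ n ∈ Ioc 0 (4 * D.natAbs), kron D n = 0 := by
  have : NeZero (4 * D.natAbs) := ⟨by omega⟩
  have h1 := MulChar.sum_eq_zero_of_ne_one (kronChar_ne_one D hD ha h)
  rw [← Complex.ofReal_eq_zero, ← h1, Complex.ofReal_sum]
  symm
  refine Finset.sum_bij' (fun a _ ↦ if a.val = 0 then 4 * D.natAbs else a.val)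
    (fun n _ ↦ (n : ZMod (4 * D.natAbs))) ?_ ?_ ?_ ?_ ?_
  · intro a _
    have := ZMod.val_lt a
    simp only [mem_Ioc]
    split_ifs <;> omega
  · simp
  · intro a _
    split_ifs with h0
    · rw [ZMod.natCast_self]; exact ((ZMod.val_eq_zero a).1 h0).symm
    · simp
  · intro n hn
    simp only [mem_Ioc] at hn
    simp only [ZMod.val_natCast]
    rcases hn.2.lt_or_eq with hlt | heq
    · rw [Nat.mod_eq_of_lt hlt]; split_ifs <;> omega
    · rw [heq]; simp
  · intro a _
    split_ifs with h0
    · rw [← kronChar_natCast D hD (by omega), ZMod.natCast_self]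
      rw [(ZMod.val_eq_zero a).1 h0]
    · rw [← kronChar_natCast D hD h0]; simp

lemma abs_sum_periodic_le {u : ℕ → ℝ} {q : ℕ} {B : ℝ} (hq : 0 < q)
    (hu : ∀ n, n ≠ 0 → u (n + q) = u n) (h0 : ∑ n ∈ Ioc 0 q, u n = 0) (hB : ∀ n, |u n| ≤ B)
    (b : ℕ) : |∑ n ∈ Ioc 0 b, u n| ≤ B * q := by
  have hB0 : 0 ≤ B := (abs_nonneg _).trans (hB 0)
  induction b using Nat.strong_induction_on with
  | _ b ih =>
    rcases le_or_gt b q with hb | hb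
    · calc |∑ n ∈ Ioc 0 b, u n| ≤ ∑ n ∈ Ioc 0 b, |u n| := abs_sum_le_sum_abs _ _
        _ ≤ ∑ n ∈ Ioc 0 b, B := sum_le_sum fun n _ ↦ hB n
        _ = B * b := by simp [mul_comm]
        _ ≤ B * q := by gcongr
    · have : ∑ n ∈ Ioc 0 b, u n = ∑ n ∈ Ioc 0 (b - q), u n := by
        rw [← Finset.sum_Ioc_consecutive u (Nat.zero_le q) hb.le, h0, zero_add]
        refine Finset.sum_bij' (fun n _ ↦ n - q) (fun n _ ↦ n + q) ?_ ?_ ?_ ?_ ?_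
        · intro n hn; simp only [mem_Ioc] at hn ⊢; omega
        · intro n hn; simp only [mem_Ioc] at hn ⊢; omega
        · intro n hn; simp only [mem_Ioc] at hn; omega
        · intro n hn; simp
        · intro n hn
          simp only [mem_Ioc] at hn
          rw [← hu (n - q) (by omega)]
          congr 1; omega
      rw [this]
      exact ih _ (by omega)

lemma abs_sum_kron_le (D : ℤ) (hD : D ≠ 0) {a : ℕ} (ha : a ≠ 0) (h : kron D a = -1) (b : ℕ) :
    |∑ n ∈ Ioc 0 b, kron D n| ≤ 4 * D.natAbs := by
  have := abs_sum_periodic_le (u := kron D) (q := 4 * D.natAbs) (B := 1) (by omega)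
    (fun n hn ↦ kron_add_period D hn) (sum_kron_period D hD ha h) (abs_kron_le_one D) b
  simpa using this

lemma exists_kron_eq_neg_one_of_neg {D : ℤ} (hD : D < 0) : ∃ a : ℕ, a ≠ 0 ∧ kron D a = -1 := by
  obtain ⟨d, rfl⟩ : ∃ d : ℕ, D = -(d : ℤ) := ⟨D.natAbs, by omega⟩
  have hd : 0 < d := by omega
  refine ⟨4 * d - 1, by omega, ?_⟩
  have h1 : jacobiSym (4 * -(d : ℤ)) (4 * d - 1) = jacobiSym (-1) (4 * d - 1) := by
    apply jacobiSym.mod_left'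
    have : (4 * -(d : ℤ)) = -1 - ((4 * d - 1 : ℕ) : ℤ) := by
      push_cast [Nat.cast_sub (show 1 ≤ 4 * d by omega)]; ring
    simp [this]
  have hodd : Odd (4 * d - 1) := ⟨2 * d - 1, by omega⟩
  rw [kron, h1, jacobiSym.at_neg_one hodd, ZMod.χ₄_nat_three_mod_four (by omega)]
  simp

/-- The partial sum `∑_{0 < n ≤ N} u n / n ^ σ` of a Dirichlet series. -/
noncomputable def partialL (u : ℕ → ℝ) (σ : ℝ) (N : ℕ) : ℝ :=
  ∑ n ∈ Ioc 0 N, u n * (n : ℝ) ^ (-σ)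

lemma abs_sum_mul_antitone_le {u w : ℕ → ℝ} {Q : ℝ} (hQ : ∀ b, |∑ n ∈ Ioc 0 b, u n| ≤ Q)
    (hw0 : ∀ n, 0 ≤ w n) (hw : ∀ n, n ≠ 0 → w (n + 1) ≤ w n) {a b : ℕ} (hab : a ≤ b) :
    |∑ n ∈ Ioc a b, u n * w n| ≤ 2 * Q * w (a + 1) := by
  have hQ0 : 0 ≤ Q := (abs_nonneg _).trans (hQ 0)
  rcases hab.eq_or_lt with rfl | hlt
  · simpa using mul_nonneg (by positivity) (hw0 (a + 1))
  have key : |∑ n ∈ Ioc a b, u n * w n - (∑ n ∈ Ioc 0 b, u n) * w b|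
      ≤ Q * (2 * w (a + 1) - w b) := by
    induction b, hlt using Nat.le_induction with
    | base =>
      rw [← Finset.sum_Ioc_consecutive u (Nat.zero_le a) (Nat.le_succ a)]
      simp only [Nat.succ_eq_add_one, Nat.Ioc_succ_singleton, sum_singleton]
      rw [show u (a + 1) * w (a + 1) - (∑ n ∈ Ioc 0 a, u n + u (a + 1)) * w (a + 1)
        = -((∑ n ∈ Ioc 0 a, u n) * w (a + 1)) by ring, abs_neg, abs_mul, abs_of_nonneg (hw0 _)]
      nlinarith [mul_le_mul_of_nonneg_right (hQ a) (hw0 (a + 1))]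
    | succ b hb ih =>
      have hb' : a < b := hb
      specialize ih hb'.le
      rw [← Finset.sum_Ioc_consecutive u (Nat.zero_le b) (Nat.le_succ b),
        ← Finset.sum_Ioc_consecutive _ hb'.le (Nat.le_succ b)]
      simp only [Nat.succ_eq_add_one, Nat.Ioc_succ_singleton, sum_singleton]
      have hd := hw b (by omega)
      have h2 : |(∑ n ∈ Ioc 0 b, u n) * (w b - w (b + 1))| ≤ Q * (w b - w (b + 1)) := by
        rw [abs_mul, abs_of_nonneg (sub_nonneg.2 hd)]
        exact mul_le_mul_of_nonneg_right (hQ b) (sub_nonneg.2 hd)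
      rw [show ∑ n ∈ Ioc a b, u n * w n + u (b + 1) * w (b + 1)
          - (∑ n ∈ Ioc 0 b, u n + u (b + 1)) * w (b + 1)
        = (∑ n ∈ Ioc a b, u n * w n - (∑ n ∈ Ioc 0 b, u n) * w b)
          + (∑ n ∈ Ioc 0 b, u n) * (w b - w (b + 1)) by ring]
      refine (abs_add_le _ _).trans ?_
      linarith
  have h3 : |(∑ n ∈ Ioc 0 b, u n) * w b| ≤ Q * w b := by
    rw [abs_mul, abs_of_nonneg (hw0 b)]
    exact mul_le_mul_of_nonneg_right (hQ b) (hw0 b)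
  have h4 := abs_add_le (∑ n ∈ Ioc a b, u n * w n - (∑ n ∈ Ioc 0 b, u n) * w b)
    ((∑ n ∈ Ioc 0 b, u n) * w b)
  rw [sub_add_cancel] at h4
  linarith

lemma abs_partialL_sub_le {u : ℕ → ℝ} {Q σ : ℝ} (hQ : ∀ b, |∑ n ∈ Ioc 0 b, u n| ≤ Q)
    (hσ : 0 < σ) {a b : ℕ} (hab : a ≤ b) :
    |partialL u σ b - partialL u σ a| ≤ 2 * Q * ((a : ℝ) + 1) ^ (-σ) := by
  have h := abs_sum_mul_antitone_le (w := fun n ↦ (n : ℝ) ^ (-σ)) hQ (fun n ↦ by positivity)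
    (fun n hn ↦ Real.rpow_le_rpow_of_nonpos (by positivity) (by push_cast; linarith)
      (by linarith)) hab
  rw [partialL, partialL, ← Finset.sum_Ioc_consecutive _ (Nat.zero_le a) hab]
  simpa using h

lemma tendsto_two_mul_rpow_neg (Q : ℝ) {σ : ℝ} (hσ : 0 < σ) :
    Tendsto (fun a : ℕ ↦ 2 * Q * ((a : ℝ) + 1) ^ (-σ)) atTop (𝓝 0) := by
  have h1 : Tendsto (fun a : ℕ ↦ (a : ℝ) + 1) atTop atTop :=
    tendsto_atTop_add_const_right _ _ tendsto_natCast_atTop_atTop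
  simpa using ((tendsto_rpow_neg_atTop hσ).comp h1).const_mul (2 * Q)

/-- The value at `σ` of the Dirichlet series of `u`, as the limit of its partial sums. -/
noncomputable def limL (u : ℕ → ℝ) (σ : ℝ) : ℝ := limUnder atTop (partialL u σ)

lemma tendsto_partialL {u : ℕ → ℝ} {Q σ : ℝ} (hQ : ∀ b, |∑ n ∈ Ioc 0 b, u n| ≤ Q)
    (hσ : 0 < σ) : Tendsto (partialL u σ) atTop (𝓝 (limL u σ)) := by
  refine CauchySeq.tendsto_limUnder ?_
  refine cauchySeq_of_le_tendsto_0' (fun a : ℕ ↦ 2 * Q * ((a : ℝ) + 1) ^ (-σ)) ?_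
    (tendsto_two_mul_rpow_neg Q hσ)
  intro a b hab
  rw [dist_comm, Real.dist_eq]
  exact abs_partialL_sub_le hQ hσ hab

lemma abs_limL_sub_partialL_le {u : ℕ → ℝ} {Q σ : ℝ} (hQ : ∀ b, |∑ n ∈ Ioc 0 b, u n| ≤ Q)
    (hσ : 0 < σ) (a : ℕ) :
    |limL u σ - partialL u σ a| ≤ 2 * Q * ((a : ℝ) + 1) ^ (-σ) := by
  refine le_of_tendsto ((tendsto_partialL hQ hσ).sub_const _).abs ?_
  filter_upwards [eventually_ge_atTop a] with b hb
  exact abs_partialL_sub_le hQ hσ hb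

lemma continuousOn_limL {u : ℕ → ℝ} {Q σ₀ : ℝ} (hQ : ∀ b, |∑ n ∈ Ioc 0 b, u n| ≤ Q)
    (hσ₀ : 0 < σ₀) : ContinuousOn (limL u) (Set.Ici σ₀) := by
  have hQ0 : 0 ≤ Q := (abs_nonneg _).trans (hQ 0)
  have hunif : TendstoUniformlyOn (fun N σ ↦ partialL u σ N) (limL u) atTop (Set.Ici σ₀) := by
    rw [Metric.tendstoUniformlyOn_iff]
    intro ε hε
    filter_upwards [(tendsto_two_mul_rpow_neg Q hσ₀).eventually (gt_mem_nhds hε)] with N hN σ hσ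
    rw [Real.dist_eq]
    refine (abs_limL_sub_partialL_le hQ (hσ₀.trans_le hσ) N).trans_lt (lt_of_le_of_lt ?_ hN)
    refine mul_le_mul_of_nonneg_left ?_ (by positivity)
    exact Real.rpow_le_rpow_of_exponent_le (by linarith [N.cast_nonneg (α := ℝ)])
      (by simpa using hσ)
  refine hunif.continuousOn (Frequently.of_forall fun N ↦ ?_)
  unfold partialL
  refine continuousOn_finsetSum _ fun n hn ↦ ?_
  have hn0 : (n : ℝ) ≠ 0 := by have := (mem_Ioc.1 hn).1; positivity
  refine Continuous.continuousOn ?_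
  exact continuous_const.mul (Real.continuous_const_rpow hn0 |>.comp continuous_neg)

lemma sum_mul_partialL_div {u v : ℕ → ℝ} (σ : ℝ) (N : ℕ) :
    ∑ k ∈ Ioc 0 N, u k * (k : ℝ) ^ (-σ) * partialL v σ (N / k)
      = ∑ n ∈ Ioc 0 N, (∑ k ∈ n.divisors, u k * v (n / k)) * (n : ℝ) ^ (-σ) := by
  simp_rw [partialL, mul_sum, sum_mul]
  rw [Finset.sum_sigma', Finset.sum_sigma']
  refine Finset.sum_bij' (fun x _ ↦ ⟨x.1 * x.2, x.1⟩) (fun y _ ↦ ⟨y.2, y.1 / y.2⟩) ?_ ?_ ?_ ?_ ?_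
  · rintro ⟨k, l⟩ h
    simp only [mem_sigma, mem_Ioc, Nat.mem_divisors] at h ⊢
    obtain ⟨⟨hk, hkN⟩, hl, hlN⟩ := h
    have : k * l ≤ N := by
      rw [Nat.le_div_iff_mul_le hk] at hlN; linarith
    have h2 : 0 < k * l := Nat.mul_pos hk hl
    exact ⟨⟨h2, this⟩, dvd_mul_right _ _, h2.ne'⟩
  · rintro ⟨n, k⟩ h
    simp only [mem_sigma, mem_Ioc, Nat.mem_divisors] at h ⊢
    obtain ⟨⟨hn, hnN⟩, hk, -⟩ := h
    have hk0 : 0 < k := Nat.pos_of_dvd_of_pos hk hn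
    have hkn := Nat.le_of_dvd hn hk
    exact ⟨⟨hk0, hkn.trans hnN⟩, Nat.div_pos hkn hk0, Nat.div_le_div_right hnN⟩
  · rintro ⟨k, l⟩ h
    simp only [mem_sigma, mem_Ioc] at h
    simp [Nat.mul_div_cancel_left l h.1.1]
  · rintro ⟨n, k⟩ h
    simp only [mem_sigma, mem_Ioc, Nat.mem_divisors] at h
    simp [Nat.mul_div_cancel' h.2.1]
  · rintro ⟨k, l⟩ h
    simp only [mem_sigma, mem_Ioc] at h
    simp only
    rw [Nat.mul_div_cancel_left l h.1.1, Nat.cast_mul,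
      Real.mul_rpow (by positivity) (by positivity)]
    ring

lemma abs_sum_mul_partialL_sub_le {u v : ℕ → ℝ} {P Q σ : ℝ} (hu : ∀ n, |u n| ≤ 1)
    (hv : ∀ n, |v n| ≤ 2) (hP : ∀ b, |∑ n ∈ Ioc 0 b, u n| ≤ P)
    (hQ : ∀ b, |∑ n ∈ Ioc 0 b, v n| ≤ Q) (hP1 : 1 ≤ P) (hQ1 : 1 ≤ Q) (hσ : 99 / 100 ≤ σ)
    {z : ℕ} (hz : 1 ≤ z) :
    |∑ k ∈ Ioc 0 (z ^ 3), u k * (k : ℝ) ^ (-σ) * partialL v σ (z ^ 3 / k)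
      - limL u σ * limL v σ| ≤ 10 * (P * Q) * (z : ℝ) ^ (-(9 / 10) : ℝ) := by
  have hσ0 : 0 < σ := by linarith
  have hz1 : (1 : ℝ) ≤ z := by exact_mod_cast hz
  have hz0 : (0 : ℝ) < z := by linarith
  set w : ℝ := (z : ℝ) ^ (-(9 / 10) : ℝ) with hw
  have hw0 : 0 < w := by positivity
  have pw : ∀ (e : ℝ), e ≤ -(9 / 10) → (z : ℝ) ^ e ≤ w := fun e he ↦
    Real.rpow_le_rpow_of_exponent_le hz1 he
  have hle : z ^ 2 ≤ z ^ 3 := Nat.pow_le_pow_right hz (by norm_num)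
  have hfirst : |∑ k ∈ Ioc 0 (z ^ 2), u k * (k : ℝ) ^ (-σ) * partialL v σ (z ^ 3 / k)
      - partialL u σ (z ^ 2) * limL v σ| ≤ 2 * Q * w := by
    rw [partialL, sum_mul, ← sum_sub_distrib]
    calc _ ≤ ∑ k ∈ Ioc 0 (z ^ 2), |u k * (k : ℝ) ^ (-σ) * partialL v σ (z ^ 3 / k)
              - u k * (k : ℝ) ^ (-σ) * limL v σ| := abs_sum_le_sum_abs _ _
      _ ≤ ∑ k ∈ Ioc 0 (z ^ 2), 2 * Q * ((z : ℝ) ^ 3) ^ (-σ) := by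
        refine sum_le_sum fun k hk ↦ ?_
        have hk0 : 0 < k := (mem_Ioc.1 hk).1
        have hk0' : (0 : ℝ) < k := by exact_mod_cast hk0
        rw [← mul_sub, abs_mul, abs_mul, abs_of_nonneg (show 0 ≤ (k : ℝ) ^ (-σ) by positivity),
          abs_sub_comm]
        have h1 := abs_limL_sub_partialL_le hQ hσ0 (z ^ 3 / k)
        have h2 : (k : ℝ) ^ (-σ) * (((z ^ 3 / k : ℕ) : ℝ) + 1) ^ (-σ) ≤ ((z : ℝ) ^ 3) ^ (-σ) := by
          rw [← Real.mul_rpow (by positivity) (by positivity)]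
          refine Real.rpow_le_rpow_of_nonpos (by positivity) ?_ (by linarith)
          have := (Nat.lt_mul_div_succ (z ^ 3) hk0).le
          exact_mod_cast this
        calc |u k| * (k : ℝ) ^ (-σ) * |limL v σ - partialL v σ (z ^ 3 / k)|
            ≤ 1 * (k : ℝ) ^ (-σ) * (2 * Q * (((z ^ 3 / k : ℕ) : ℝ) + 1) ^ (-σ)) := by
              gcongr; exact hu k
          _ = 2 * Q * ((k : ℝ) ^ (-σ) * (((z ^ 3 / k : ℕ) : ℝ) + 1) ^ (-σ)) := by ring
          _ ≤ _ := by gcongr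
      _ = 2 * Q * ((z : ℝ) ^ 2 * ((z : ℝ) ^ 3) ^ (-σ)) := by simp; ring
      _ ≤ 2 * Q * w := by
        gcongr
        rw [← Real.rpow_natCast, ← Real.rpow_natCast, ← Real.rpow_mul hz0.le,
          ← Real.rpow_add hz0]
        exact pw _ (by push_cast; linarith)
  have htail : ∀ b, z ^ 2 ≤ b → |partialL u σ b - partialL u σ (z ^ 2)|
      ≤ 2 * P * (z : ℝ) ^ (-(198 / 100) : ℝ) := by
    intro b hb
    refine (abs_partialL_sub_le hP hσ0 hb).trans ?_
    gcongr
    calc (((z ^ 2 : ℕ) : ℝ) + 1) ^ (-σ) ≤ ((z : ℝ) ^ 2) ^ (-σ) :=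
          Real.rpow_le_rpow_of_nonpos (by positivity) (by push_cast; linarith) (by linarith)
      _ ≤ _ := by
        rw [← Real.rpow_natCast, ← Real.rpow_mul hz0.le]
        exact Real.rpow_le_rpow_of_exponent_le hz1 (by push_cast; linarith)
  have hsecond : |∑ k ∈ Ioc (z ^ 2) (z ^ 3), u k * (k : ℝ) ^ (-σ) * partialL v σ (z ^ 3 / k)|
      ≤ 4 * P * w := by
    have hswap : ∑ k ∈ Ioc (z ^ 2) (z ^ 3), u k * (k : ℝ) ^ (-σ) * partialL v σ (z ^ 3 / k)
        = ∑ l ∈ Ioc 0 z, v l * (l : ℝ) ^ (-σ) *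
          (partialL u σ (z ^ 3 / l) - partialL u σ (z ^ 2)) := by
      have : ∀ l ∈ Ioc 0 z, v l * (l : ℝ) ^ (-σ) *
          (partialL u σ (z ^ 3 / l) - partialL u σ (z ^ 2))
          = ∑ k ∈ Ioc (z ^ 2) (z ^ 3 / l), v l * (l : ℝ) ^ (-σ) * (u k * (k : ℝ) ^ (-σ)) := by
        intro l hl
        have hl := mem_Ioc.1 hl
        have : z ^ 2 ≤ z ^ 3 / l := by
          rw [Nat.le_div_iff_mul_le hl.1, pow_succ z 2]
          exact Nat.mul_le_mul_left _ hl.2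
        rw [partialL, partialL, ← Finset.sum_Ioc_consecutive _ (Nat.zero_le _) this,
          add_sub_cancel_left, mul_sum]
      rw [sum_congr rfl this]
      simp_rw [partialL, mul_sum]
      rw [Finset.sum_comm' (t' := Ioc 0 z) (s' := fun l ↦ Ioc (z ^ 2) (z ^ 3 / l))]
      · refine sum_congr rfl fun l _ ↦ sum_congr rfl fun k _ ↦ by ring
      · intro k l
        simp only [mem_Ioc]
        constructor
        · rintro ⟨⟨h1, h2⟩, h3, h4⟩
          have hk : 0 < k := by omega
          rw [Nat.le_div_iff_mul_le hk] at h4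
          refine ⟨⟨h1, ?_⟩, h3, ?_⟩
          · rw [Nat.le_div_iff_mul_le h3]; linarith
          · by_contra hcon
            have : z * z ^ 2 < l * k := Nat.mul_lt_mul'' (by omega) h1
            have e3 : z * z ^ 2 = z ^ 3 := by ring
            omega
        · rintro ⟨⟨h1, h2⟩, h3, h4⟩
          have hk : 0 < k := by omega
          rw [Nat.le_div_iff_mul_le h3] at h2
          refine ⟨⟨h1, ?_⟩, h3, ?_⟩
          · nlinarith
          · rw [Nat.le_div_iff_mul_le hk]; linarith
    rw [hswap]
    calc _ ≤ ∑ l ∈ Ioc 0 z, |v l * (l : ℝ) ^ (-σ) *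
          (partialL u σ (z ^ 3 / l) - partialL u σ (z ^ 2))| := abs_sum_le_sum_abs _ _
      _ ≤ ∑ l ∈ Ioc 0 z, 4 * P * (z : ℝ) ^ (-(198 / 100) : ℝ) := by
        refine sum_le_sum fun l hl ↦ ?_
        have hl := mem_Ioc.1 hl
        have hl1 : (1 : ℝ) ≤ l := by exact_mod_cast hl.1
        have : z ^ 2 ≤ z ^ 3 / l := by
          rw [Nat.le_div_iff_mul_le hl.1, pow_succ z 2]
          exact Nat.mul_le_mul_left _ hl.2
        rw [abs_mul, abs_mul, abs_of_nonneg (show 0 ≤ (l : ℝ) ^ (-σ) by positivity)]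
        calc _ ≤ 2 * 1 * (2 * P * (z : ℝ) ^ (-(198 / 100) : ℝ)) := by
              gcongr
              · exact hv l
              · exact Real.rpow_le_one_of_one_le_of_nonpos hl1 (by linarith)
              · exact htail _ this
          _ = _ := by ring
      _ = 4 * P * ((z : ℝ) * (z : ℝ) ^ (-(198 / 100) : ℝ)) := by simp; ring
      _ ≤ 4 * P * w := by
        gcongr
        nth_rewrite 1 [← Real.rpow_one (z : ℝ)]
        rw [← Real.rpow_add hz0]
        exact pw _ (by norm_num)
  have hLv : |limL v σ| ≤ 2 * Q := by
    have := abs_limL_sub_partialL_le hQ hσ0 0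
    simpa [partialL] using this
  have hthird : |(partialL u σ (z ^ 2) - limL u σ) * limL v σ| ≤ 4 * (P * Q) * w := by
    have h1 : |limL u σ - partialL u σ (z ^ 2)| ≤ 2 * P * (z : ℝ) ^ (-(198 / 100) : ℝ) := by
      refine le_of_tendsto ((tendsto_partialL hP hσ0).sub_const _).abs ?_
      filter_upwards [eventually_ge_atTop (z ^ 2)] with b hb
      exact htail b hb
    have h2 := pw (-(198 / 100)) (by norm_num)
    rw [abs_mul, abs_sub_comm]
    calc _ ≤ 2 * P * w * (2 * Q) := by gcongr; exact h1.trans (by gcongr)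
      _ = _ := by ring
  rw [← Finset.sum_Ioc_consecutive _ (Nat.zero_le _) hle]
  set A := ∑ k ∈ Ioc 0 (z ^ 2), u k * (k : ℝ) ^ (-σ) * partialL v σ (z ^ 3 / k)
  set B := ∑ k ∈ Ioc (z ^ 2) (z ^ 3), u k * (k : ℝ) ^ (-σ) * partialL v σ (z ^ 3 / k)
  have hsplit : A + B - limL u σ * limL v σ = (A - partialL u σ (z ^ 2) * limL v σ) + B
      + (partialL u σ (z ^ 2) - limL u σ) * limL v σ := by ring
  rw [hsplit]
  have h1 : Q * w ≤ P * Q * w := by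
    rw [mul_assoc]; exact le_mul_of_one_le_left (by positivity) hP1
  have h2 : P * w ≤ P * Q * w := by
    rw [mul_right_comm]; exact le_mul_of_one_le_right (by positivity) hQ1
  have := abs_add_le (A - partialL u σ (z ^ 2) * limL v σ + B)
    ((partialL u σ (z ^ 2) - limL u σ) * limL v σ)
  have := abs_add_le (A - partialL u σ (z ^ 2) * limL v σ) B
  linarith

/-- The function `n ↦ w (n / p)` supported on multiples of `p`. -/
noncomputable def dil (p : ℕ) (w : ℕ → ℝ) (n : ℕ) : ℝ := if p ∣ n then w (n / p) else 0

lemma partialL_congr {u v : ℕ → ℝ} (h : ∀ n, n ≠ 0 → u n = v n) (σ : ℝ) (N : ℕ) :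
    partialL u σ N = partialL v σ N := by
  refine Finset.sum_congr rfl fun n hn ↦ ?_
  rw [h n (by have := (mem_Ioc.1 hn).1; omega)]

lemma partialL_dil {p : ℕ} (hp : 0 < p) (w : ℕ → ℝ) (σ : ℝ) (N : ℕ) :
    partialL (dil p w) σ N = (p : ℝ) ^ (-σ) * partialL w σ (N / p) := by
  have h : ∀ n, dil p w n * (n : ℝ) ^ (-σ)
      = if p ∣ n then w (n / p) * (n : ℝ) ^ (-σ) else 0 := by
    intro n; unfold dil; split_ifs <;> simp
  rw [partialL, partialL, Finset.sum_congr rfl fun n _ ↦ h n, ← Finset.sum_filter, Finset.mul_sum]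
  symm
  refine Finset.sum_bij' (fun k _ ↦ p * k) (fun n _ ↦ n / p) ?_ ?_ ?_ ?_ ?_
  · intro k hk
    rw [mem_Ioc, Nat.le_div_iff_mul_le hp] at hk
    rw [mem_filter, mem_Ioc]
    exact ⟨⟨Nat.mul_pos hp hk.1, by linarith [mul_comm p k]⟩, dvd_mul_right _ _⟩
  · intro n hn
    rw [mem_filter, mem_Ioc] at hn
    rw [mem_Ioc]
    exact ⟨Nat.div_pos (Nat.le_of_dvd hn.1.1 hn.2) hp, Nat.div_le_div_right hn.1.2⟩
  · intro k _
    exact Nat.mul_div_cancel_left k hp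
  · intro n hn
    exact Nat.mul_div_cancel' (mem_filter.1 hn).2
  · intro k hk
    rw [Nat.mul_div_cancel_left k hp]
    push_cast
    rw [Real.mul_rpow (by positivity) (by positivity)]
    ring

lemma partialL_sub_const_mul (u v : ℕ → ℝ) (c σ : ℝ) (N : ℕ) :
    partialL (fun n ↦ u n - c * v n) σ N = partialL u σ N - c * partialL v σ N := by
  simp only [partialL, Finset.mul_sum, ← Finset.sum_sub_distrib]
  exact Finset.sum_congr rfl fun n _ ↦ by ring

lemma kron_mul_prime_sq (D : ℤ) {p n : ℕ} (hp : p.Prime) (hn : n ≠ 0) :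
    kron (D * (p : ℤ) ^ 2) n = kron D n - kron D p * dil p (kron D) n := by
  rw [← kron_mul_kron D _ hn, kron_sq p hn]
  by_cases hpn : p ∣ n
  · obtain ⟨k, rfl⟩ := hpn
    have hk : k ≠ 0 := by rintro rfl; simp at hn
    rw [if_neg, dil, if_pos (dvd_mul_right _ _), Nat.mul_div_cancel_left _ hp.pos,
      kron_mul D hp.ne_zero hk]
    · ring
    · intro h
      have := Nat.Coprime.coprime_dvd_left (dvd_mul_right p k) h
      rw [Nat.coprime_mul_iff_right] at this
      exact hp.one_lt.ne' ((Nat.coprime_self p).1 this.2)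
  · rw [dil, if_neg hpn]
    have hc : n.Coprime p := ((hp.coprime_iff_not_dvd).2 hpn).symm
    by_cases h2 : n.Coprime 2
    · rw [if_pos (Nat.Coprime.mul_right h2 hc)]; ring
    · have : kron D n = 0 := by
        rw [kron_eq_zero_iff D hn]
        intro h
        exact h2 (Nat.Coprime.coprime_dvd_right (dvd_mul_right _ _) h)
      rw [this]; ring

lemma partialL_kron_mul_prime_sq (D : ℤ) {p : ℕ} (hp : p.Prime) (σ : ℝ) (N : ℕ) :
    partialL (kron (D * (p : ℤ) ^ 2)) σ N
      = partialL (kron D) σ N - kron D p * ((p : ℝ) ^ (-σ) * partialL (kron D) σ (N / p)) := by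
  rw [partialL_congr (fun n hn ↦ kron_mul_prime_sq D hp hn), partialL_sub_const_mul,
    partialL_dil hp.pos]

lemma tendsto_nat_div_atTop {p : ℕ} (hp : 0 < p) : Tendsto (fun N : ℕ ↦ N / p) atTop atTop :=
  Nat.tendsto_div_const_atTop hp.ne'

lemma prime_rpow_neg_lt_one {p : ℕ} (hp : p.Prime) {σ : ℝ} (hσ : 0 < σ) :
    (p : ℝ) ^ (-σ) < 1 :=
  Real.rpow_lt_one_of_one_lt_of_neg (by exact_mod_cast hp.one_lt) (by linarith)

lemma euler_factor_pos (D : ℤ) {p : ℕ} (hp : p.Prime) {σ : ℝ} (hσ : 0 < σ) :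
    0 < 1 - kron D p * (p : ℝ) ^ (-σ) := by
  have h1 := prime_rpow_neg_lt_one hp hσ
  have h2 : 0 ≤ (p : ℝ) ^ (-σ) := by positivity
  rcases kron_trichotomy D p with h | h | h <;> rw [h] <;> linarith

lemma exists_tendsto_partialL_kron_mul_sq {σ : ℝ} (hσ : 0 < σ) (e : ℕ) (he : e ≠ 0) :
    ∀ D : ℤ, ∃ E : ℝ, 0 < E ∧ ∀ l, Tendsto (partialL (kron D) σ) atTop (𝓝 l) →
      Tendsto (partialL (kron (D * (e : ℤ) ^ 2)) σ) atTop (𝓝 (E * l)) := by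
  induction e using induction_on_primes with
  | zero => exact absurd rfl he
  | one => exact fun D ↦ ⟨1, one_pos, fun l h ↦ by simpa using h⟩
  | prime_mul p a hp ih =>
    intro D
    obtain ⟨E, hE, h⟩ := ih (by rintro rfl; simp at he) D
    refine ⟨(1 - kron (D * (a : ℤ) ^ 2) p * (p : ℝ) ^ (-σ)) * E,
      mul_pos (euler_factor_pos _ hp hσ) hE, fun l hl ↦ ?_⟩
    have h1 := h l hl
    have h2 := h1.sub (((h1.comp (tendsto_nat_div_atTop hp.pos)).const_mul
      ((p : ℝ) ^ (-σ))).const_mul (kron (D * (a : ℤ) ^ 2) p))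
    have e1 : D * ((p * a : ℕ) : ℤ) ^ 2 = D * (a : ℤ) ^ 2 * (p : ℤ) ^ 2 := by push_cast; ring
    rw [e1]
    refine (h2.congr fun N ↦ ?_).trans (le_of_eq ?_)
    · rw [partialL_kron_mul_prime_sq _ hp]; rfl
    · congr 1; ring

/-- A periodic sequence whose Dirichlet series is `(1 - 2 ^ (1 - s))` times that of the
principal character modulo `2 * d`. -/
noncomputable def psi (d : ℕ) (n : ℕ) : ℝ :=
  kron ((d : ℤ) ^ 2) n - 2 * dil 2 (kron ((d : ℤ) ^ 2)) n

lemma partialL_psi (d : ℕ) (σ : ℝ) (N : ℕ) :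
    partialL (psi d) σ N = partialL (kron ((d : ℤ) ^ 2)) σ N
      - 2 * ((2 : ℝ) ^ (-σ) * partialL (kron ((d : ℤ) ^ 2)) σ (N / 2)) := by
  have := partialL_sub_const_mul (kron ((d : ℤ) ^ 2)) (dil 2 (kron ((d : ℤ) ^ 2))) 2 σ N
  rw [partialL_dil two_pos] at this
  exact_mod_cast this

lemma kron_sq_eq {d n : ℕ} (hn : n ≠ 0) : kron ((d : ℤ) ^ 2) n = 0 ∨ kron ((d : ℤ) ^ 2) n = 1 := by
  rw [kron_sq d hn]; split_ifs <;> simp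

lemma abs_psi_le {d n : ℕ} (hn : n ≠ 0) : |psi d n| ≤ 2 := by
  unfold psi dil
  split_ifs with h
  · have h2 : n / 2 ≠ 0 := by omega
    rcases kron_sq_eq (d := d) hn with h | h <;> rcases kron_sq_eq (d := d) h2 with h' | h' <;>
      rw [h, h'] <;> norm_num
  · rcases kron_sq_eq (d := d) hn with h | h <;> rw [h] <;> norm_num

lemma psi_zero_le (d : ℕ) : |psi d 0| ≤ 2 := by
  have h := abs_kron_le_one ((d : ℤ) ^ 2) 0
  rw [abs_le] at h ⊢
  simp only [psi, dil, dvd_zero, if_true, Nat.zero_div]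
  constructor <;> linarith

lemma sum_eq_partialL_zero (u : ℕ → ℝ) (N : ℕ) : ∑ n ∈ Ioc 0 N, u n = partialL u 0 N := by
  simp [partialL]

lemma abs_sum_psi_le {d : ℕ} (hd : d ≠ 0) (b : ℕ) :
    |∑ n ∈ Ioc 0 b, psi d n| ≤ 16 * (d : ℝ) ^ 2 := by
  have hnat : ((d : ℤ) ^ 2).natAbs = d ^ 2 := by simp [Int.natAbs_pow]
  have hper : ∀ n, n ≠ 0 → kron ((d : ℤ) ^ 2) (n + 4 * d ^ 2) = kron ((d : ℤ) ^ 2) n := by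
    intro n hn
    have := kron_add_period ((d : ℤ) ^ 2) hn
    rwa [hnat] at this
  have hd0 : 0 < d ^ 2 := by positivity
  have h := abs_sum_periodic_le (u := psi d) (q := 8 * d ^ 2) (B := 2) (by positivity) ?_ ?_ ?_ b
  · push_cast at h; linarith
  · intro n hn
    have e1 : kron ((d : ℤ) ^ 2) (n + 8 * d ^ 2) = kron ((d : ℤ) ^ 2) n := by
      rw [show n + 8 * d ^ 2 = n + 4 * d ^ 2 + 4 * d ^ 2 by ring, hper _ (by omega), hper _ hn]
    unfold psi dil
    rw [e1]
    by_cases h2 : 2 ∣ n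
    · rw [if_pos (by omega), if_pos h2, show (n + 8 * d ^ 2) / 2 = n / 2 + 4 * d ^ 2 by omega,
        hper _ (by omega)]
    · rw [if_neg (by omega), if_neg h2]
  · rw [sum_eq_partialL_zero, partialL_psi, show 8 * d ^ 2 / 2 = 4 * d ^ 2 by omega,
      ← sum_eq_partialL_zero, ← sum_eq_partialL_zero,
      ← Finset.sum_Ioc_consecutive _ (Nat.zero_le (4 * d ^ 2))
        (show 4 * d ^ 2 ≤ 8 * d ^ 2 by omega)]
    have : ∑ n ∈ Ioc (4 * d ^ 2) (8 * d ^ 2), kron ((d : ℤ) ^ 2) n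
        = ∑ n ∈ Ioc 0 (4 * d ^ 2), kron ((d : ℤ) ^ 2) n := by
      symm
      refine Finset.sum_bij' (fun n _ ↦ n + 4 * d ^ 2) (fun n _ ↦ n - 4 * d ^ 2) ?_ ?_ ?_ ?_ ?_
      · intro n hn; rw [mem_Ioc] at hn ⊢; omega
      · intro n hn; rw [mem_Ioc] at hn ⊢; omega
      · intro n hn; simp
      · intro n hn; rw [mem_Ioc] at hn; omega
      · intro n hn; rw [mem_Ioc] at hn; rw [hper n (by omega)]
    rw [this, neg_zero, Real.rpow_zero]; ring
  · intro n
    rcases eq_or_ne n 0 with rfl | hn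
    · exact psi_zero_le d
    · exact abs_psi_le hn

/-- The coefficients of the alternating zeta series. -/
noncomputable def alt (n : ℕ) : ℝ := (-1) ^ (n + 1)

lemma psi_one {n : ℕ} (hn : n ≠ 0) : psi 1 n = alt n - 1 * dil 2 alt n := by
  have h1 : ∀ k, k ≠ 0 → kron (((1 : ℕ) : ℤ) ^ 2) k = if k % 2 = 1 then 1 else 0 := by
    intro k hk
    rw [kron_sq 1 hk]
    simp only [mul_one, Nat.coprime_two_right, Nat.odd_iff]
  unfold psi dil alt
  rw [h1 n hn]
  have h4 : n % 4 = 0 ∨ n % 4 = 1 ∨ n % 4 = 2 ∨ n % 4 = 3 := by omega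
  rcases h4 with h | h | h | h
  · rw [if_neg (by omega), if_pos (by omega), if_pos (by omega), h1 _ (by omega),
      if_neg (by omega), Odd.neg_one_pow (by rw [Nat.odd_iff]; omega),
      Odd.neg_one_pow (by rw [Nat.odd_iff]; omega)]; norm_num
  · rw [if_pos (by omega), if_neg (by omega), if_neg (by omega),
      Even.neg_one_pow (by rw [Nat.even_iff]; omega)]; norm_num
  · rw [if_neg (by omega), if_pos (by omega), if_pos (by omega), h1 _ (by omega),
      if_pos (by omega), Odd.neg_one_pow (by rw [Nat.odd_iff]; omega),
      Even.neg_one_pow (by rw [Nat.even_iff]; omega)]; norm_num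
  · rw [if_pos (by omega), if_neg (by omega), if_neg (by omega),
      Even.neg_one_pow (by rw [Nat.even_iff]; omega)]; norm_num

lemma abs_sum_alt_le (b : ℕ) : |∑ n ∈ Ioc 0 b, alt n| ≤ 1 := by
  have : ∑ n ∈ Ioc 0 b, alt n = if b % 2 = 1 then 1 else 0 := by
    induction b with
    | zero => simp
    | succ k ih =>
      rw [Finset.sum_Ioc_succ_top (Nat.zero_le k), ih, alt]
      rcases Nat.mod_two_eq_zero_or_one k with h | h
      · rw [if_neg (by omega), if_pos (by omega), Even.neg_one_pow (by rw [Nat.even_iff]; omega)]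
        norm_num
      · rw [if_pos (by omega), if_neg (by omega), Odd.neg_one_pow (by rw [Nat.odd_iff]; omega)]
        norm_num
  rw [this]; split_ifs <;> norm_num

lemma limL_alt_pos {σ : ℝ} (hσ : 0 < σ) : 0 < limL alt σ := by
  have hlt : (2 : ℝ) ^ (-σ) < 1 := Real.rpow_lt_one_of_one_lt_of_neg (by norm_num) (by linarith)
  have hM : ∀ M : ℕ, 1 - (2 : ℝ) ^ (-σ) ≤ partialL alt σ (2 * (M + 1)) := by
    intro M
    induction M with
    | zero => norm_num [partialL, Finset.sum_Ioc_succ_top, alt]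
    | succ k ih =>
      refine ih.trans ?_
      have : partialL alt σ (2 * (k + 1 + 1)) = partialL alt σ (2 * (k + 1))
          + alt (2 * (k + 1) + 1) * ((2 * (k + 1) + 1 : ℕ) : ℝ) ^ (-σ)
          + alt (2 * (k + 1) + 1 + 1) * ((2 * (k + 1) + 1 + 1 : ℕ) : ℝ) ^ (-σ) := by
        rw [show 2 * (k + 1 + 1) = 2 * (k + 1) + 1 + 1 by ring]
        simp only [partialL]
        rw [Finset.sum_Ioc_succ_top (Nat.zero_le _), Finset.sum_Ioc_succ_top (Nat.zero_le _)]
      rw [this, alt, alt, Even.neg_one_pow (by rw [Nat.even_iff]; omega),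
        Odd.neg_one_pow (by rw [Nat.odd_iff]; omega)]
      have : ((2 * (k + 1) + 1 + 1 : ℕ) : ℝ) ^ (-σ) ≤ ((2 * (k + 1) + 1 : ℕ) : ℝ) ^ (-σ) :=
        Real.rpow_le_rpow_of_nonpos (by positivity) (by push_cast; linarith) (by linarith)
      linarith
  have ht := (tendsto_partialL abs_sum_alt_le hσ).comp
    (show Tendsto (fun M : ℕ ↦ 2 * (M + 1)) atTop atTop from
      tendsto_atTop_mono (fun M ↦ by simp only [id]; omega) tendsto_id)
  have := ge_of_tendsto' ht hM
  linarith

lemma exists_tendsto_partialL_psi {σ : ℝ} (hσ : 0 < σ) (d : ℕ) (hd : d ≠ 0) :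
    ∃ E : ℝ, 0 < E ∧ Tendsto (partialL (psi d) σ) atTop (𝓝 E) := by
  induction d using induction_on_primes with
  | zero => exact absurd rfl hd
  | one =>
    have hlt : (2 : ℝ) ^ (-σ) < 1 := Real.rpow_lt_one_of_one_lt_of_neg (by norm_num) (by linarith)
    have ht := tendsto_partialL abs_sum_alt_le hσ
    refine ⟨limL alt σ - 1 * ((2 : ℝ) ^ (-σ) * limL alt σ), ?_, ?_⟩
    · nlinarith [limL_alt_pos hσ]
    · refine (ht.sub (((ht.comp (tendsto_nat_div_atTop two_pos)).const_mul
        ((2 : ℝ) ^ (-σ))).const_mul 1)).congr fun N ↦ ?_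
      rw [partialL_congr (fun n hn ↦ psi_one hn), partialL_sub_const_mul, partialL_dil two_pos]
      simp
  | prime_mul p a hp ih =>
    obtain ⟨E, hE, h⟩ := ih (by rintro rfl; simp at hd)
    refine ⟨E - kron ((a : ℤ) ^ 2) p * ((p : ℝ) ^ (-σ) * E), ?_, ?_⟩
    · have := mul_pos (euler_factor_pos ((a : ℤ) ^ 2) hp hσ) hE
      linarith
    · refine (h.sub (((h.comp (tendsto_nat_div_atTop hp.pos)).const_mul
        ((p : ℝ) ^ (-σ))).const_mul (kron ((a : ℤ) ^ 2) p))).congr fun N ↦ ?_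
      simp only [Function.comp_apply]
      have e1 : ((p * a : ℕ) : ℤ) ^ 2 = (a : ℤ) ^ 2 * (p : ℤ) ^ 2 := by push_cast; ring
      rw [partialL_psi, partialL_psi, partialL_psi, e1, partialL_kron_mul_prime_sq _ hp,
        partialL_kron_mul_prime_sq _ hp, Nat.div_div_eq_div_mul, Nat.div_div_eq_div_mul,
        mul_comm 2 p]
      ring

lemma limL_psi_pos {σ : ℝ} (hσ : 0 < σ) {d : ℕ} (hd : d ≠ 0) : 0 < limL (psi d) σ := by
  obtain ⟨E, hE, h⟩ := exists_tendsto_partialL_psi hσ d hd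
  rwa [tendsto_nhds_unique (tendsto_partialL (abs_sum_psi_le hd) hσ) h]

lemma limL_kron_eq_of_one_lt {D : ℤ} [NeZero (4 * D.natAbs)] (hD : D ≠ 0) {a : ℕ} (ha : a ≠ 0) (h : kron D a = -1)
    {σ : ℝ} (hσ : 1 < σ) :
    (limL (kron D) σ : ℂ) = (kronChar D hD).LFunction (σ : ℂ) := by
  have hs : 1 < (σ : ℂ).re := by simpa using hσ
  rw [DirichletCharacter.LFunction_eq_LSeries _ hs]
  have hsum := (DirichletCharacter.LSeriesSummable_of_one_lt_re (kronChar D hD) hs).LSeriesHasSum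
  have ht : Tendsto (fun N : ℕ ↦ ∑ n ∈ range (N + 1),
      LSeries.term (fun n ↦ kronChar D hD n) σ n) atTop
      (𝓝 (LSeries (fun n ↦ kronChar D hD n) σ)) :=
    (hsum.tendsto_sum_nat).comp (tendsto_add_atTop_nat 1)
  have ht2 : Tendsto (fun N ↦ (partialL (kron D) σ N : ℂ)) atTop (𝓝 (limL (kron D) σ : ℂ)) :=
    (Complex.continuous_ofReal.tendsto _).comp
      (tendsto_partialL (abs_sum_kron_le D hD ha h) (by linarith))
  refine tendsto_nhds_unique ht2 (ht.congr fun N ↦ ?_)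
  rw [Finset.sum_range_succ', LSeries.term_zero, add_zero, partialL, Complex.ofReal_sum]
  symm
  refine Finset.sum_bij' (fun n _ ↦ n - 1) (fun n _ ↦ n + 1) ?_ ?_ ?_ ?_ ?_
  · intro n hn; rw [mem_Ioc] at hn; rw [mem_range]; omega
  · intro n hn; rw [mem_range] at hn; rw [mem_Ioc]; omega
  · intro n hn; rw [mem_Ioc] at hn; omega
  · intro n hn; simp
  · intro n hn
    have hn0 : n ≠ 0 := by rw [mem_Ioc] at hn; omega
    rw [Nat.sub_add_cancel (by omega), LSeries.term_of_ne_zero hn0, kronChar_natCast D hD hn0,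
      Real.rpow_neg (by positivity), Complex.ofReal_mul, Complex.ofReal_inv, div_eq_mul_inv,
      Complex.ofReal_cpow (by positivity)]
    simp

lemma limL_kron_ne_zero {D : ℤ} (hD : D ≠ 0) {a : ℕ} (ha : a ≠ 0) (h : kron D a = -1)
    {σ : ℝ} (hσ : 1 ≤ σ) : limL (kron D) σ ≠ 0 := by
  have : NeZero (4 * D.natAbs) := ⟨by simpa using hD⟩
  have hχ := kronChar_ne_one D hD ha h
  have heq : (limL (kron D) σ : ℂ) = (kronChar D hD).LFunction (σ : ℂ) := by
    rcases hσ.eq_or_lt with rfl | hlt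
    · have hc : Tendsto (fun x : ℝ ↦ (limL (kron D) x : ℂ)) (𝓝[>] 1)
          (𝓝 (limL (kron D) 1 : ℂ)) :=
        (Complex.continuous_ofReal.tendsto _).comp
          ((continuousOn_limL (abs_sum_kron_le D hD ha h) one_pos 1 (by simp)).mono_left
            (nhdsWithin_mono _ Set.Ioi_subset_Ici_self))
      have hc2 : Tendsto (fun x : ℝ ↦ (kronChar D hD).LFunction (x : ℂ)) (𝓝[>] 1)
          (𝓝 ((kronChar D hD).LFunction ((1 : ℝ) : ℂ))) :=
        (((DirichletCharacter.differentiable_LFunction hχ).continuous.comp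
          Complex.continuous_ofReal).tendsto _).mono_left nhdsWithin_le_nhds
      refine tendsto_nhds_unique hc (hc2.congr' ?_)
      filter_upwards [self_mem_nhdsWithin] with x hx
      exact (limL_kron_eq_of_one_lt hD ha h hx).symm
    · exact limL_kron_eq_of_one_lt hD ha h hlt
  intro h0
  rw [h0] at heq
  exact DirichletCharacter.LFunction_ne_zero_of_one_le_re (kronChar D hD) (Or.inl hχ)
    (by simpa using hσ) heq.symm

lemma limL_kron_two_pos {D : ℤ} (hD : D ≠ 0) {a : ℕ} (ha : a ≠ 0) (h : kron D a = -1) :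
    0 < limL (kron D) 2 := by
  have hN : ∀ N : ℕ, ((N + 3 : ℕ) : ℝ)⁻¹ + 1 / 4 ≤ partialL (kron D) 2 (N + 3) := by
    have h2 : kron D 2 = 0 := by rw [kron_eq_zero_iff D two_ne_zero]; simp
    have key : ∀ n : ℕ, -((n : ℝ) ^ 2)⁻¹ ≤ kron D n * (n : ℝ) ^ (-2 : ℝ) := by
      intro n
      have := abs_le.1 (abs_kron_le_one D n)
      rw [Real.rpow_neg (by positivity)]
      norm_cast
      have h3 : (0 : ℝ) ≤ ((n ^ 2 : ℕ) : ℝ)⁻¹ := by positivity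
      push_cast at h3 ⊢
      nlinarith
    intro N
    induction N with
    | zero =>
      have h3 := key 3
      norm_num [partialL, Finset.sum_Ioc_succ_top, h2, kron_one] at h3 ⊢
      linarith
    | succ k ih =>
      have h3 := key (k + 3 + 1)
      rw [show k + 1 + 3 = k + 3 + 1 by ring]
      have e : partialL (kron D) 2 (k + 3 + 1) = partialL (kron D) 2 (k + 3)
          + kron D (k + 3 + 1) * ((k + 3 + 1 : ℕ) : ℝ) ^ (-2 : ℝ) := by
        simp only [partialL]
        rw [Finset.sum_Ioc_succ_top (Nat.zero_le _)]
      rw [e]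
      have h5 : ((k + 3 + 1 : ℕ) : ℝ)⁻¹ + (((k + 3 + 1 : ℕ) : ℝ) ^ 2)⁻¹ ≤ ((k + 3 : ℕ) : ℝ)⁻¹ := by
        push_cast
        rw [← sub_nonneg]
        have : ((k : ℝ) + 3)⁻¹ - (((k : ℝ) + 3 + 1)⁻¹ + (((k : ℝ) + 3 + 1) ^ 2)⁻¹)
            = (((k : ℝ) + 3) * ((k : ℝ) + 3 + 1) ^ 2)⁻¹ := by
          field_simp; ring
        rw [this]; positivity
      linarith
  have ht := (tendsto_partialL (abs_sum_kron_le D hD ha h) two_pos).comp (tendsto_add_atTop_nat 3)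
  have := ge_of_tendsto' ht fun N ↦ (show (1 / 4 : ℝ) ≤ _ from
    le_trans (by have : (0 : ℝ) ≤ ((N + 3 : ℕ) : ℝ)⁻¹ := by positivity
                 linarith) (hN N))
  linarith

/-- The divisor sum of the character `kron (-d)`. -/
noncomputable def divSum (d n : ℕ) : ℝ := ∑ l ∈ n.divisors, kron (-d) l

/-- The product of the local factors `bHp` at the primes dividing `n`. -/
noncomputable def localProd (d n : ℕ) : ℝ :=
  ((∏ p ∈ n.primeFactors, bHp d p (n.factorization p) : ℤ) : ℝ)

lemma kron_eq_jacobiSym (D : ℤ) {n : ℕ} (h : n.Coprime 2) : kron D n = (jacobiSym D n : ℝ) := by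
  have h4 : jacobiSym 4 n = 1 := by
    rw [show (4 : ℤ) = 2 ^ 2 by norm_num]
    exact jacobiSym.sq_one' (by rw [Int.gcd_comm]; exact_mod_cast h)
  rw [kron, jacobiSym.mul_left, h4, one_mul]

lemma kron_pow (D : ℤ) {p : ℕ} (hp : p ≠ 0) (i : ℕ) : kron D (p ^ i) = kron D p ^ i := by
  induction i with
  | zero => simp [kron_one]
  | succ k ih => rw [pow_succ, pow_succ, kron_mul D (pow_ne_zero _ hp) hp, ih]

lemma divSum_mul (d : ℕ) {m n : ℕ} (h : m.Coprime n) :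
    divSum d (m * n) = divSum d m * divSum d n := by
  unfold divSum
  rw [Nat.divisors_mul, Finset.mul_def, Finset.sum_image h.mul_injOn_divisors,
    Finset.sum_product, Finset.sum_mul_sum]
  refine Finset.sum_congr rfl fun i hi ↦ Finset.sum_congr rfl fun j hj ↦ ?_
  exact kron_mul _ (Nat.pos_of_mem_divisors hi).ne' (Nat.pos_of_mem_divisors hj).ne'

lemma localProd_mul (d : ℕ) {m n : ℕ} (h : m.Coprime n) :
    localProd d (m * n) = localProd d m * localProd d n := by
  have key : ∀ k : ℕ, localProd d k = ((k.factorization.prod fun p e ↦ bHp d p e : ℤ) : ℝ) :=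
    fun k ↦ rfl
  rw [key, key, key, Nat.factorization_mul_of_coprime h,
    Finsupp.prod_add_index_of_disjoint (by simpa using h.disjoint_primeFactors), Int.cast_mul]

lemma localProd_prime_pow (d : ℕ) {p k : ℕ} (hp : p.Prime) (hk : 0 < k) (h2 : p.Coprime 2) :
    localProd d (p ^ k) = ∑ t ∈ range (2 * k + 1), kron (-d) p ^ t := by
  rw [localProd, Nat.primeFactors_prime_pow hk.ne' hp, Finset.prod_singleton,
    Nat.Prime.factorization_pow hp, kron_eq_jacobiSym _ h2, bHp]
  simp

lemma divSum_localProd {d n : ℕ} (hn : n ≠ 0) (hc : n.Coprime (2 * d)) :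
    0 ≤ divSum d n ∧ 1 ≤ localProd d n ∧
      ((divSum d n ≤ 1 ∧ localProd d n = 1 ∧ (¬ IsSquare n → divSum d n ≤ 0)) ∨
        divSum d n + 1 ≤ localProd d n) := by
  induction n using Nat.recOnPosPrimePosCoprime with
  | zero => exact absurd rfl hn
  | one =>
    have h1 : divSum d 1 = 1 := by simp [divSum, kron_one]
    have h2 : localProd d 1 = 1 := by simp [localProd]
    rw [h1, h2]
    refine ⟨zero_le_one, le_rfl, Or.inl ⟨le_rfl, rfl, fun h ↦ absurd (IsSquare.one) h⟩⟩
  | prime_pow p k hp hk =>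
    have hc' : p.Coprime (2 * d) := (Nat.coprime_pow_left_iff hk p (2 * d)).1 hc
    have hkr : kron (-d) p ≠ 0 := by
      rw [Ne, kron_eq_zero_iff _ hp.ne_zero]
      simpa using hc'
    rw [localProd_prime_pow d hp hk (hc'.coprime_dvd_right (dvd_mul_right _ _)), divSum,
      Nat.sum_divisors_prime_pow hp, Finset.sum_congr rfl fun i _ ↦ kron_pow _ hp.ne_zero i]
    have hk1 : (1 : ℝ) ≤ k := by exact_mod_cast hk
    rcases kron_trichotomy (-d) p with h | h | h
    · exact absurd h hkr
    · rw [h]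
      simp only [one_pow, Finset.sum_const, card_range, nsmul_eq_mul, mul_one]
      push_cast
      refine ⟨by linarith, by linarith, Or.inr (by linarith)⟩
    · rw [h, neg_one_geom_sum, neg_one_geom_sum,
        if_neg (show ¬ Even (2 * k + 1) by simp)]
      refine ⟨by split_ifs <;> norm_num, le_rfl, Or.inl ⟨by split_ifs <;> norm_num, rfl, ?_⟩⟩
      intro hsq
      rw [if_pos]
      by_contra hev
      rw [Nat.not_even_iff_odd, Nat.odd_add_one, Nat.not_odd_iff_even] at hev
      exact hsq (hev.isSquare_pow p)
  | coprime a b ha hb hab iha ihb =>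
    obtain ⟨a1, a2, a3⟩ := iha (by omega) (hc.coprime_dvd_left (dvd_mul_right _ _))
    obtain ⟨b1, b2, b3⟩ := ihb (by omega) (hc.coprime_dvd_left (dvd_mul_left _ _))
    rw [divSum_mul d hab, localProd_mul d hab]
    refine ⟨mul_nonneg a1 b1, one_le_mul_of_one_le_of_one_le a2 b2, ?_⟩
    rcases a3 with ⟨a4, a5, a6⟩ | a3 <;> rcases b3 with ⟨b4, b5, b6⟩ | b3
    · refine Or.inl ⟨mul_le_one₀ a4 b1 b4, by rw [a5, b5, one_mul], fun hs ↦ ?_⟩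
      by_cases hsa : IsSquare a
      · have hsb : ¬ IsSquare b := fun h ↦ hs (hsa.mul h)
        exact mul_nonpos_of_nonneg_of_nonpos a1 (b6 hsb)
      · exact mul_nonpos_of_nonpos_of_nonneg (a6 hsa) b1
    · right; rw [a5]; nlinarith
    · right; rw [b5]; nlinarith
    · right; nlinarith

lemma divSum_one (d : ℕ) : divSum d 1 = 1 := by simp [divSum, kron_one]

lemma kron_conv_eq_zero (D E : ℤ) {n : ℕ} (hn : n ≠ 0) {q : ℕ}
    (hq : ∀ k : ℕ, k.Coprime (2 * D.natAbs) → ∀ l : ℕ, l.Coprime (2 * E.natAbs) → k * l = n →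
      n.Coprime q) (h : ¬ n.Coprime q) :
    ∑ k ∈ n.divisors, kron D k * kron E (n / k) = 0 := by
  refine Finset.sum_eq_zero fun k hk ↦ ?_
  have hk0 := (Nat.pos_of_mem_divisors hk).ne'
  have hkn := Nat.dvd_of_mem_divisors hk
  by_contra h0
  have h1 : kron D k ≠ 0 := left_ne_zero_of_mul h0
  have h2 : kron E (n / k) ≠ 0 := right_ne_zero_of_mul h0
  have hl0 : n / k ≠ 0 := by
    have := Nat.div_pos (Nat.le_of_dvd (by omega) hkn) (by omega)
    omega
  rw [Ne, kron_eq_zero_iff _ hk0, not_not] at h1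
  rw [Ne, kron_eq_zero_iff _ hl0, not_not] at h2
  exact h (hq k h1 _ h2 (Nat.mul_div_cancel' hkn))

lemma kron_conv_sq {d n : ℕ} (hn : n ≠ 0) :
    ∑ k ∈ n.divisors, kron (-d) k * kron ((d : ℤ) ^ 2) (n / k)
      = if n.Coprime (2 * d) then divSum d n else 0 := by
  split_ifs with h
  · refine Finset.sum_congr rfl fun k hk ↦ ?_
    have hkn := Nat.dvd_of_mem_divisors hk
    have hk0 := (Nat.pos_of_mem_divisors hk)
    have hl0 := Nat.div_pos (Nat.le_of_dvd (by omega) hkn) hk0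
    rw [kron_sq d hl0.ne', if_pos (h.coprime_dvd_left (Nat.div_dvd_of_dvd hkn)), mul_one]
  · refine kron_conv_eq_zero _ _ hn (fun k hk l hl hkl ↦ ?_) h
    rw [← hkl]
    rw [Int.natAbs_neg, Int.natAbs_natCast] at hk
    rw [Int.natAbs_pow, Int.natAbs_natCast] at hl
    refine Nat.Coprime.mul_left hk (hl.coprime_dvd_right ?_)
    exact Nat.mul_dvd_mul_left 2 (dvd_pow_self d two_ne_zero)

lemma kron_conv_twist {d₁ d₂ n : ℕ} (hn : n ≠ 0) :
    ∑ k ∈ n.divisors, kron (-(d₁ : ℤ) * (d₂ : ℤ) ^ 2) k * kron ((d₁ : ℤ) * d₂) (n / k)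
      = if n.Coprime (2 * (d₁ * d₂)) then kron (-d₁) n * divSum d₂ n else 0 := by
  split_ifs with h
  · have hdiv : divSum d₂ n = ∑ k ∈ n.divisors, kron (-d₂) (n / k) :=
      (Nat.sum_div_divisors n _).symm
    rw [hdiv, Finset.mul_sum]
    refine Finset.sum_congr rfl fun k hk ↦ ?_
    have hkn := Nat.dvd_of_mem_divisors hk
    have hk0 := (Nat.pos_of_mem_divisors hk)
    have hl0 := Nat.div_pos (Nat.le_of_dvd (by omega) hkn) hk0
    have hkc : k.Coprime (2 * d₂) := (h.coprime_dvd_left hkn).coprime_dvd_right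
      (Nat.mul_dvd_mul_left 2 (dvd_mul_left _ _))
    rw [← kron_mul_kron _ _ hk0.ne', kron_sq d₂ hk0.ne', if_pos hkc,
      show (d₁ : ℤ) * d₂ = -d₁ * -d₂ by ring, ← kron_mul_kron _ _ hl0.ne']
    conv_rhs => rw [← Nat.mul_div_cancel' hkn, kron_mul _ hk0.ne' hl0.ne',
      Nat.mul_div_cancel' hkn]
    ring
  · refine kron_conv_eq_zero _ _ hn (fun k hk l hl hkl ↦ ?_) h
    rw [← hkl]
    simp only [Int.natAbs_mul, Int.natAbs_neg, Int.natAbs_pow, Int.natAbs_natCast] at hk hl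
    refine Nat.Coprime.mul_left (hk.coprime_dvd_right ?_) hl
    exact Nat.mul_dvd_mul_left 2 (Nat.mul_dvd_mul_left _ (dvd_pow_self d₂ two_ne_zero))

/-- The local products `localProd d n` are equal to `1` for most `n` prime to `2 * d`. -/
def FewReps (C : ℝ) (d : ℕ) : Prop :=
  ∀ N : ℕ, 1 ≤ N → ∑ n ∈ (Ioc 0 N).filter (fun n ↦ n.Coprime (2 * d)),
    (localProd d n - 1) * (n : ℝ) ^ (-(99 / 100) : ℝ)
      ≤ C * (N : ℝ) ^ (1 / 40 : ℝ) * (d : ℝ) ^ (-(1 / 2) : ℝ)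

lemma FewReps.sum_le {C : ℝ} {d : ℕ} (h : FewReps C d) (hd : 1 ≤ d) {σ : ℝ}
    (hσ : 99 / 100 ≤ σ) {S : Finset ℕ}
    (hS : S ⊆ (Ioc 0 (d ^ 12)).filter (fun n ↦ n.Coprime (2 * d))) :
    ∑ n ∈ S, (localProd d n - 1) * (n : ℝ) ^ (-σ) ≤ C * (d : ℝ) ^ (-(1 / 5) : ℝ) := by
  have hd0 : (0 : ℝ) < d := by exact_mod_cast hd
  have hmem : ∀ n ∈ (Ioc 0 (d ^ 12)).filter (fun n ↦ n.Coprime (2 * d)),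
      0 ≤ localProd d n - 1 ∧ (1 : ℝ) ≤ n := by
    intro n hn
    rw [mem_filter, mem_Ioc] at hn
    exact ⟨sub_nonneg.2 (divSum_localProd (by omega) hn.2).2.1, by exact_mod_cast hn.1.1⟩
  calc ∑ n ∈ S, (localProd d n - 1) * (n : ℝ) ^ (-σ)
      ≤ ∑ n ∈ (Ioc 0 (d ^ 12)).filter (fun n ↦ n.Coprime (2 * d)),
          (localProd d n - 1) * (n : ℝ) ^ (-σ) :=
        Finset.sum_le_sum_of_subset_of_nonneg hS fun n hn _ ↦
          mul_nonneg (hmem n hn).1 (by positivity)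
    _ ≤ ∑ n ∈ (Ioc 0 (d ^ 12)).filter (fun n ↦ n.Coprime (2 * d)),
          (localProd d n - 1) * (n : ℝ) ^ (-(99 / 100) : ℝ) :=
        Finset.sum_le_sum fun n hn ↦ mul_le_mul_of_nonneg_left
          (Real.rpow_le_rpow_of_exponent_le (hmem n hn).2 (by linarith)) (hmem n hn).1
    _ ≤ C * ((d ^ 12 : ℕ) : ℝ) ^ (1 / 40 : ℝ) * (d : ℝ) ^ (-(1 / 2) : ℝ) :=
        h _ (Nat.one_le_pow _ _ hd)
    _ = C * (d : ℝ) ^ (-(1 / 5) : ℝ) := by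
        push_cast
        rw [← Real.rpow_natCast, ← Real.rpow_mul hd0.le, mul_assoc, ← Real.rpow_add hd0]
        norm_num

lemma sum_kron_partialL_psi (d : ℕ) (σ : ℝ) (N : ℕ) :
    ∑ k ∈ Ioc 0 N, kron (-d) k * (k : ℝ) ^ (-σ) * partialL (psi d) σ (N / k)
      = partialL (fun n ↦ if n.Coprime (2 * d) then divSum d n else 0) σ N
        - 2 * (2 : ℝ) ^ (-σ)
          * partialL (fun n ↦ if n.Coprime (2 * d) then divSum d n else 0) σ (N / 2) := by
  have h : ∀ M, ∑ k ∈ Ioc 0 M, kron (-d) k * (k : ℝ) ^ (-σ)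
      * partialL (kron ((d : ℤ) ^ 2)) σ (M / k)
      = partialL (fun n ↦ if n.Coprime (2 * d) then divSum d n else 0) σ M := by
    intro M
    rw [sum_mul_partialL_div]
    refine Finset.sum_congr rfl fun n hn ↦ ?_
    rw [kron_conv_sq (by have := (mem_Ioc.1 hn).1; omega)]
  have h2 : ∑ k ∈ Ioc 0 (N / 2), kron (-d) k * (k : ℝ) ^ (-σ)
      * partialL (kron ((d : ℤ) ^ 2)) σ (N / 2 / k) = ∑ k ∈ Ioc 0 N, kron (-d) k * (k : ℝ) ^ (-σ)
      * partialL (kron ((d : ℤ) ^ 2)) σ (N / 2 / k) := by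
    refine Finset.sum_subset (Ioc_subset_Ioc_right (Nat.div_le_self _ _)) fun k hk hk' ↦ ?_
    rw [mem_Ioc] at hk hk'
    rw [Nat.div_eq_of_lt (by omega)]
    simp [partialL]
  rw [← h, ← h, h2, Finset.mul_sum, ← Finset.sum_sub_distrib]
  refine Finset.sum_congr rfl fun k _ ↦ ?_
  rw [partialL_psi, Nat.div_div_eq_div_mul, Nat.div_div_eq_div_mul, mul_comm k 2]
  ring

lemma sum_isSquare_le {d : ℕ} (hd : 1 ≤ d) {σ : ℝ} (hσ : 99 / 100 ≤ σ) :
    ∑ n ∈ (Ioc (d ^ 12 / 2) (d ^ 12)).filter IsSquare, (n : ℝ) ^ (-σ)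
      ≤ 2 * (d : ℝ) ^ (-(1 / 5) : ℝ) := by
  have hd0 : (0 : ℝ) < d := by exact_mod_cast hd
  have hd1 : (1 : ℝ) ≤ d := by exact_mod_cast hd
  have hcard : #((Ioc (d ^ 12 / 2) (d ^ 12)).filter IsSquare) ≤ d ^ 6 := by
    have : (Ioc (d ^ 12 / 2) (d ^ 12)).filter IsSquare ⊆ (Ioc 0 (d ^ 6)).image fun k ↦ k * k := by
      intro n hn
      rw [mem_filter, mem_Ioc] at hn
      obtain ⟨⟨h1, h2⟩, k, rfl⟩ := hn
      rw [mem_image]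
      refine ⟨k, mem_Ioc.2 ⟨Nat.pos_of_ne_zero (by rintro rfl; simp at h1), ?_⟩, rfl⟩
      by_contra! hlt
      have := Nat.mul_lt_mul'' hlt hlt
      have e : d ^ 6 * d ^ 6 = d ^ 12 := by ring
      omega
    exact (card_le_card this).trans (card_image_le.trans (by simp))
  have hterm : ∀ n ∈ (Ioc (d ^ 12 / 2) (d ^ 12)).filter IsSquare,
      (n : ℝ) ^ (-σ) ≤ 2 * (d : ℝ) ^ (-(297 / 25) : ℝ) := by
    intro n hn
    rw [mem_filter, mem_Ioc] at hn
    have h1 : d ^ 12 ≤ 2 * n := by omega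
    have h1' : (d : ℝ) ^ 12 / 2 ≤ n := by
      have : ((d ^ 12 : ℕ) : ℝ) ≤ ((2 * n : ℕ) : ℝ) := by exact_mod_cast h1
      push_cast at this; linarith
    have hn1 : (1 : ℝ) ≤ n := by exact_mod_cast (show 1 ≤ n by omega)
    calc (n : ℝ) ^ (-σ) ≤ (n : ℝ) ^ (-(99 / 100) : ℝ) :=
          Real.rpow_le_rpow_of_exponent_le hn1 (by linarith)
      _ ≤ ((d : ℝ) ^ 12 / 2) ^ (-(99 / 100) : ℝ) :=
          Real.rpow_le_rpow_of_nonpos (by positivity) h1' (by norm_num)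
      _ = (2 : ℝ) ^ (99 / 100 : ℝ) * (d : ℝ) ^ (-(297 / 25) : ℝ) := by
          rw [Real.div_rpow (by positivity) (by norm_num), Real.rpow_neg (by norm_num : (0:ℝ) ≤ 2),
            div_inv_eq_mul, ← Real.rpow_natCast, ← Real.rpow_mul hd0.le, mul_comm]
          norm_num
      _ ≤ 2 * (d : ℝ) ^ (-(297 / 25) : ℝ) := by
          gcongr
          exact (Real.rpow_le_rpow_of_exponent_le (by norm_num) (by norm_num)).trans
            (Real.rpow_one 2).le
  calc _ ≤ #((Ioc (d ^ 12 / 2) (d ^ 12)).filter IsSquare) • (2 * (d : ℝ) ^ (-(297 / 25) : ℝ)) :=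
        Finset.sum_le_card_nsmul _ _ _ hterm
    _ ≤ (d : ℝ) ^ 6 * (2 * (d : ℝ) ^ (-(297 / 25) : ℝ)) := by
        rw [nsmul_eq_mul]
        gcongr
        exact_mod_cast hcard
    _ = 2 * (d : ℝ) ^ (-(147 / 25) : ℝ) := by
        rw [← Real.rpow_natCast, mul_left_comm, ← Real.rpow_add hd0]
        norm_num
    _ ≤ _ := by
        exact mul_le_mul_of_nonneg_left
          (Real.rpow_le_rpow_of_exponent_le hd1 (by norm_num)) (by norm_num)

lemma tendsto_const_mul_rpow_neg (K : ℝ) {s : ℝ} (hs : 0 < s) :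
    Tendsto (fun d : ℕ ↦ K * (d : ℝ) ^ (-s)) atTop (𝓝 0) := by
  simpa using ((tendsto_rpow_neg_atTop hs).comp tendsto_natCast_atTop_atTop).const_mul K

lemma eventually_limL_neg (C : ℝ) {σ : ℝ} (hσ : 99 / 100 ≤ σ) (hσ1 : σ < 1) :
    ∀ᶠ d : ℕ in atTop, FewReps C d → limL (kron (-d)) σ < 0 := by
  have hτ : 0 < 2 * (2 : ℝ) ^ (-σ) - 1 := by
    have h : (1 : ℝ) < 2 ^ (1 - σ) := Real.one_lt_rpow (by norm_num) (by linarith)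
    rw [sub_eq_add_neg, Real.rpow_add (by norm_num), Real.rpow_one] at h
    linarith
  filter_upwards [(tendsto_const_mul_rpow_neg (C + 642) (by norm_num : (0 : ℝ) < 1 / 5)).eventually
    (gt_mem_nhds hτ), eventually_ge_atTop 2] with d hd hd2 hC
  have hσ0 : 0 < σ := by linarith
  have hd0 : (0 : ℝ) < d := by exact_mod_cast (by omega : 0 < d)
  have hd1 : (1 : ℝ) ≤ d := by exact_mod_cast (by omega : 1 ≤ d)
  have hdz : (-(d : ℤ)) ≠ 0 := by simp; omega
  obtain ⟨a, ha, hka⟩ := exists_kron_eq_neg_one_of_neg (D := -(d : ℤ)) (by simp; omega)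
  have hP : ∀ b, |∑ n ∈ Ioc 0 b, kron (-(d : ℤ)) n| ≤ 4 * d := by
    intro b
    have := abs_sum_kron_le (-(d : ℤ)) hdz ha hka b
    rwa [Int.natAbs_neg, Int.natAbs_natCast] at this
  have hQ := abs_sum_psi_le (d := d) (by omega)
  have hv : ∀ n, |psi d n| ≤ 2 := by
    intro n
    rcases eq_or_ne n 0 with rfl | hn
    · exact psi_zero_le d
    · exact abs_psi_le hn
  have hmain := abs_sum_mul_partialL_sub_le (abs_kron_le_one (-(d : ℤ))) hv hP hQ (by linarith)
    (by nlinarith) hσ (z := d ^ 4) (Nat.one_le_pow _ _ (by omega))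
  rw [← pow_mul, show 4 * 3 = 12 from rfl, sum_kron_partialL_psi] at hmain
  have hbound : 10 * (4 * (d : ℝ) * (16 * (d : ℝ) ^ 2)) * ((d ^ 4 : ℕ) : ℝ) ^ (-(9 / 10) : ℝ)
      ≤ 640 * (d : ℝ) ^ (-(1 / 5) : ℝ) := by
    have e : 10 * (4 * (d : ℝ) * (16 * (d : ℝ) ^ 2)) * ((d ^ 4 : ℕ) : ℝ) ^ (-(9 / 10) : ℝ)
        = 640 * (d : ℝ) ^ (-(3 / 5) : ℝ) := by
      push_cast
      rw [show 10 * (4 * (d : ℝ) * (16 * (d : ℝ) ^ 2)) = 640 * (d : ℝ) ^ 3 by ring,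
        ← Real.rpow_natCast, ← Real.rpow_natCast, ← Real.rpow_mul hd0.le, mul_assoc,
        ← Real.rpow_add hd0]
      norm_num
    rw [e]
    exact mul_le_mul_of_nonneg_left
      (Real.rpow_le_rpow_of_exponent_le hd1 (by norm_num)) (by norm_num)
  set c : ℕ → ℝ := fun n ↦ if n.Coprime (2 * d) then divSum d n else 0 with hc
  have hc0 : ∀ n ≠ 0, 0 ≤ c n := by
    intro n hn
    simp only [hc]
    split_ifs with h
    · exact (divSum_localProd hn h).1
    · exact le_rfl
  have hle : c 1 * ((1 : ℕ) : ℝ) ^ (-σ) ≤ partialL c σ (d ^ 12 / 2) := by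
    have hmem : 1 ∈ Ioc 0 (d ^ 12 / 2) := by
      rw [mem_Ioc]
      refine ⟨one_pos, ?_⟩
      rw [Nat.le_div_iff_mul_le two_pos, one_mul]
      exact hd2.trans (Nat.le_self_pow (by norm_num) d)
    exact Finset.single_le_sum (f := fun n : ℕ ↦ c n * (n : ℝ) ^ (-σ)) (fun n hn ↦
      mul_nonneg (hc0 n (by have := (mem_Ioc.1 hn).1; omega)) (by positivity)) hmem
  have hc1 : c 1 = 1 := by simp [hc, divSum_one]
  rw [hc1, Nat.cast_one, Real.one_rpow, mul_one] at hle
  have hdiff : partialL c σ (d ^ 12) - partialL c σ (d ^ 12 / 2)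
      ≤ (C + 2) * (d : ℝ) ^ (-(1 / 5) : ℝ) := by
    have e : partialL c σ (d ^ 12) - partialL c σ (d ^ 12 / 2)
        = ∑ n ∈ Ioc (d ^ 12 / 2) (d ^ 12), c n * (n : ℝ) ^ (-σ) := by
      rw [partialL, partialL, ← Finset.sum_Ioc_consecutive _ (Nat.zero_le _)
        (Nat.div_le_self (d ^ 12) 2)]
      ring
    rw [e]
    have hpt : ∀ n ∈ Ioc (d ^ 12 / 2) (d ^ 12), c n * (n : ℝ) ^ (-σ)
        ≤ (if IsSquare n then (n : ℝ) ^ (-σ) else 0)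
          + (if n.Coprime (2 * d) then (localProd d n - 1) * (n : ℝ) ^ (-σ) else 0) := by
      intro n hn
      have hn0 : n ≠ 0 := by have := (mem_Ioc.1 hn).1; omega
      have hpos : 0 ≤ (n : ℝ) ^ (-σ) := by positivity
      simp only [hc]
      by_cases hcop : n.Coprime (2 * d)
      · rw [if_pos hcop, if_pos hcop]
        obtain ⟨h1, h2, ⟨h3, h4, h5⟩ | h3⟩ := divSum_localProd hn0 hcop
        · split_ifs with hsq
          · nlinarith
          · nlinarith [h5 hsq]
        · split_ifs <;> nlinarith
      · rw [if_neg hcop, if_neg hcop]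
        split_ifs <;> simp [hpos]
    refine (Finset.sum_le_sum hpt).trans ?_
    rw [Finset.sum_add_distrib, ← Finset.sum_filter, ← Finset.sum_filter]
    have h1 := sum_isSquare_le (d := d) (by omega) hσ
    have h2 := hC.sum_le (by omega) hσ (S := (Ioc (d ^ 12 / 2) (d ^ 12)).filter
      (fun n ↦ n.Coprime (2 * d)))
      (Finset.filter_subset_filter _ (Ioc_subset_Ioc_left (Nat.zero_le _)))
    linarith
  have hneg : limL (kron (-(d : ℤ))) σ * limL (psi d) σ < 0 := by
    have h1 := (abs_le.1 (hmain.trans hbound)).1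
    nlinarith
  have hpsi := limL_psi_pos hσ0 (d := d) (by omega)
  by_contra! hge
  exact absurd hneg (not_lt.2 (mul_nonneg hge hpsi.le))

lemma tendsto_limL_kron_neg {d : ℕ} (hd : 1 ≤ d) {σ : ℝ} (hσ : 0 < σ) :
    Tendsto (partialL (kron (-d)) σ) atTop (𝓝 (limL (kron (-d)) σ)) := by
  obtain ⟨a, ha, h⟩ := exists_kron_eq_neg_one_of_neg (D := -(d : ℤ)) (by simp; omega)
  exact tendsto_partialL (abs_sum_kron_le _ (by simp; omega) ha h) hσ

lemma kron_nonneg_of_isSquare (D : ℤ) {n : ℕ} (hn : n ≠ 0) (h : IsSquare n) : 0 ≤ kron D n := by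
  obtain ⟨k, rfl⟩ := h
  have hk : k ≠ 0 := by rintro rfl; simp at hn
  rw [kron_mul D hk hk]
  exact mul_self_nonneg _

lemma eventually_kron_mul_ne_neg_one (C : ℝ) {d₁ : ℕ} (hd₁ : 1 ≤ d₁) {β : ℝ}
    (hβ : 99 / 100 ≤ β) (h0 : limL (kron (-d₁)) β = 0) :
    ∀ᶠ d₂ : ℕ in atTop, FewReps C d₂ → ∀ a : ℕ, a ≠ 0 → kron ((d₁ : ℤ) * d₂) a ≠ -1 := by
  filter_upwards [(tendsto_const_mul_rpow_neg (C + 160 * (d₁ : ℝ) ^ 2)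
    (by norm_num : (0 : ℝ) < 1 / 5)).eventually (gt_mem_nhds one_pos), eventually_ge_atTop 1]
    with d hd hd2 hC a ha hka
  have hβ0 : 0 < β := by linarith
  have hd0 : (0 : ℝ) < d := by exact_mod_cast hd2
  have hd1 : (1 : ℝ) ≤ d := by exact_mod_cast hd2
  have hd1' : (1 : ℝ) ≤ d₁ := by exact_mod_cast hd₁
  have hneg : -(d₁ : ℤ) * (d : ℤ) ^ 2 < 0 := by
    have : (0 : ℤ) < d₁ := by exact_mod_cast hd₁
    have : (0 : ℤ) < d := by exact_mod_cast hd2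
    rw [neg_mul, neg_lt_zero]; positivity
  obtain ⟨b, hb, hkb⟩ := exists_kron_eq_neg_one_of_neg hneg
  have hP := abs_sum_kron_le _ hneg.ne hb hkb
  have hQ := abs_sum_kron_le ((d₁ : ℤ) * d) (by positivity) ha hka
  have hu0 : limL (kron (-(d₁ : ℤ) * (d : ℤ) ^ 2)) β = 0 := by
    obtain ⟨E, -, hE⟩ := exists_tendsto_partialL_kron_mul_sq hβ0 d (by omega) (-(d₁ : ℤ))
    have h1 := hE _ (tendsto_limL_kron_neg hd₁ hβ0)
    rw [h0, mul_zero] at h1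
    exact tendsto_nhds_unique (tendsto_partialL hP hβ0) h1
  have hmain := abs_sum_mul_partialL_sub_le (abs_kron_le_one (-(d₁ : ℤ) * (d : ℤ) ^ 2))
    (fun n ↦ (abs_kron_le_one ((d₁ : ℤ) * d) n).trans one_le_two) hP hQ
    (by simp only [Int.natAbs_mul, Int.natAbs_neg, Int.natAbs_pow, Int.natAbs_natCast]
        push_cast
        nlinarith [one_le_mul_of_one_le_of_one_le hd1' (one_le_pow₀ hd1 (n := 2))])
    (by simp only [Int.natAbs_mul, Int.natAbs_natCast]
        push_cast
        nlinarith [one_le_mul_of_one_le_of_one_le hd1' hd1])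
    hβ (z := d ^ 4) (Nat.one_le_pow _ _ (by omega))
  rw [← pow_mul, show 4 * 3 = 12 from rfl, hu0, zero_mul, sub_zero, sum_mul_partialL_div] at hmain
  simp only [Int.natAbs_mul, Int.natAbs_neg, Int.natAbs_pow, Int.natAbs_natCast] at hmain
  have hbound : 10 * (4 * ((d₁ * d ^ 2 : ℕ) : ℝ) * (4 * ((d₁ * d : ℕ) : ℝ)))
      * ((d ^ 4 : ℕ) : ℝ) ^ (-(9 / 10) : ℝ)
      ≤ 160 * (d₁ : ℝ) ^ 2 * (d : ℝ) ^ (-(1 / 5) : ℝ) := by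
    have e : 10 * (4 * ((d₁ * d ^ 2 : ℕ) : ℝ) * (4 * ((d₁ * d : ℕ) : ℝ)))
        * ((d ^ 4 : ℕ) : ℝ) ^ (-(9 / 10) : ℝ)
        = 160 * (d₁ : ℝ) ^ 2 * (d : ℝ) ^ (-(3 / 5) : ℝ) := by
      push_cast
      rw [show 10 * (4 * ((d₁ : ℝ) * (d : ℝ) ^ 2) * (4 * ((d₁ : ℝ) * d)))
          = 160 * (d₁ : ℝ) ^ 2 * (d : ℝ) ^ 3 by ring,
        ← Real.rpow_natCast (d : ℝ) 3, ← Real.rpow_natCast (d : ℝ) 4, ← Real.rpow_mul hd0.le,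
        mul_assoc, ← Real.rpow_add hd0]
      norm_num
    rw [e]
    exact mul_le_mul_of_nonneg_left
      (Real.rpow_le_rpow_of_exponent_le hd1 (by norm_num)) (by positivity)
  have hlow : 1 - C * (d : ℝ) ^ (-(1 / 5) : ℝ) ≤ ∑ n ∈ Ioc 0 (d ^ 12),
      (∑ k ∈ n.divisors, kron (-(d₁ : ℤ) * (d : ℤ) ^ 2) k * kron ((d₁ : ℤ) * d) (n / k))
        * (n : ℝ) ^ (-β) := by
    have hpt : ∀ n ∈ Ioc 0 (d ^ 12), (if n = 1 then (1 : ℝ) else 0)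
        - (if n.Coprime (2 * (d₁ * d)) then (localProd d n - 1) * (n : ℝ) ^ (-β) else 0)
        ≤ (∑ k ∈ n.divisors, kron (-(d₁ : ℤ) * (d : ℤ) ^ 2) k * kron ((d₁ : ℤ) * d) (n / k))
        * (n : ℝ) ^ (-β) := by
      intro n hn
      have hn0 : n ≠ 0 := by have := (mem_Ioc.1 hn).1; omega
      have hpos : 0 ≤ (n : ℝ) ^ (-β) := by positivity
      rw [kron_conv_twist hn0]
      rcases eq_or_ne n 1 with rfl | hn1
      · simp [kron_one, divSum_one, localProd]
      rw [if_neg hn1]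
      by_cases hcop : n.Coprime (2 * (d₁ * d))
      · rw [if_pos hcop, if_pos hcop]
        have hcop' : n.Coprime (2 * d) :=
          hcop.coprime_dvd_right (Nat.mul_dvd_mul_left 2 (dvd_mul_left _ _))
        have hk := abs_le.1 (abs_kron_le_one (-(d₁ : ℤ)) n)
        rw [zero_sub, ← neg_mul]
        refine mul_le_mul_of_nonneg_right ?_ hpos
        obtain ⟨h1, h2, ⟨h3, h4, h5⟩ | h3⟩ := divSum_localProd hn0 hcop'
        · rw [h4, sub_self, neg_zero]
          by_cases hsq : IsSquare n
          · exact mul_nonneg (kron_nonneg_of_isSquare _ hn0 hsq) h1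
          · rw [le_antisymm (h5 hsq) h1, mul_zero]
        · nlinarith
      · rw [if_neg hcop, if_neg hcop]
        simp
    refine le_trans ?_ (Finset.sum_le_sum hpt)
    rw [Finset.sum_sub_distrib, Finset.sum_ite_eq',
      if_pos (mem_Ioc.2 ⟨one_pos, Nat.one_le_pow _ _ hd2⟩), ← Finset.sum_filter]
    have h2 := hC.sum_le hd2 hβ (S := (Ioc 0 (d ^ 12)).filter
      (fun n ↦ n.Coprime (2 * (d₁ * d)))) (Finset.monotone_filter_right _ fun n _ hn ↦
        hn.coprime_dvd_right (Nat.mul_dvd_mul_left 2 (dvd_mul_left _ _)))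
    linarith
  have h1 := (abs_le.1 (hmain.trans hbound)).2
  linarith

lemma kron_neg_mul_sq_comm {d₁ d₂ n : ℕ} (hn : n ≠ 0) (h : kron ((d₁ : ℤ) * d₂) n ≠ -1) :
    kron (-(d₁ : ℤ) * (d₂ : ℤ) ^ 2) n = kron (-(d₂ : ℤ) * (d₁ : ℤ) ^ 2) n := by
  have e₁ : -(d₁ : ℤ) * (d₂ : ℤ) ^ 2 = -1 * d₁ * (d₂ * d₂) := by ring
  have e₂ : -(d₂ : ℤ) * (d₁ : ℤ) ^ 2 = -1 * d₂ * (d₁ * d₁) := by ring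
  rw [← kron_mul_kron _ _ hn] at h
  simp only [e₁, e₂, ← kron_mul_kron _ _ hn]
  rcases kron_trichotomy d₁ n with h1 | h1 | h1 <;> rcases kron_trichotomy d₂ n with h2 | h2 | h2 <;>
    simp [h1, h2] at h ⊢

theorem eventually_not_fewReps (C : ℝ) : ∀ᶠ d : ℕ in atTop, ¬ FewReps C d := by
  by_contra hcon
  have hf : ∃ᶠ d : ℕ in atTop, FewReps C d := hcon
  obtain ⟨d₁, ⟨hbad, hneg⟩, hd₁⟩ := ((hf.and_eventually (eventually_limL_neg C (σ := 99 / 100)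
    le_rfl (by norm_num))).and_eventually (eventually_ge_atTop 1)).exists
  have hz : -(d₁ : ℤ) ≠ 0 := by simp; omega
  obtain ⟨a, ha, hka⟩ := exists_kron_eq_neg_one_of_neg (D := -(d₁ : ℤ)) (by simp; omega)
  have hcont : ContinuousOn (limL (kron (-(d₁ : ℤ)))) (Set.Icc (99 / 100) 2) :=
    (continuousOn_limL (abs_sum_kron_le _ hz ha hka) (by norm_num)).mono Set.Icc_subset_Ici_self
  obtain ⟨β, ⟨hβ, -⟩, hβ0⟩ := intermediate_value_Icc (by norm_num) hcont
    ⟨(hneg hbad).le, (limL_kron_two_pos hz ha hka).le⟩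
  have hβ1 : β < 1 := by
    by_contra! h
    exact limL_kron_ne_zero hz ha hka h hβ0
  have hβpos : 0 < β := by linarith
  obtain ⟨d₂, ⟨⟨hbad₂, hneg₂⟩, hkr⟩, hd₂⟩ := (((hf.and_eventually
    (eventually_limL_neg C hβ hβ1)).and_eventually
      (eventually_kron_mul_ne_neg_one C hd₁ hβ hβ0)).and_eventually (eventually_ge_atTop 1)).exists
  obtain ⟨E₁, -, hE₁⟩ := exists_tendsto_partialL_kron_mul_sq hβpos d₂ (by omega) (-(d₁ : ℤ))
  obtain ⟨E₂, hE₂0, hE₂⟩ := exists_tendsto_partialL_kron_mul_sq hβpos d₁ (by omega) (-(d₂ : ℤ))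
  have h1 := hE₁ _ (tendsto_limL_kron_neg hd₁ hβpos)
  have h2 := hE₂ _ (tendsto_limL_kron_neg hd₂ hβpos)
  have h3 := tendsto_nhds_unique (h1.congr fun N ↦
    partialL_congr (fun n hn ↦ kron_neg_mul_sq_comm hn (hkr hbad₂ n hn)) β N) h2
  rw [hβ0, mul_zero] at h3
  exact (mul_neg_of_pos_of_neg hE₂0 (hneg₂ hbad₂)).ne h3.symm

lemma exists_card_divisors_le {ε : ℝ} (hε : 0 < ε) :
    ∃ C : ℝ, 0 < C ∧ ∀ n : ℕ, n ≠ 0 → (#n.divisors : ℝ) ≤ C * (n : ℝ) ^ ε := by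
  obtain ⟨P, hP⟩ := exists_nat_gt ((2 : ℝ) ^ (1 / ε))
  have hl : 0 < ε * Real.log 2 := mul_pos hε (Real.log_pos one_lt_two)
  set A : ℝ := 1 + 1 / (ε * Real.log 2) with hA
  have hA1 : 1 ≤ A := by rw [hA]; have : 0 < 1 / (ε * Real.log 2) := by positivity
                         linarith
  have hA2 : 1 ≤ A * (ε * Real.log 2) := by
    rw [hA, add_mul, one_div, inv_mul_cancel₀ hl.ne']; linarith
  have hloc : ∀ p k : ℕ, p.Prime →
      ((k + 1 : ℕ) : ℝ) ≤ (if p < P then A else 1) * ((p ^ k : ℕ) : ℝ) ^ ε := by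
    intro p k hp
    have hp2 : (2 : ℝ) ≤ p := by exact_mod_cast hp.two_le
    have hp0 : (0 : ℝ) ≤ p := by linarith
    have e : ((p ^ k : ℕ) : ℝ) ^ ε = ((p : ℝ) ^ ε) ^ k := by
      push_cast
      rw [← Real.rpow_natCast, ← Real.rpow_mul hp0, mul_comm, Real.rpow_mul hp0, Real.rpow_natCast]
    rw [e]
    push_cast
    split_ifs with h
    · have h1 : Real.exp (ε * Real.log 2) ≤ (p : ℝ) ^ ε := by
        rw [mul_comm, ← Real.rpow_def_of_pos two_pos]
        exact Real.rpow_le_rpow two_pos.le hp2 hε.le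
      have h2 : 1 + k * (ε * Real.log 2) ≤ ((p : ℝ) ^ ε) ^ k := by
        calc 1 + k * (ε * Real.log 2) ≤ Real.exp (k * (ε * Real.log 2)) := by
              linarith [Real.add_one_le_exp (k * (ε * Real.log 2))]
          _ = Real.exp (ε * Real.log 2) ^ k := by rw [Real.exp_nat_mul]
          _ ≤ _ := by gcongr
      calc (k : ℝ) + 1 ≤ k * (A * (ε * Real.log 2)) + A := by
            have : (0 : ℝ) ≤ k := by positivity
            nlinarith
        _ = A * (1 + k * (ε * Real.log 2)) := by ring
        _ ≤ _ := by gcongr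
    · have h1 : (2 : ℝ) ≤ (p : ℝ) ^ ε := by
        have : (2 : ℝ) ^ (1 / ε) ≤ p := hP.le.trans (by exact_mod_cast not_lt.1 h)
        calc (2 : ℝ) = ((2 : ℝ) ^ (1 / ε)) ^ ε := by
              rw [← Real.rpow_mul two_pos.le, one_div_mul_cancel hε.ne', Real.rpow_one]
          _ ≤ _ := Real.rpow_le_rpow (by positivity) this hε.le
      have h2 := one_add_mul_le_pow (a := (1 : ℝ)) (by norm_num) k
      calc (k : ℝ) + 1 ≤ (1 + 1) ^ k := by linarith
        _ ≤ ((p : ℝ) ^ ε) ^ k := by gcongr; linarith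
        _ = _ := (one_mul _).symm
  refine ⟨A ^ P, by positivity, fun n hn ↦ ?_⟩
  rw [Nat.card_divisors hn, Nat.cast_prod]
  calc ∏ p ∈ n.primeFactors, ((n.factorization p + 1 : ℕ) : ℝ)
      ≤ ∏ p ∈ n.primeFactors, ((if p < P then A else 1)
          * ((p ^ n.factorization p : ℕ) : ℝ) ^ ε) :=
        Finset.prod_le_prod (fun p _ ↦ by positivity) fun p hp ↦
          hloc p _ (Nat.prime_of_mem_primeFactors hp)
    _ = (∏ p ∈ n.primeFactors, (if p < P then A else 1)) * (n : ℝ) ^ ε := by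
        rw [Finset.prod_mul_distrib, Real.finsetProd_rpow _ _ (fun _ _ ↦ by positivity),
          ← Nat.cast_prod]
        congr 3
        exact Nat.prod_factorization_pow_eq_self hn
    _ ≤ A ^ P * (n : ℝ) ^ ε := by
        gcongr
        rw [← Finset.prod_filter, Finset.prod_const]
        refine pow_le_pow_right₀ hA1 ?_
        calc _ ≤ #(range P) := card_le_card fun p hp ↦ by
              rw [mem_filter] at hp; exact mem_range.2 hp.2
          _ = P := card_range P

lemma sum_inv_le {K : ℕ} (hK : K ≠ 0) {ε : ℝ} (hε : 0 < ε) :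
    ∑ k ∈ Ioc 0 K, ((k : ℝ))⁻¹ ≤ (1 + 1 / ε) * (K : ℝ) ^ ε := by
  have h := harmonic_le_one_add_log K
  have h1 := Real.log_le_rpow_div (Nat.cast_nonneg K) hε
  have h2 : (1 : ℝ) ≤ (K : ℝ) ^ ε := Real.one_le_rpow (by exact_mod_cast Nat.pos_of_ne_zero hK) hε.le
  have h3 : ((harmonic K : ℚ) : ℝ) = ∑ k ∈ Ioc 0 K, ((k : ℝ))⁻¹ := by
    rw [harmonic_eq_sum_Icc]
    push_cast
    rfl
  rw [← h3]
  calc _ ≤ _ := h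
    _ ≤ (K : ℝ) ^ ε + (K : ℝ) ^ ε / ε := add_le_add h2 h1
    _ = _ := by ring

lemma bDisc_pos {a b c : ℤ} (h : bPosDef a b c) : 0 < a ∧ 0 < c ∧ 0 < bDisc a b c := by
  have ha : 0 < a := by simpa [bVal] using h 1 0 (by simp)
  have hc : 0 < c := by simpa [bVal] using h 0 1 (by simp)
  have h1 := h (-b) (2 * a) (by omega)
  have h2 : bVal a b c (-b) (2 * a) = a * bDisc a b c := by unfold bVal bDisc; ring
  rw [h2] at h1
  exact ⟨ha, hc, pos_of_mul_pos_right h1 ha.le⟩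

lemma finite_setOf_bVal_eq {a b c : ℤ} (h : bPosDef a b c) (k : ℤ) :
    {v : ℤ × ℤ | bVal a b c v.1 v.2 = k}.Finite := by
  obtain ⟨ha, hc, hd⟩ := bDisc_pos h
  refine Set.Finite.subset ((Set.finite_Icc (-(4 * c * k)) (4 * c * k)).prod
    (Set.finite_Icc (-(4 * a * k)) (4 * a * k))) ?_
  rintro ⟨x, y⟩ hv
  have hv' : bVal a b c x y = k := hv
  have e1 : 4 * a * k = (2 * a * x + b * y) ^ 2 + bDisc a b c * y ^ 2 := by
    rw [← hv']; unfold bVal bDisc; ring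
  have e2 : 4 * c * k = (2 * c * y + b * x) ^ 2 + bDisc a b c * x ^ 2 := by
    rw [← hv']; unfold bVal bDisc; ring
  have key : ∀ t M s : ℤ, M = s ^ 2 + bDisc a b c * t ^ 2 → -M ≤ t ∧ t ≤ M := by
    intro t M s hM
    have h1 : t ^ 2 ≤ M := by nlinarith [sq_nonneg s, sq_nonneg t]
    have h2 : |t| ≤ t ^ 2 := by
      rw [← sq_abs]
      exact Int.le_self_sq _
    exact abs_le.1 (h2.trans h1)
  exact ⟨key x _ _ e2, key y _ _ e1⟩

/-- The bilinear form associated with the quadratic form `bVal a b c`. -/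
def bPolar (a b c x₀ y₀ x y : ℤ) : ℤ := 2 * a * x₀ * x + b * (x₀ * y + x * y₀) + 2 * c * y₀ * y

lemma four_mul_bVal_mul_bVal (a b c x₀ y₀ x y : ℤ) :
    4 * bVal a b c x₀ y₀ * bVal a b c x y
      = bPolar a b c x₀ y₀ x y ^ 2 + bDisc a b c * (x₀ * y - y₀ * x) ^ 2 := by
  unfold bVal bPolar bDisc; ring

lemma eq_of_bPolar_eq {a b c x₀ y₀ x y x' y' : ℤ} (h0 : bVal a b c x₀ y₀ ≠ 0)
    (hB : bPolar a b c x₀ y₀ x y = bPolar a b c x₀ y₀ x' y')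
    (hδ : x₀ * y - y₀ * x = x₀ * y' - y₀ * x') : x = x' ∧ y = y' := by
  have h2 : 2 * bVal a b c x₀ y₀ ≠ 0 := mul_ne_zero two_ne_zero h0
  have ex : ∀ x y, 2 * bVal a b c x₀ y₀ * x
      = x₀ * bPolar a b c x₀ y₀ x y - (b * x₀ + 2 * c * y₀) * (x₀ * y - y₀ * x) := by
    intro x y; unfold bVal bPolar; ring
  have ey : ∀ x y, 2 * bVal a b c x₀ y₀ * y
      = y₀ * bPolar a b c x₀ y₀ x y + (2 * a * x₀ + b * y₀) * (x₀ * y - y₀ * x) := by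
    intro x y; unfold bVal bPolar; ring
  constructor
  · apply mul_left_cancel₀ h2
    rw [ex x y, ex x' y', hB, hδ]
  · apply mul_left_cancel₀ h2
    rw [ey x y, ey x' y', hB, hδ]

lemma card_le_two_of_proportional {a b c x₀ y₀ M k : ℤ} (h0 : bVal a b c x₀ y₀ = M) (hM : M ≠ 0)
    {S : Finset (ℤ × ℤ)} (hS : ∀ w ∈ S, bVal a b c w.1 w.2 = k ∧ x₀ * w.2 - y₀ * w.1 = 0) :
    #S ≤ 2 := by
  refine (card_le_card_of_injOn (t := (univ : Finset Bool))
    (fun w ↦ decide (0 < bPolar a b c x₀ y₀ w.1 w.2)) (fun _ _ ↦ mem_coe.2 (mem_univ _)) ?_).trans (by simp)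
  rintro w hw w' hw' hww
  obtain ⟨h1, h2⟩ := hS w hw
  obtain ⟨h1', h2'⟩ := hS w' hw'
  have e := four_mul_bVal_mul_bVal a b c x₀ y₀ w.1 w.2
  have e' := four_mul_bVal_mul_bVal a b c x₀ y₀ w'.1 w'.2
  rw [h1, h2] at e
  rw [h1', h2'] at e'
  have hsq : bPolar a b c x₀ y₀ w.1 w.2 ^ 2 = bPolar a b c x₀ y₀ w'.1 w'.2 ^ 2 := by linarith
  simp only [decide_eq_decide] at hww
  have hB : bPolar a b c x₀ y₀ w.1 w.2 = bPolar a b c x₀ y₀ w'.1 w'.2 := by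
    rcases sq_eq_sq_iff_eq_or_eq_neg.1 hsq with h | h <;> omega
  have := eq_of_bPolar_eq (by rwa [h0]) hB (by rw [h2, h2'])
  exact Prod.ext this.1 this.2

lemma sum_card_rpow_le {a b c x₀ y₀ : ℤ} {m d N : ℕ} (hm : 0 < m) (hd : 0 < d)
    (hdisc : bDisc a b c = d) (h0 : bVal a b c x₀ y₀ = (m : ℤ) ^ 2) {S : ℕ → Finset (ℤ × ℤ)}
    (hS : ∀ n, ∀ w ∈ S n, bVal a b c w.1 w.2 = ((m : ℤ) * n) ^ 2 ∧ x₀ * w.2 - y₀ * w.1 ≠ 0)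
    {τ : ℝ} (hτ : ∀ k : ℕ, k ≠ 0 → k ≤ 4 * m ^ 4 * N ^ 2 → (#k.divisors : ℝ) ≤ τ) :
    ∑ n ∈ Ioc 0 N, (#(S n) : ℝ) * (n : ℝ) ^ (-(99 / 100) : ℝ)
      ≤ (N : ℝ) ^ (1 / 100 : ℝ) * (4 * (m : ℝ) ^ 2) * (d : ℝ) ^ (-(1 / 2) : ℝ) * τ
        * ∑ k ∈ (Ioc 0 (2 * m ^ 2 * N) : Finset ℕ), (k : ℝ)⁻¹ := by
  set B : ℤ × ℤ → ℤ := fun w ↦ bPolar a b c x₀ y₀ w.1 w.2 with hB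
  set δ : ℤ × ℤ → ℤ := fun w ↦ x₀ * w.2 - y₀ * w.1 with hδ
  have hmz : (0 : ℤ) < m := by exact_mod_cast hm
  have hdz : (0 : ℤ) < d := by exact_mod_cast hd
  have hid : ∀ n, ∀ w ∈ S n,
      (2 * (m : ℤ) ^ 2 * n - B w) * (2 * (m : ℤ) ^ 2 * n + B w) = d * δ w ^ 2 := by
    intro n w hw
    have e := four_mul_bVal_mul_bVal a b c x₀ y₀ w.1 w.2
    rw [h0, (hS n w hw).1, hdisc] at e
    simp only [hB, hδ]
    linear_combination e
  have hpos : ∀ n, n ≠ 0 → ∀ w ∈ S n, 0 < 2 * (m : ℤ) ^ 2 * n - B w ∧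
      0 < 2 * (m : ℤ) ^ 2 * n + B w := by
    intro n hn w hw
    have h1 := hid n w hw
    have h2 : 0 < (d : ℤ) * δ w ^ 2 := mul_pos hdz (by have := (hS n w hw).2; positivity)
    have h3 : 0 < (m : ℤ) ^ 2 * n := by positivity
    rw [← h1] at h2
    rcases pos_and_pos_or_neg_and_neg_of_mul_pos h2 with h | h
    · exact h
    · exfalso; linarith [h.1, h.2]
  have hsq : ∀ n, ∀ w ∈ S n, d * (δ w).natAbs ^ 2 ≤ (2 * m ^ 2 * n) ^ 2 := by
    intro n w hw
    have h1 := hid n w hw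
    have h2 : (d : ℤ) * ((δ w).natAbs : ℤ) ^ 2 ≤ (2 * m ^ 2 * n) ^ 2 := by
      rw [Int.natAbs_sq]
      nlinarith [sq_nonneg (B w)]
    exact_mod_cast h2
  set G : ℕ → ℝ := fun k ↦ (N : ℝ) ^ (1 / 100 : ℝ) * (2 * (m : ℝ) ^ 2)
    * (d : ℝ) ^ (-(1 / 2) : ℝ) * (k : ℝ)⁻¹ with hG
  have hweight : ∀ n ∈ Ioc 0 N, ∀ w ∈ S n,
      (n : ℝ) ^ (-(99 / 100) : ℝ) ≤ G (δ w).natAbs := by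
    intro n hn w hw
    rw [mem_Ioc] at hn
    have hn0 : (0 : ℝ) < n := by exact_mod_cast hn.1
    have hk0 : (0 : ℝ) < ((δ w).natAbs : ℝ) := by
      exact_mod_cast Int.natAbs_pos.2 (hS n w hw).2
    have h1 : (d : ℝ) * ((δ w).natAbs : ℝ) ^ 2 ≤ (2 * (m : ℝ) ^ 2 * n) ^ 2 := by
      exact_mod_cast hsq n w hw
    have hd0 : (0 : ℝ) < d := by exact_mod_cast hd
    have h2 : (d : ℝ) ^ (1 / 2 : ℝ) * ((δ w).natAbs : ℝ) ≤ 2 * (m : ℝ) ^ 2 * n := by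
      refine le_of_sq_le_sq ?_ (by positivity)
      rw [mul_pow, ← Real.sqrt_eq_rpow, Real.sq_sqrt hd0.le]
      exact h1
    have h3 : (n : ℝ)⁻¹ ≤ 2 * (m : ℝ) ^ 2 * (d : ℝ) ^ (-(1 / 2) : ℝ) * ((δ w).natAbs : ℝ)⁻¹ := by
      rw [Real.rpow_neg hd0.le, inv_eq_one_div, mul_assoc, ← mul_inv, ← div_eq_mul_inv,
        div_le_div_iff₀ hn0 (by positivity)]
      linarith
    calc (n : ℝ) ^ (-(99 / 100) : ℝ) = (n : ℝ) ^ (1 / 100 : ℝ) * (n : ℝ)⁻¹ := by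
          rw [← Real.rpow_neg_one, ← Real.rpow_add hn0]; norm_num
      _ ≤ (N : ℝ) ^ (1 / 100 : ℝ) * (2 * (m : ℝ) ^ 2 * (d : ℝ) ^ (-(1 / 2) : ℝ)
          * ((δ w).natAbs : ℝ)⁻¹) := by
          gcongr
          exact_mod_cast hn.2
      _ = _ := by simp only [hG]; ring
  set T : Finset (Σ _ : ℕ, ℕ × Bool) := ((Ioc 0 (2 * m ^ 2 * N)).filter
    (fun k ↦ d * k ^ 2 ≤ 4 * m ^ 4 * N ^ 2)).sigma (fun k ↦ (d * k ^ 2).divisors ×ˢ univ) with hT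
  set φ : (Σ _ : ℕ, ℤ × ℤ) → Σ _ : ℕ, ℕ × Bool := fun p ↦
    ⟨(δ p.2).natAbs, ((2 * (m : ℤ) ^ 2 * p.1 - B p.2).natAbs, decide (0 < δ p.2))⟩ with hφ
  have hmaps : ∀ p ∈ (Ioc 0 N).sigma S, φ p ∈ T := by
    rintro ⟨n, w⟩ hp
    rw [mem_sigma, mem_Ioc] at hp
    obtain ⟨⟨hn0, hnN⟩, hw⟩ := hp
    have hk0 : 0 < (δ w).natAbs := Int.natAbs_pos.2 (hS n w hw).2
    have hle : (2 * m ^ 2 * n) ^ 2 ≤ 4 * m ^ 4 * N ^ 2 := by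
      calc (2 * m ^ 2 * n) ^ 2 ≤ (2 * m ^ 2 * N) ^ 2 := by gcongr
        _ = _ := by ring
    simp only [hT, hφ, mem_sigma, mem_filter, mem_Ioc, mem_product, mem_univ, and_true,
      Nat.mem_divisors]
    refine ⟨⟨⟨hk0, ?_⟩, (hsq n w hw).trans hle⟩, ?_, by positivity⟩
    · have h1 : (δ w).natAbs ^ 2 ≤ (2 * m ^ 2 * n) ^ 2 :=
        (Nat.le_mul_of_pos_left _ hd).trans (hsq n w hw)
      exact ((Nat.pow_le_pow_iff_left two_ne_zero).1 h1).trans (by gcongr)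
    · rw [← Int.natCast_dvd_natCast]
      push_cast
      rw [sq_abs, abs_dvd, ← hid n w hw]
      exact dvd_mul_right _ _
  have hinj : Set.InjOn φ ((Ioc 0 N).sigma S : Finset _) := by
    rintro ⟨n, w⟩ hp ⟨n', w'⟩ hp' heq
    rw [mem_coe, mem_sigma, mem_Ioc] at hp hp'
    obtain ⟨⟨hn0, hnN⟩, hw⟩ := hp
    obtain ⟨⟨hn0', hnN'⟩, hw'⟩ := hp'
    simp only [hφ, Sigma.mk.injEq, heq_eq_eq, Prod.mk.injEq, decide_eq_decide] at heq
    obtain ⟨h1, h2, h3⟩ := heq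
    have hδ' : δ w = δ w' := by omega
    obtain ⟨p1, p2⟩ := hpos n hn0.ne' w hw
    obtain ⟨p1', p2'⟩ := hpos n' hn0'.ne' w' hw'
    have hu : 2 * (m : ℤ) ^ 2 * n - B w = 2 * (m : ℤ) ^ 2 * n' - B w' := by omega
    have hu' : 2 * (m : ℤ) ^ 2 * n + B w = 2 * (m : ℤ) ^ 2 * n' + B w' := by
      apply mul_left_cancel₀ p1.ne'
      rw [hid n w hw, hu, hid n' w' hw', hδ']
    have hn : (n : ℤ) = n' := by
      have : 4 * (m : ℤ) ^ 2 * n = 4 * (m : ℤ) ^ 2 * n' := by linarith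
      exact mul_left_cancel₀ (by positivity) this
    have hn' : n = n' := by exact_mod_cast hn
    subst hn'
    have hBB : B w = B w' := by linarith
    have := eq_of_bPolar_eq (by rw [h0]; positivity) hBB hδ'
    rw [Prod.ext this.1 this.2]
  have hG0 : ∀ k, 0 ≤ G k := fun k ↦ by simp only [hG]; positivity
  calc ∑ n ∈ Ioc 0 N, (#(S n) : ℝ) * (n : ℝ) ^ (-(99 / 100) : ℝ)
      = ∑ p ∈ (Ioc 0 N).sigma S, (p.1 : ℝ) ^ (-(99 / 100) : ℝ) := by
        rw [Finset.sum_sigma]; simp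
    _ ≤ ∑ p ∈ (Ioc 0 N).sigma S, G (φ p).1 := by
        refine Finset.sum_le_sum ?_
        rintro ⟨n, w⟩ hp
        rw [mem_sigma] at hp
        exact hweight n hp.1 w hp.2
    _ = ∑ q ∈ ((Ioc 0 N).sigma S).image φ, G q.1 := (Finset.sum_image (f := fun q ↦ G q.1) hinj).symm
    _ ≤ ∑ q ∈ T, G q.1 := Finset.sum_le_sum_of_subset_of_nonneg
        (Finset.image_subset_iff.2 hmaps) fun q _ _ ↦ hG0 _
    _ = ∑ k ∈ (Ioc 0 (2 * m ^ 2 * N)).filter (fun k ↦ d * k ^ 2 ≤ 4 * m ^ 4 * N ^ 2),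
          (#(d * k ^ 2).divisors : ℝ) * 2 * G k := by
        rw [hT, Finset.sum_sigma]; simp
    _ ≤ ∑ k ∈ (Ioc 0 (2 * m ^ 2 * N)).filter (fun k ↦ d * k ^ 2 ≤ 4 * m ^ 4 * N ^ 2),
          τ * 2 * G k := by
        refine Finset.sum_le_sum fun k hk ↦ ?_
        rw [mem_filter, mem_Ioc] at hk
        have := hτ (d * k ^ 2) (Nat.mul_pos hd (pow_pos hk.1.1 2)).ne' hk.2
        have := hG0 k
        gcongr
    _ ≤ ∑ k ∈ Ioc 0 (2 * m ^ 2 * N), τ * 2 * G k := by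
        refine Finset.sum_le_sum_of_subset_of_nonneg (filter_subset _ _) fun k hk hk' ↦ ?_
        have hτ0 : 0 ≤ τ := by
          rw [mem_Ioc] at hk
          have hN0 : 0 < N := Nat.pos_of_ne_zero (by rintro rfl; simp at hk; omega)
          exact (Nat.cast_nonneg _).trans (hτ 1 one_ne_zero (Nat.pos_of_ne_zero (by positivity)))
        have := hG0 k
        positivity
    _ = _ := by
        rw [Finset.mul_sum]
        refine Finset.sum_congr rfl fun k _ ↦ ?_
        simp only [hG]; ring

lemma bRep_ne_zero_iff {a b c : ℤ} (h : bPosDef a b c) (k : ℤ) :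
    bRep a b c k ≠ 0 ↔ ∃ x y, bVal a b c x y = k := by
  rw [bRep, Ne, Set.ncard_eq_zero (finite_setOf_bVal_eq h k), ← Ne, ← Set.nonempty_iff_ne_empty]
  exact ⟨fun ⟨v, hv⟩ ↦ ⟨v.1, v.2, hv⟩, fun ⟨x, y, hv⟩ ↦ ⟨(x, y), hv⟩⟩

lemma bRep_eq_card {a b c : ℤ} (h : bPosDef a b c) (k : ℤ) :
    bRep a b c k = #(finite_setOf_bVal_eq h k).toFinset :=
  Set.ncard_eq_toFinset_card _ _

lemma two_le_bRep {a b c : ℤ} (h : bPosDef a b c) {k : ℤ} (hk : k ≠ 0)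
    (h0 : bRep a b c k ≠ 0) : 2 ≤ bRep a b c k := by
  obtain ⟨x, y, hxy⟩ := (bRep_ne_zero_iff h k).1 h0
  have hne : ((x, y) : ℤ × ℤ) ≠ (-x, -y) := by
    intro heq
    rw [Prod.mk.injEq] at heq
    have hx : x = 0 := by omega
    have hy : y = 0 := by omega
    rw [hx, hy] at hxy
    exact hk (by rw [← hxy]; simp [bVal])
  rw [bRep_eq_card h, ← card_pair hne]
  refine card_le_card fun v hv ↦ ?_
  rw [Set.Finite.mem_toFinset, Set.mem_ofPred_eq]
  rw [mem_insert, mem_singleton] at hv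
  rcases hv with rfl | rfl
  · exact hxy
  · rw [← hxy]; simp [bVal]

/-- Strong s-regularity applied to the minimal represented square: every prime factor of the
minimum `m` divides twice the discriminant. -/
lemma bRep_mul_sq {a b c : ℤ} {m d : ℕ} (hm : 0 < m) (hdisc : bDisc a b c = d)
    (hreg : bASSR a b c ∅) (h0 : bRep a b c ((m : ℤ) ^ 2) ≠ 0)
    (hmin : ∀ k : ℕ, 0 < k → bRep a b c ((k : ℤ) ^ 2) ≠ 0 → m ≤ k) {n : ℕ} (hn : 0 < n)
    (hc : n.Coprime (2 * d)) :
    (bRep a b c (((m : ℤ) * n) ^ 2) : ℝ) = bRep a b c ((m : ℤ) ^ 2) * localProd d n := by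
  have hcop : ∀ k : ℕ, k.Coprime (2 * d) → IsCoprime (k : ℤ) (2 * bDisc a b c) := by
    intro k hk
    rw [hdisc]
    exact_mod_cast Nat.isCoprime_iff_coprime.2 hk
  have hprime : ∀ p : ℕ, p.Prime → p ∣ m → (p : ℤ) ∣ 2 * bDisc a b c := by
    obtain ⟨r, hr, hmax⟩ := (m.divisors.filter fun r ↦ r.Coprime (2 * d)).exists_max_image id
      ⟨1, by simp [hm.ne']⟩
    rw [mem_filter, Nat.mem_divisors] at hr
    obtain ⟨⟨⟨s, rfl⟩, -⟩, hrc⟩ := hr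
    have hr0 : 0 < r := Nat.pos_of_mul_pos_right hm
    have hs0 : 0 < s := Nat.pos_of_mul_pos_left hm
    have hdvd : ∀ p : ℕ, p.Prime → p ∣ s → (p : ℤ) ∣ 2 * bDisc a b c := by
      intro p hp hps
      rw [hdisc]
      by_contra hnd
      have hpc : p.Coprime (2 * d) := (hp.coprime_iff_not_dvd).2 (by exact_mod_cast hnd)
      have := hmax (r * p) (by
        rw [mem_filter, Nat.mem_divisors]
        exact ⟨⟨Nat.mul_dvd_mul_left r hps, hm.ne'⟩, hrc.mul_left hpc⟩)
      simp only [id] at this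
      nlinarith [hp.two_le]
    have h1 := hreg s r hs0 hr0 (fun p hp hps ↦ Or.inr (hdvd p hp hps)) (hcop r hrc) (by simp)
    have h2 : bRep a b c ((s : ℤ) ^ 2) ≠ 0 := by
      intro hz
      rw [hz, Nat.cast_zero, zero_mul] at h1
      refine h0 ?_
      rw [Nat.cast_mul, mul_comm]
      exact_mod_cast h1
    have h3 := hmin s hs0 h2
    have hr1 : r = 1 := by nlinarith
    rw [hr1, one_mul]
    exact hdvd
  have h1 := hreg m n hm hn (fun p hp hpm ↦ Or.inr (hprime p hp hpm)) (hcop n hc) (by simp)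
  rw [localProd, ← hdisc]
  exact_mod_cast h1

lemma exists_fewReps (m : ℕ) (hm : 0 < m) : ∃ C : ℝ, ∀ (a b c : ℤ) (d : ℕ), bPosDef a b c →
    bDisc a b c = d → bASSR a b c ∅ → bRep a b c ((m : ℤ) ^ 2) ≠ 0 →
    (∀ k : ℕ, 0 < k → bRep a b c ((k : ℤ) ^ 2) ≠ 0 → m ≤ k) → FewReps C d := by
  obtain ⟨C₀, hC₀, hdiv⟩ := exists_card_divisors_le (ε := 1 / 200) (by norm_num)
  refine ⟨402 * (m : ℝ) ^ 2 * C₀ * (4 * (m : ℝ) ^ 4) ^ (1 / 200 : ℝ)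
    * (2 * (m : ℝ) ^ 2) ^ (1 / 200 : ℝ), fun a b c d hpd hdisc hreg h0 hmin N hN ↦ ?_⟩
  have hd : 0 < d := by
    have := (bDisc_pos hpd).2.2
    rw [hdisc] at this
    exact_mod_cast this
  have hm2 : ((m : ℤ) ^ 2) ≠ 0 := by positivity
  have hN0 : (0 : ℝ) < N := by exact_mod_cast hN
  obtain ⟨x₀, y₀, hv⟩ := (bRep_ne_zero_iff hpd _).1 h0
  set R : ℕ → Finset (ℤ × ℤ) := fun n ↦ (finite_setOf_bVal_eq hpd (((m : ℤ) * n) ^ 2)).toFinset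
    with hR
  have hmemR : ∀ n w, w ∈ R n ↔ bVal a b c w.1 w.2 = ((m : ℤ) * n) ^ 2 := by
    intro n w; simp [hR]
  have hkey : ∀ n ∈ (Ioc 0 N).filter (fun n ↦ n.Coprime (2 * d)),
      localProd d n - 1 ≤ 1 / 2 * (#((R n).filter fun w ↦ x₀ * w.2 - y₀ * w.1 ≠ 0) : ℝ) := by
    intro n hn
    rw [mem_filter, mem_Ioc] at hn
    have hH := (divSum_localProd (by omega) hn.2).2.1
    have h1 := bRep_mul_sq hm hdisc hreg h0 hmin hn.1.1 hn.2
    rw [bRep_eq_card hpd] at h1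
    have h2 : (2 : ℝ) ≤ bRep a b c ((m : ℤ) ^ 2) := by exact_mod_cast two_le_bRep hpd hm2 h0
    have h3 : #((R n).filter fun w ↦ x₀ * w.2 - y₀ * w.1 = 0) ≤ 2 :=
      card_le_two_of_proportional hv hm2 fun w hw ↦ by
        rw [mem_filter, hmemR] at hw; exact hw
    have h4 := card_filter_add_card_filter_not (s := R n) (fun w ↦ x₀ * w.2 - y₀ * w.1 = 0)
    have h3' : (#((R n).filter fun w ↦ x₀ * w.2 - y₀ * w.1 = 0) : ℝ) ≤ 2 := by exact_mod_cast h3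
    have h4' : (#((R n).filter fun w ↦ x₀ * w.2 - y₀ * w.1 = 0) : ℝ)
        + (#((R n).filter fun w ↦ x₀ * w.2 - y₀ * w.1 ≠ 0) : ℝ) = #(R n) := by exact_mod_cast h4
    have h1' : (#(R n) : ℝ) = bRep a b c ((m : ℤ) ^ 2) * localProd d n := h1
    nlinarith
  have hcount := sum_card_rpow_le (N := N) hm hd hdisc hv
    (S := fun n ↦ (R n).filter fun w ↦ x₀ * w.2 - y₀ * w.1 ≠ 0)
    (fun n w hw ↦ by rw [mem_filter, hmemR] at hw; exact hw)
    (τ := C₀ * (4 * (m : ℝ) ^ 4 * (N : ℝ) ^ 2) ^ (1 / 200 : ℝ)) (fun k hk hkN ↦ by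
      refine (hdiv k hk).trans ?_
      gcongr
      exact_mod_cast hkN)
  have hharm := sum_inv_le (K := 2 * m ^ 2 * N) (by positivity) (ε := 1 / 200) (by norm_num)
  calc ∑ n ∈ (Ioc 0 N).filter (fun n ↦ n.Coprime (2 * d)),
        (localProd d n - 1) * (n : ℝ) ^ (-(99 / 100) : ℝ)
      ≤ ∑ n ∈ (Ioc 0 N).filter (fun n ↦ n.Coprime (2 * d)),
        1 / 2 * ((#((R n).filter fun w ↦ x₀ * w.2 - y₀ * w.1 ≠ 0) : ℝ)
          * (n : ℝ) ^ (-(99 / 100) : ℝ)) := by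
        refine Finset.sum_le_sum fun n hn ↦ ?_
        rw [← mul_assoc]
        exact mul_le_mul_of_nonneg_right (hkey n hn) (by positivity)
    _ ≤ ∑ n ∈ Ioc 0 N, 1 / 2 * ((#((R n).filter fun w ↦ x₀ * w.2 - y₀ * w.1 ≠ 0) : ℝ)
          * (n : ℝ) ^ (-(99 / 100) : ℝ)) :=
        Finset.sum_le_sum_of_subset_of_nonneg (filter_subset _ _) fun n _ _ ↦ by positivity
    _ ≤ 1 / 2 * ((N : ℝ) ^ (1 / 100 : ℝ) * (4 * (m : ℝ) ^ 2) * (d : ℝ) ^ (-(1 / 2) : ℝ)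
          * (C₀ * (4 * (m : ℝ) ^ 4 * (N : ℝ) ^ 2) ^ (1 / 200 : ℝ))
          * ((1 + 1 / (1 / 200)) * ((2 * m ^ 2 * N : ℕ) : ℝ) ^ (1 / 200 : ℝ))) := by
        rw [← Finset.mul_sum]
        refine mul_le_mul_of_nonneg_left (hcount.trans ?_) (by norm_num)
        gcongr
    _ = _ := by
        have e : (N : ℝ) ^ (1 / 40 : ℝ) = (N : ℝ) ^ (1 / 100 : ℝ) * (N : ℝ) ^ (1 / 100 : ℝ)
            * (N : ℝ) ^ (1 / 200 : ℝ) := by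
          rw [← Real.rpow_add hN0, ← Real.rpow_add hN0]; norm_num
        have e2 : ((N : ℝ) ^ 2) ^ (1 / 200 : ℝ) = (N : ℝ) ^ (1 / 100 : ℝ) := by
          rw [← Real.rpow_natCast, ← Real.rpow_mul hN0.le]; norm_num
        push_cast
        rw [Real.mul_rpow (by positivity) (by positivity), e2,
          Real.mul_rpow (x := 2 * (m : ℝ) ^ 2) (by positivity) hN0.le, e]
        ring

lemma exists_bEquiv_reduced {a b c : ℤ} {m d : ℕ} (hm : 0 < m) (hpd : bPosDef a b c)
    (hdisc : bDisc a b c = d) (h0 : bRep a b c ((m : ℤ) ^ 2) ≠ 0)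
    (hmin : ∀ k : ℕ, 0 < k → bRep a b c ((k : ℤ) ^ 2) ≠ 0 → m ≤ k) :
    ∃ b' c' : ℤ, b' ∈ Icc 0 (2 * (m : ℤ) ^ 2) ∧ c' ∈ Icc 0 ((d : ℤ) + 4 * (m : ℤ) ^ 4) ∧
      bEquiv a b c ((m : ℤ) ^ 2) b' c' := by
  have hmz : (0 : ℤ) < m := by exact_mod_cast hm
  obtain ⟨x₀, y₀, hv⟩ := (bRep_ne_zero_iff hpd _).1 h0
  have hprim : IsCoprime x₀ y₀ := by
    rw [Int.isCoprime_iff_gcd_eq_one]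
    obtain ⟨x₁, hx₁⟩ := Int.gcd_dvd_left x₀ y₀
    obtain ⟨y₁, hy₁⟩ := Int.gcd_dvd_right x₀ y₀
    set g := Int.gcd x₀ y₀ with hg
    have h1 : (g : ℤ) ^ 2 * bVal a b c x₁ y₁ = (m : ℤ) ^ 2 := by
      rw [← hv, hx₁, hy₁]; unfold bVal; ring
    have hgm : g ∣ m := by
      have : (g : ℤ) ^ 2 ∣ (m : ℤ) ^ 2 := ⟨_, h1.symm⟩
      rw [Int.pow_dvd_pow_iff two_ne_zero] at this
      exact_mod_cast this
    obtain ⟨k, rfl⟩ := hgm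
    have hg0 : 0 < g := Nat.pos_of_mul_pos_right hm
    have hk0 : 0 < k := Nat.pos_of_mul_pos_left hm
    have h2 : bVal a b c x₁ y₁ = (k : ℤ) ^ 2 := by
      have : (g : ℤ) ^ 2 ≠ 0 := by positivity
      apply mul_left_cancel₀ this
      rw [h1]; push_cast; ring
    have := hmin k hk0 ((bRep_ne_zero_iff hpd _).2 ⟨x₁, y₁, h2⟩)
    nlinarith
  obtain ⟨s, t, hst⟩ := hprim
  set j : ℤ := -(bPolar a b c x₀ y₀ (-t) s / (2 * (m : ℤ) ^ 2)) with hj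
  have hM : (0 : ℤ) < 2 * (m : ℤ) ^ 2 := by positivity
  set x₁ : ℤ := -t + j * x₀ with hx₁
  set y₁ : ℤ := s + j * y₀ with hy₁
  have hdet : x₀ * y₁ - x₁ * y₀ = 1 := by rw [hx₁, hy₁]; linear_combination hst
  have hb : bPolar a b c x₀ y₀ x₁ y₁ = bPolar a b c x₀ y₀ (-t) s % (2 * (m : ℤ) ^ 2) := by
    rw [Int.emod_def, ← hv, hx₁, hy₁]
    have : bPolar a b c x₀ y₀ (-t) s / (2 * bVal a b c x₀ y₀) = -j := by rw [hj, hv]; ring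
    rw [this]
    unfold bPolar bVal; ring
  have hb0 := Int.emod_nonneg (bPolar a b c x₀ y₀ (-t) s) hM.ne'
  have hb1 := Int.emod_lt_of_pos (bPolar a b c x₀ y₀ (-t) s) hM
  rw [← hb] at hb0 hb1
  have hc0 : 0 < bVal a b c x₁ y₁ := hpd x₁ y₁ (by rintro ⟨h1, h2⟩; rw [h1, h2] at hdet; simp at hdet)
  have hid := four_mul_bVal_mul_bVal a b c x₀ y₀ x₁ y₁
  rw [hv, hdisc, show x₀ * y₁ - y₀ * x₁ = 1 by linarith] at hid
  refine ⟨bPolar a b c x₀ y₀ x₁ y₁, bVal a b c x₁ y₁, mem_Icc.2 ⟨hb0, hb1.le⟩,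
    mem_Icc.2 ⟨hc0.le, ?_⟩, !![x₀, x₁; y₀, y₁], ?_, fun x y ↦ ?_⟩
  · have h1 : (1 : ℤ) ≤ (m : ℤ) ^ 2 := by
      have : (0 : ℤ) < (m : ℤ) ^ 2 := by positivity
      omega
    nlinarith
  · rw [Matrix.det_fin_two_of, hdet]
    exact isUnit_one
  · rw [← hv]
    simp only [Matrix.of_apply, Matrix.cons_val', Matrix.cons_val_zero, Matrix.cons_val_one,
      Matrix.cons_val_fin_one]
    unfold bVal bPolar; ring

/-- For each positive integer `m` there are only finitely many isometry classes of
strongly s-regular positive definite binary forms with `m_s(L) = m`. -/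
theorem stmt_8 (m : ℕ) (hm : 0 < m) :
    ∃ S : Finset (ℤ × ℤ × ℤ),
      ∀ a b c : ℤ, bPosDef a b c → bASSR a b c ∅ →
        (∃ n : ℕ, 0 < n ∧ bRep a b c ((n : ℤ) ^ 2) ≠ 0) →
        bMs a b c = m →
        ∃ t ∈ S, bEquiv a b c t.1 t.2.1 t.2.2 := by
  obtain ⟨C, hC⟩ := exists_fewReps m hm
  obtain ⟨D, hD⟩ := eventually_atTop.1 (eventually_not_fewReps C)
  refine ⟨{(m : ℤ) ^ 2} ×ˢ Icc 0 (2 * (m : ℤ) ^ 2) ×ˢ Icc 0 ((D : ℤ) + 4 * (m : ℤ) ^ 4),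
    fun a b c hpd hreg hex hms ↦ ?_⟩
  obtain ⟨d, hd⟩ := Int.eq_ofNat_of_zero_le (bDisc_pos hpd).2.2.le
  have h0 : bRep a b c ((m : ℤ) ^ 2) ≠ 0 := by
    have := Nat.sInf_mem (s := {n : ℕ | 0 < n ∧ bRep a b c ((n : ℤ) ^ 2) ≠ 0}) hex
    rw [← bMs, hms] at this
    exact this.2
  have hmin : ∀ k : ℕ, 0 < k → bRep a b c ((k : ℤ) ^ 2) ≠ 0 → m ≤ k := by
    intro k hk hk'
    rw [← hms]
    exact Nat.sInf_le ⟨hk, hk'⟩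
  have hdD : d < D := by
    by_contra! h
    exact hD d h (hC a b c d hpd hd hreg h0 hmin)
  obtain ⟨b', c', hb', hc', heq⟩ := exists_bEquiv_reduced hm hpd hd h0 hmin
  refine ⟨((m : ℤ) ^ 2, b', c'), ?_, heq⟩
  rw [mem_product, mem_product]
  refine ⟨mem_singleton_self _, hb', Icc_subset_Icc_right ?_ hc'⟩
  have : (d : ℤ) < D := by exact_mod_cast hdD
  linarith
end

section
/- Let L be a strongly s-regular positive definite integral quadratic form of rank k ≥ 3 that represents at least one nonzero square. Then every positive integer m such that m² is represented by L is a multiple of m_s(L) = min{n ≥ 1 : r(n², L) ≠ 0}. -/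
open Finset

/-- The value of the integral quadratic form `∑_{i ≤ j} a i j * x i * x j` at `x`. -/
def qfVal {k : ℕ} (a : Fin k → Fin k → ℤ) (x : Fin k → ℤ) : ℤ :=
  ∑ i : Fin k, ∑ j : Fin k, if i ≤ j then a i j * x i * x j else 0

/-- Positive definiteness of an integral quadratic form. -/
def qfPosDef {k : ℕ} (a : Fin k → Fin k → ℤ) : Prop :=
  ∀ x : Fin k → ℤ, x ≠ 0 → 0 < qfVal a x

/-- `qfRep a n` is the number of representations of `n` by the quadratic form. -/
noncomputable def qfRep {k : ℕ} (a : Fin k → Fin k → ℤ) (n : ℤ) : ℕ :=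
  Set.ncard {x : Fin k → ℤ | qfVal a x = n}

/-- The Hessian matrix `(∂²f/∂xᵢ∂xⱼ)` of the quadratic form. -/
def qfHess {k : ℕ} (a : Fin k → Fin k → ℤ) : Matrix (Fin k) (Fin k) ℤ :=
  Matrix.of fun i j => if i = j then 2 * a i i else if i < j then a i j else a j i

/-- The discriminant: determinant of the Hessian matrix. -/
def qfDisc {k : ℕ} (a : Fin k → Fin k → ℤ) : ℤ := (qfHess a).det

/-- The local factor `h_p(d, μ)` for a quadratic form of rank `k` with discriminant `d`. -/
def hp (k : ℕ) (d : ℤ) (p : ℕ) (μ : ℕ) : ℤ :=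
  if Even k then
    ∑ t ∈ Finset.range (2 * μ + 1),
      (jacobiSym ((-1) ^ (k / 2) * d) p) ^ t * (p : ℤ) ^ (((k - 2) / 2) * t)
  else
    ((p : ℤ) ^ ((k - 2) * (μ + 1)) - 1) / ((p : ℤ) ^ (k - 2) - 1) -
      (p : ℤ) ^ ((k - 3) / 2) * jacobiSym ((-1) ^ ((k - 1) / 2) * (d / 2)) p *
        (((p : ℤ) ^ ((k - 2) * μ) - 1) / ((p : ℤ) ^ (k - 2) - 1))

/-- Almost strong s-regularity with respect to a finite set `P` of primes. -/
def AlmostSSRegular {k : ℕ} (a : Fin k → Fin k → ℤ) (P : Finset ℕ) : Prop :=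
  ∀ n₁ n₂ : ℕ, 0 < n₁ → 0 < n₂ →
    (∀ p : ℕ, p.Prime → p ∣ n₁ → p ∈ P ∨ (p : ℤ) ∣ 2 * qfDisc a) →
    IsCoprime (n₂ : ℤ) (2 * qfDisc a) → (∀ p ∈ P, ¬ p ∣ n₂) →
    (qfRep a (((n₁ : ℤ) * (n₂ : ℤ)) ^ 2) : ℤ) =
      (qfRep a ((n₁ : ℤ) ^ 2) : ℤ) *
        ∏ p ∈ n₂.primeFactors, hp k (qfDisc a) p (n₂.factorization p)

/-- Strong s-regularity: almost strong s-regularity with respect to the empty set. -/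
def StronglySSRegular {k : ℕ} (a : Fin k → Fin k → ℤ) : Prop :=
  AlmostSSRegular a ∅

/-- The minimum of positive integers `n` such that `n²` is represented. -/
noncomputable def qfMs {k : ℕ} (a : Fin k → Fin k → ℤ) : ℕ :=
  sInf {n : ℕ | 0 < n ∧ qfRep a ((n : ℤ) ^ 2) ≠ 0}

/-- The Hessian is the sum of the upper triangular coefficient matrix and its transpose. -/
lemma qfHess_apply {k : ℕ} (a : Fin k → Fin k → ℤ) (i j : Fin k) :
    qfHess a i j = (if i ≤ j then a i j else 0) + if j ≤ i then a j i else 0 := by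
  simp only [qfHess, Matrix.of_apply]
  rcases lt_trichotomy i j with h | rfl | h
  · simp [h.ne, h, h.le, h.not_ge]
  · simp [two_mul]
  · simp [h.ne', h.not_gt, h.le, h.not_ge]

lemma qfHess_transpose {k : ℕ} (a : Fin k → Fin k → ℤ) : (qfHess a).transpose = qfHess a := by
  ext i j
  rw [Matrix.transpose_apply, qfHess_apply, qfHess_apply, add_comm]

lemma two_mul_qfVal {k : ℕ} (a : Fin k → Fin k → ℤ) (x : Fin k → ℤ) :
    2 * qfVal a x = x ⬝ᵥ (qfHess a).mulVec x := by
  have h : x ⬝ᵥ (qfHess a).mulVec x =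
      (∑ i, ∑ j, if i ≤ j then a i j * x i * x j else 0) +
        ∑ i, ∑ j, if j ≤ i then a j i * x j * x i else 0 := by
    simp only [dotProduct, Matrix.mulVec, Finset.mul_sum, ← Finset.sum_add_distrib, qfHess_apply]
    refine Finset.sum_congr rfl fun i _ => Finset.sum_congr rfl fun j _ => ?_
    split_ifs <;> ring
  rw [h, Finset.sum_comm (f := fun i j => if j ≤ i then a j i * x j * x i else 0), ← two_mul]
  rfl

lemma dotProduct_qfHess_comm {k : ℕ} (a : Fin k → Fin k → ℤ) (x y : Fin k → ℤ) :
    y ⬝ᵥ (qfHess a).mulVec x = x ⬝ᵥ (qfHess a).mulVec y := by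
  rw [Matrix.dotProduct_mulVec, ← Matrix.mulVec_transpose, qfHess_transpose, dotProduct_comm]

/-- Expansion of the form on the plane spanned by two vectors. -/
lemma qfVal_smul_add_smul {k : ℕ} (a : Fin k → Fin k → ℤ) (x y : Fin k → ℤ) (s t : ℤ) :
    qfVal a (s • x + t • y) =
      s ^ 2 * qfVal a x + s * t * (x ⬝ᵥ (qfHess a).mulVec y) + t ^ 2 * qfVal a y := by
  have h := two_mul_qfVal a (s • x + t • y)
  simp only [Matrix.mulVec_add, Matrix.mulVec_smul, dotProduct_add, add_dotProduct,
    smul_dotProduct, dotProduct_smul, smul_eq_mul, dotProduct_qfHess_comm a x y,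
    ← two_mul_qfVal] at h
  linarith

lemma qfVal_neg {k : ℕ} (a : Fin k → Fin k → ℤ) (x : Fin k → ℤ) : qfVal a (-x) = qfVal a x := by
  simp [qfVal]

lemma qfPosDef.nonneg {k : ℕ} {a : Fin k → Fin k → ℤ} (ha : qfPosDef a) (x : Fin k → ℤ) :
    0 ≤ qfVal a x := by
  rcases eq_or_ne x 0 with rfl | hx
  · simp [qfVal]
  · exact (ha x hx).le

lemma qfPosDef.eq_zero_of_mulVec_eq_zero {k : ℕ} {a : Fin k → Fin k → ℤ} (ha : qfPosDef a)
    {x : Fin k → ℤ} (hx : (qfHess a).mulVec x = 0) : x = 0 := by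
  by_contra h
  have h1 := two_mul_qfVal a x
  rw [hx, dotProduct_zero] at h1
  linarith [ha x h]

lemma qfPosDef.qfDisc_ne_zero {k : ℕ} {a : Fin k → Fin k → ℤ} (ha : qfPosDef a) :
    qfDisc a ≠ 0 := by
  intro h
  obtain ⟨x, hx, hx'⟩ := Matrix.exists_mulVec_eq_zero_iff.mpr h
  exact hx (ha.eq_zero_of_mulVec_eq_zero hx')

/-- The Cauchy–Schwarz inequality for the polar form. -/
lemma qfPosDef.sq_polar_le {k : ℕ} {a : Fin k → Fin k → ℤ} (ha : qfPosDef a)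
    (x y : Fin k → ℤ) :
    (x ⬝ᵥ (qfHess a).mulVec y) ^ 2 ≤ 4 * qfVal a x * qfVal a y := by
  rcases eq_or_ne x 0 with rfl | hx
  · simp [qfVal]
  · have h := ha.nonneg ((-(x ⬝ᵥ (qfHess a).mulVec y)) • x + (2 * qfVal a x) • y)
    rw [qfVal_smul_add_smul] at h
    refine le_of_mul_le_mul_left ?_ (ha x hx)
    linarith

/-- A positive definite form represents each integer finitely often: by Cauchy–Schwarz the
Hessian, which is injective, maps the representations into a box. -/
lemma qfPosDef.finite_setOf_qfVal_eq {k : ℕ} {a : Fin k → Fin k → ℤ} (ha : qfPosDef a) (n : ℤ) :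
    {x : Fin k → ℤ | qfVal a x = n}.Finite := by
  let c : Fin k → ℤ := fun i => 4 * qfVal a (Pi.single i 1) * n
  refine Set.Finite.of_finite_image (f := (qfHess a).mulVec)
    ((Set.finite_Icc (-c) c).subset ?_) ?_
  · rintro _ ⟨x, rfl, rfl⟩
    have h : ∀ i, |(qfHess a).mulVec x i| ≤ c i := fun i => by
      have h1 := ha.sq_polar_le (Pi.single i 1) x
      rw [single_one_dotProduct, ← sq_abs] at h1
      exact (Int.le_self_sq _).trans h1
    exact ⟨fun i => (abs_le.mp (h i)).1, fun i => (abs_le.mp (h i)).2⟩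
  · intro x _ y _ hxy
    refine sub_eq_zero.mp (ha.eq_zero_of_mulVec_eq_zero ?_)
    rw [Matrix.mulVec_sub, sub_eq_zero]
    exact hxy

lemma qfPosDef.qfRep_ne_zero_iff {k : ℕ} {a : Fin k → Fin k → ℤ} (ha : qfPosDef a) (n : ℤ) :
    qfRep a n ≠ 0 ↔ ∃ x, qfVal a x = n :=
  Nat.pos_iff_ne_zero.symm.trans (Set.ncard_pos (ha.finite_setOf_qfVal_eq n))

/-- Weak approximation on the conic `f (s x + t y) = N²`: given vectors with values
`(p ^ i A)²` and `(p ^ j B)²`, there is a vector which looks like the second one at `p` and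
like the first one at the primes dividing `M`. -/
lemma exists_qfVal_eq_sq_of_polar_ne {k : ℕ} (a : Fin k → Fin k → ℤ) {x y : Fin k → ℤ}
    {p A B M : ℤ} (hp : Prime p) {i j : ℕ} (hx : qfVal a x = (p ^ i * A) ^ 2)
    (hy : qfVal a y = (p ^ j * B) ^ 2) (hA : ¬ p ∣ A) (hB : ¬ p ∣ B) (hM : ¬ p ∣ M)
    (hne : x ⬝ᵥ (qfHess a).mulVec y ≠ 2 * (p ^ i * A) * (p ^ j * B)) :
    ∃ z n, qfVal a z = (p ^ j * A * n) ^ 2 ∧ IsCoprime n M ∧ ¬ p ∣ n := by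
  set b := x ⬝ᵥ (qfHess a).mulVec y with hb
  obtain ⟨E, hE, hτ⟩ := (FiniteMultiplicity.of_prime_left hp
    (sub_ne_zero.mpr hne.symm)).exists_eq_pow_mul_and_not_dvd
  generalize multiplicity p _ = τ at hE
  obtain rfl | hA0 := eq_or_ne A 0
  · simp at hA
  have hpA : IsCoprime p A := (Prime.coprime_iff_not_dvd hp).mpr hA
  have hpM : IsCoprime p M := (Prime.coprime_iff_not_dvd hp).mpr hM
  obtain ⟨v, hv⟩ : ∃ v, v = A * M := ⟨_, rfl⟩
  have hpv : ¬ p ∣ v := by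
    rw [hv]; exact fun h => (hp.dvd_or_dvd h).elim hA hM
  obtain ⟨w, c, hwc⟩ : IsCoprime (p ^ (τ + j + 1)) v :=
    (hv ▸ hpA.mul_right hpM).pow_left
  set K := τ + j + 1 with hK
  obtain ⟨u, hu⟩ : ∃ u, u = p ^ j * B * v + p ^ K * w := ⟨_, rfl⟩
  have huv : u = 1 + (p ^ j * B - c) * v := by rw [hu]; linear_combination hwc
  obtain ⟨N, hN⟩ : ∃ N, N = B * v ^ 2 * E +
    p * (w * (2 * (p ^ i * A) * (p ^ j * B) * v + p ^ i * A * p ^ K * w - b * v)) := ⟨_, rfl⟩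
  have hpN : ¬ p ∣ N := by
    rw [hN, Int.dvd_add_left (Dvd.intro _ rfl)]
    exact fun h => (hp.dvd_or_dvd h).elim
      (fun h => (hp.dvd_or_dvd h).elim hB fun h => hpv (hp.dvd_of_dvd_pow h)) hτ
  have hNu : p ^ (τ + j) * N = A * (p ^ i * u ^ 2 +
      M * (-b * u + p ^ i * A * (p ^ j * B) ^ 2 * v)) := by
    have h1 : A * (p ^ i * u ^ 2 + M * (-b * u + p ^ i * A * (p ^ j * B) ^ 2 * v)) =
      p ^ i * A * u ^ 2 - b * u * v + p ^ i * A * (p ^ j * B) ^ 2 * v ^ 2 := by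
      rw [hv]; ring
    rw [h1, hN, hu, hK]
    linear_combination (-(p ^ j * B * v ^ 2)) * hE
  obtain ⟨n, rfl⟩ : A ∣ N := (hpA.symm.pow_right (n := τ + j)).dvd_of_dvd_mul_left
    (Dvd.intro _ hNu.symm)
  have hn : p ^ (τ + j) * n =
      p ^ i * u ^ 2 + M * (-b * u + p ^ i * A * (p ^ j * B) ^ 2 * v) := by
    apply mul_left_cancel₀ hA0
    rw [← hNu]; ring
  refine ⟨(-(p ^ (j + 1) * w * (2 * (p ^ j * B) * v + p ^ K * w))) • x +
    (v * (E * v + 2 * (p ^ i * A) * p ^ (j + 1) * w)) • y, n, ?_, ?_, fun h => hpN (h.mul_left A)⟩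
  · rw [qfVal_smul_add_smul, hx, hy, ← hb]
    have hp0 : p ^ τ ≠ 0 := pow_ne_zero _ hp.ne_zero
    apply mul_left_cancel₀ (pow_ne_zero 2 hp0)
    have hs : p ^ τ * -(p ^ (j + 1) * w * (2 * (p ^ j * B) * v + p ^ K * w)) =
        (p ^ j * B) ^ 2 * v ^ 2 - u ^ 2 := by
      rw [hu, hK]; ring
    have ht : p ^ τ * (v * (E * v + 2 * (p ^ i * A) * p ^ (j + 1) * w)) =
        v * (2 * (p ^ i * A) * u - b * v) := by
      rw [hu, hK]; linear_combination (-(v ^ 2)) * hE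
    have hN' : p ^ τ * (p ^ j * A * n) =
        p ^ i * A * u ^ 2 - b * u * v + p ^ i * A * (p ^ j * B) ^ 2 * v ^ 2 := by
      rw [hv] at hn ⊢; linear_combination A * hn
    generalize -(p ^ (j + 1) * w * (2 * (p ^ j * B) * v + p ^ K * w)) = s at hs ⊢
    generalize v * (E * v + 2 * (p ^ i * A) * p ^ (j + 1) * w) = t at ht ⊢
    calc _ = (p ^ τ * s) ^ 2 * (p ^ i * A) ^ 2 + (p ^ τ * s) * (p ^ τ * t) * b +
          (p ^ τ * t) ^ 2 * (p ^ j * B) ^ 2 := by ring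
      _ = (p ^ τ * (p ^ j * A * n)) ^ 2 := by rw [hs, ht, hN']; ring
      _ = _ := by ring
  · have huM : IsCoprime u M := by
      rw [huv, hv]
      exact ⟨1, -((p ^ j * B - c) * A), by ring⟩
    have h : IsCoprime (p ^ (τ + j) * n) M := by
      rw [hn]
      exact ((hpM.pow_left).mul_left huM.pow_left).add_mul_left_left _
    exact h.of_mul_left_right

lemma exists_qfVal_eq_sq {k : ℕ} (a : Fin k → Fin k → ℤ) {x y : Fin k → ℤ}
    {p A B M : ℤ} (hp : Prime p) {i j : ℕ} (hx : qfVal a x = (p ^ i * A) ^ 2)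
    (hy : qfVal a y = (p ^ j * B) ^ 2) (hA : ¬ p ∣ A) (hB : ¬ p ∣ B) (hM : ¬ p ∣ M) :
    ∃ z n, qfVal a z = (p ^ j * A * n) ^ 2 ∧ IsCoprime n M ∧ ¬ p ∣ n := by
  by_cases h : x ⬝ᵥ (qfHess a).mulVec y = 2 * (p ^ i * A) * (p ^ j * B)
  · refine exists_qfVal_eq_sq_of_polar_ne a hp hx ((qfVal_neg a y).trans hy) hA hB hM ?_
    rw [Matrix.mulVec_neg, dotProduct_neg, h]
    intro h0
    have h1 : (p ^ i * A) * (p ^ j * B) = 0 := by linarith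
    have hA0 : A ≠ 0 := by rintro rfl; simp at hA
    have hB0 : B ≠ 0 := by rintro rfl; simp at hB
    simp [hp.ne_zero, hA0, hB0] at h1
  · exact exists_qfVal_eq_sq_of_polar_ne a hp hx hy hA hB hM h

/-- Removing a factor prime to `2df` from a represented square. -/
lemma StronglySSRegular.qfRep_sq_ne_zero {k : ℕ} {a : Fin k → Fin k → ℤ}
    (ha : StronglySSRegular a) {n₁ n₂ : ℕ} (h1 : 0 < n₁) (h2 : 0 < n₂)
    (hn1 : ∀ p : ℕ, p.Prime → p ∣ n₁ → (p : ℤ) ∣ 2 * qfDisc a)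
    (hn2 : IsCoprime (n₂ : ℤ) (2 * qfDisc a))
    (h : qfRep a (((n₁ : ℤ) * (n₂ : ℤ)) ^ 2) ≠ 0) : qfRep a ((n₁ : ℤ) ^ 2) ≠ 0 := by
  have h3 := ha n₁ n₂ h1 h2 (fun p hp hd => Or.inr (hn1 p hp hd)) hn2 (by simp)
  intro h0
  rw [h0, Nat.cast_zero, zero_mul] at h3
  exact h (by exact_mod_cast h3)

lemma qfMs_spec {k : ℕ} {a : Fin k → Fin k → ℤ}
    (hsq : ∃ n : ℕ, 0 < n ∧ qfRep a ((n : ℤ) ^ 2) ≠ 0) :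
    0 < qfMs a ∧ qfRep a ((qfMs a : ℤ) ^ 2) ≠ 0 :=
  Nat.sInf_mem (s := {n : ℕ | 0 < n ∧ qfRep a ((n : ℤ) ^ 2) ≠ 0}) hsq

lemma qfMs_le {k : ℕ} {a : Fin k → Fin k → ℤ} {n : ℕ} (hn : 0 < n)
    (h : qfRep a ((n : ℤ) ^ 2) ≠ 0) : qfMs a ≤ n :=
  Nat.sInf_le ⟨hn, h⟩

/-- Every positive integer splits into a part supported on the primes dividing `d` and a part
prime to `d`. -/
lemma exists_mul_isCoprime (d : ℤ) {n : ℕ} (hn : 0 < n) : ∃ n₁ n₂ : ℕ, n = n₁ * n₂ ∧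
    (∀ p : ℕ, p.Prime → p ∣ n₁ → (p : ℤ) ∣ d) ∧ IsCoprime (n₂ : ℤ) d := by
  induction n using Nat.strong_induction_on with
  | _ n ih =>
    by_cases h : Nat.Coprime n d.natAbs
    · refine ⟨1, n, by simp, fun p hp h1 => absurd h1 hp.not_dvd_one, ?_⟩
      rw [Int.isCoprime_iff_gcd_eq_one]
      simpa [Int.gcd] using h
    · obtain ⟨p, hp, ⟨c, rfl⟩, hpd⟩ := Nat.Prime.not_coprime_iff_dvd.mp h
      have hc : 0 < c := Nat.pos_of_mul_pos_left hn
      obtain ⟨n₁, n₂, rfl, h1, h2⟩ := ih c (lt_mul_left hc hp.one_lt) hc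
      refine ⟨p * n₁, n₂, (mul_assoc _ _ _).symm, fun q hq hd => ?_, h2⟩
      rcases (Nat.Prime.dvd_mul hq).mp hd with hd | hd
      · rw [(Nat.prime_dvd_prime_iff_eq hq hp).mp hd]
        exact Int.natCast_dvd.mpr hpd
      · exact h1 q hq hd

/-- All prime factors of `m_s(L)` divide `2df`. -/
lemma StronglySSRegular.dvd_of_dvd_qfMs {k : ℕ} {a : Fin k → Fin k → ℤ}
    (ha : StronglySSRegular a) (hsq : ∃ n : ℕ, 0 < n ∧ qfRep a ((n : ℤ) ^ 2) ≠ 0)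
    {p : ℕ} (hp : p.Prime) (hd : p ∣ qfMs a) : (p : ℤ) ∣ 2 * qfDisc a := by
  obtain ⟨hpos, hrep⟩ := qfMs_spec hsq
  obtain ⟨n₁, n₂, hn, h1, h2⟩ := exists_mul_isCoprime (2 * qfDisc a) hpos
  rw [hn] at hpos hrep
  have hn1 : 0 < n₁ := Nat.pos_of_mul_pos_right hpos
  have hn2 : 0 < n₂ := Nat.pos_of_mul_pos_left hpos
  rw [Nat.cast_mul] at hrep
  have hle := qfMs_le hn1 (ha.qfRep_sq_ne_zero hn1 hn2 h1 h2 hrep)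
  have hn2' : n₂ = 1 := by nlinarith
  rw [hn2', mul_one] at hn
  exact h1 p hp (hn ▸ hd)

/-- For a strongly s-regular positive definite form of rank `k ≥ 3` representing a
nonzero square, every positive integer `m` with `m²` represented is a multiple of
`m_s(L)`. -/
theorem stmt_9 (k : ℕ) (hk : 3 ≤ k) (a : Fin k → Fin k → ℤ) (hpos : qfPosDef a)
    (hreg : StronglySSRegular a)
    (hsq : ∃ n : ℕ, 0 < n ∧ qfRep a ((n : ℤ) ^ 2) ≠ 0)
    (m : ℕ) (hm : 0 < m) (hrep : qfRep a ((m : ℤ) ^ 2) ≠ 0) :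
    qfMs a ∣ m := by
  obtain ⟨hs, hsrep⟩ := qfMs_spec hsq
  rw [← Nat.factorization_prime_le_iff_dvd hs.ne' hm.ne']
  intro p hp
  by_contra! hlt
  have hp' : Prime (p : ℤ) := Nat.prime_iff_prime_int.mp hp
  obtain ⟨x, hx⟩ := (hpos.qfRep_ne_zero_iff _).mp hsrep
  obtain ⟨y, hy⟩ := (hpos.qfRep_ne_zero_iff _).mp hrep
  obtain ⟨i, A, hA, hsA⟩ := Nat.exists_eq_pow_mul_and_not_dvd hs.ne' p hp.ne_one
  obtain ⟨j, B, hB, hmB⟩ := Nat.exists_eq_pow_mul_and_not_dvd hm.ne' p hp.ne_one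
  have hij : j < i := by
    have hv : ∀ {e C : ℕ}, ¬ p ∣ C → (p ^ e * C).factorization p = e := fun {e C} hC => by
      rw [Nat.factorization_mul (pow_ne_zero _ hp.ne_zero) (by rintro rfl; simp at hC)]
      simp [hp, Nat.factorization_eq_zero_of_not_dvd hC]
    rwa [hmB, hsA, hv hA, hv hB] at hlt
  obtain ⟨M, hM, hdM⟩ := (FiniteMultiplicity.of_prime_left hp'
    (mul_ne_zero two_ne_zero hpos.qfDisc_ne_zero)).exists_eq_pow_mul_and_not_dvd
  generalize multiplicity (p : ℤ) _ = e at hM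
  obtain ⟨z, n, hz, hnM, hpn⟩ := exists_qfVal_eq_sq a (p := p) (A := A) (B := B) (M := M)
    (i := i) (j := j) hp' (by rw [hx, hsA]; push_cast; rfl) (by rw [hy, hmB]; push_cast; rfl)
    (by exact_mod_cast hA) (by exact_mod_cast hB) hdM
  have hn : IsCoprime n (2 * qfDisc a) := by
    rw [hM]
    exact (((Prime.coprime_iff_not_dvd hp').mpr hpn).symm.pow_right).mul_right hnM
  have hA0 : 0 < A := Nat.pos_of_ne_zero (by rintro rfl; simp at hA)
  have hn0 : 0 < n.natAbs := Int.natAbs_pos.mpr (by rintro rfl; simp at hpn)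
  have hjA : 0 < p ^ j * A := Nat.mul_pos (pow_pos hp.pos _) hA0
  have hjs : p ^ j * A ∣ qfMs a := hsA ▸ Nat.mul_dvd_mul_right (pow_dvd_pow p hij.le) A
  have hle := qfMs_le hjA (hreg.qfRep_sq_ne_zero hjA hn0
    (fun q hq hd => hreg.dvd_of_dvd_qfMs hsq hq (hd.trans hjs))
    (by simpa using hn.abs_left)
    ((hpos.qfRep_ne_zero_iff _).mpr ⟨z, by rw [hz]; push_cast; simp [mul_pow]⟩))
  rw [hsA] at hle
  exact absurd (Nat.le_of_mul_le_mul_right hle hA0)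
    (not_le.mpr (Nat.pow_lt_pow_right hp.one_lt hij))
end

section
/- For every integer k ≥ 2 there exists a constant C(k) > 0, depending only on k, such that for every positive definite integral quadratic form L of rank k and every positive integer n, r(n, L) ≤ C(k) · ( n^{(k−1)/2} · (dL)^{−(k−1)/(2k)} + Σ_{i=1}^{k−1} n^{(k−1−i)/2} ). -/
open Finset

open Matrix in
/-- A symmetric integer matrix whose form `x ↦ xᵀ H x` is positive on nonzero integer vectors. -/
def IsPosGram {k : ℕ} (H : Matrix (Fin k) (Fin k) ℤ) : Prop :=
  H.IsSymm ∧ ∀ x : Fin k → ℤ, x ≠ 0 → 0 < x ⬝ᵥ (H *ᵥ x)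

open Matrix in
theorem IsPosGram.nonneg {k : ℕ} {H : Matrix (Fin k) (Fin k) ℤ} (hH : IsPosGram H)
    (x : Fin k → ℤ) : 0 ≤ x ⬝ᵥ (H *ᵥ x) := by
  rcases eq_or_ne x 0 with rfl | hx
  · simp
  · exact (hH.2 x hx).le

/-- The fraction-free Schur complement of the top left entry. -/
def schurInt {k : ℕ} (H : Matrix (Fin (k + 1)) (Fin (k + 1)) ℤ) : Matrix (Fin k) (Fin k) ℤ :=
  Matrix.of fun i j => H 0 0 * H i.succ j.succ - H i.succ 0 * H 0 j.succ

theorem schurInt_det {k : ℕ} (H : Matrix (Fin (k + 1)) (Fin (k + 1)) ℤ) :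
    (schurInt H).det * H 0 0 = H 0 0 ^ k * H.det := by
  set c : Fin (k + 1) → ℤ := Fin.cons 0 fun i => -H i.succ 0 with hc
  set v : Fin (k + 1) → ℤ := Fin.cons 1 fun _ => H 0 0 with hv
  set B : Matrix (Fin (k + 1)) (Fin (k + 1)) ℤ := Matrix.of fun i j => v i * H i j with hB
  have hdB : B.det = H 0 0 ^ k * H.det := by
    rw [hB, Matrix.det_mul_column]
    simp [hv, Fin.prod_univ_succ]
  set A : Matrix (Fin (k + 1)) (Fin (k + 1)) ℤ := Matrix.of fun i j => B i j + c i * B 0 j with hA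
  have hdA : A.det = B.det :=
    Matrix.det_eq_of_forall_row_eq_smul_add_const c 0 (by simp [hc]) fun i j => by simp [hA]
  rw [← hdB, ← hdA, Matrix.det_succ_column_zero, Fin.sum_univ_succ, Finset.sum_eq_zero]
  · have : A.submatrix (Fin.succAbove 0) Fin.succ = schurInt H := by
      ext i j
      simp [hA, hB, hc, hv, schurInt]
      ring
    rw [this]
    simp [hA, hB, hc, hv, mul_comm]
  · intro i _
    have : A i.succ 0 = 0 := by
      simp [hA, hB, hc, hv]
      ring
    simp [this]

open Matrix in
theorem mul_gram_cons {k : ℕ} (H : Matrix (Fin (k + 1)) (Fin (k + 1)) ℤ) (hH : H.IsSymm)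
    (t : ℤ) (y : Fin k → ℤ) :
    H 0 0 * ((Fin.cons t y : Fin (k + 1) → ℤ) ⬝ᵥ (H *ᵥ Fin.cons t y)) =
      (H 0 0 * t + ∑ i, H 0 i.succ * y i) ^ 2 + y ⬝ᵥ (schurInt H *ᵥ y) := by
  have hs : ∀ i, H i 0 = H 0 i := fun i => hH.apply 0 i
  have h1 : y ⬝ᵥ (schurInt H *ᵥ y) =
      H 0 0 * (∑ i, y i * ∑ j, H i.succ j.succ * y j) - (∑ i, H 0 i.succ * y i) ^ 2 := by
    rw [sq, Finset.sum_mul, Finset.mul_sum, ← Finset.sum_sub_distrib]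
    refine Finset.sum_congr rfl fun i _ => ?_
    simp only [mulVec, dotProduct, schurInt, Matrix.of_apply, hs, sub_mul, Finset.sum_sub_distrib]
    simp only [mul_assoc, ← Finset.mul_sum]
    ring
  rw [h1]
  simp only [dotProduct, mulVec, Fin.sum_univ_succ, Fin.cons_zero, Fin.cons_succ, hs, mul_add,
    Finset.sum_add_distrib]
  have h2 : ∑ x, y x * (H 0 x.succ * t) = t * ∑ i, H 0 i.succ * y i := by
    rw [Finset.mul_sum]
    exact Finset.sum_congr rfl fun _ _ => by ring
  rw [h2]
  ring

theorem exists_two_mul_abs_le (m l : ℤ) (hm : 0 < m) : ∃ t : ℤ, 4 * (m * t + l) ^ 2 ≤ m ^ 2 := by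
  refine ⟨-round ((l : ℚ) / m), ?_⟩
  have h := abs_sub_round ((l : ℚ) / m)
  have hm' : (0 : ℚ) < m := by exact_mod_cast hm
  set r := round ((l : ℚ) / m)
  have h1 : (4 * (m * (-r : ℚ) + l) ^ 2 : ℚ) = m ^ 2 * (4 * |(l : ℚ) / m - r| ^ 2) := by
    rw [sq_abs]
    field_simp
    ring
  have h2 : 4 * |(l : ℚ) / m - r| ^ 2 ≤ 1 := by
    nlinarith [abs_nonneg ((l : ℚ) / m - r)]
  have h3 : (4 * (m * (-r : ℚ) + l) ^ 2 : ℚ) ≤ m ^ 2 := by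
    rw [h1]
    nlinarith [sq_nonneg (m : ℚ)]
  exact_mod_cast h3

open Matrix in
theorem IsPosGram.exists_min {k : ℕ} {H : Matrix (Fin (k + 1)) (Fin (k + 1)) ℤ}
    (hH : IsPosGram H) :
    ∃ v : Fin (k + 1) → ℤ, v ≠ 0 ∧ ∀ x, x ≠ 0 → v ⬝ᵥ (H *ᵥ v) ≤ x ⬝ᵥ (H *ᵥ x) := by
  classical
  have hex : ∃ n : ℕ, ∃ x : Fin (k + 1) → ℤ, x ≠ 0 ∧ x ⬝ᵥ (H *ᵥ x) = n := by
    have h1 : (1 : Fin (k + 1) → ℤ) ≠ 0 := one_ne_zero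
    exact ⟨_, 1, h1, (Int.toNat_of_nonneg (hH.2 1 h1).le).symm⟩
  obtain ⟨v, hv, hvn⟩ := Nat.find_spec hex
  refine ⟨v, hv, fun x hx => ?_⟩
  have hxn := Int.toNat_of_nonneg (hH.2 x hx).le
  have := Nat.find_min' hex ⟨x, hx, hxn.symm⟩
  rw [hvn]
  omega

/-- Every nonzero vector is a multiple of some member of some basis, placed at index `0`. -/
theorem exists_basis_smul_eq {k : ℕ} (v : Fin (k + 1) → ℤ) (hv : v ≠ 0) :
    ∃ (b : Module.Basis (Fin (k + 1)) ℤ (Fin (k + 1) → ℤ)) (c : ℤ), v = c • b 0 := by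
  obtain ⟨n, bM, bN, f, a, snf⟩ :=
    (Submodule.span ℤ {v}).smithNormalForm (Pi.basisFun ℤ (Fin (k + 1)))
  have hn : n = 1 := by
    have h1 := Module.finrank_eq_card_basis bN
    rw [← (LinearEquiv.toSpanNonzeroSingleton ℤ _ v hv).finrank_eq] at h1
    simpa using h1.symm
  subst hn
  obtain ⟨c, hc⟩ := bN.mem_submodule_iff.mp (Submodule.mem_span_singleton_self v)
  refine ⟨bM.reindex (Equiv.swap (f 0) 0), c 0 * a 0, ?_⟩
  rw [hc]
  simp [Finsupp.sum_fintype, snf, mul_smul]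

open Matrix in
/-- A change of basis making the top left entry of the Gram matrix minimal. -/
theorem IsPosGram.exists_equiv {k : ℕ} {H : Matrix (Fin (k + 1)) (Fin (k + 1)) ℤ}
    (hH : IsPosGram H) :
    ∃ (G : Matrix (Fin (k + 1)) (Fin (k + 1)) ℤ)
      (e : (Fin (k + 1) → ℤ) ≃ₗ[ℤ] (Fin (k + 1) → ℤ)),
      IsPosGram G ∧ G.det = H.det ∧ (∀ x, e x ⬝ᵥ (G *ᵥ e x) = x ⬝ᵥ (H *ᵥ x)) ∧
      ∀ x, x ≠ 0 → G 0 0 ≤ x ⬝ᵥ (G *ᵥ x) := by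
  obtain ⟨v, hv, hmin⟩ := hH.exists_min
  obtain ⟨b, c, hbc⟩ := exists_basis_smul_eq v hv
  set U := (Pi.basisFun ℤ (Fin (k + 1))).toMatrix b with hU
  have hUd : U.det * U.det = 1 := by
    have h := (Pi.basisFun ℤ (Fin (k + 1))).isUnit_det b
    rw [Module.Basis.det_apply] at h
    exact Int.isUnit_mul_self h
  have hmul : ∀ x, U *ᵥ (b.equivFun x) = x := by
    intro x
    conv_rhs => rw [← b.sum_equivFun x]
    ext i
    simp [hU, mulVec, dotProduct, Module.Basis.toMatrix_apply, mul_comm]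
  have hval : ∀ x, b.equivFun x ⬝ᵥ ((Uᵀ * H * U) *ᵥ b.equivFun x) = x ⬝ᵥ (H *ᵥ x) := by
    intro x
    rw [← mulVec_mulVec, ← mulVec_mulVec, hmul, dotProduct_mulVec, vecMul_transpose, hmul]
  have hval' : ∀ y, y ⬝ᵥ ((Uᵀ * H * U) *ᵥ y) =
      b.equivFun.symm y ⬝ᵥ (H *ᵥ b.equivFun.symm y) := by
    intro y
    rw [← hval, LinearEquiv.apply_symm_apply]
  have h00 : (Uᵀ * H * U) 0 0 = b 0 ⬝ᵥ (H *ᵥ b 0) := by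
    have : b.equivFun (b 0) = Pi.single 0 1 := by
      ext i
      simp [Pi.single_apply, eq_comm]
    rw [← hval, this]
    simp
  have hb0 : (Uᵀ * H * U) 0 0 ≤ v ⬝ᵥ (H *ᵥ v) := by
    rw [h00, hbc]
    have hc : c ≠ 0 := by
      rintro rfl
      simp [hbc] at hv
    have hp := hH.2 _ (b.ne_zero 0)
    have hc2 : 1 ≤ c * c := by
      have := mul_self_pos.2 hc
      omega
    simp only [mulVec_smul, dotProduct_smul, smul_dotProduct, smul_eq_mul]
    nlinarith
  refine ⟨Uᵀ * H * U, b.equivFun, ⟨?_, ?_⟩, ?_, hval, ?_⟩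
  · rw [Matrix.IsSymm, transpose_mul, transpose_mul, transpose_transpose, hH.1, Matrix.mul_assoc]
  · intro y hy
    rw [hval']
    exact hH.2 _ (b.equivFun.symm.map_ne_zero_iff.2 hy)
  · rw [det_mul, det_mul, det_transpose]
    linear_combination H.det * hUd
  · intro y hy
    rw [hval']
    exact hb0.trans (hmin _ (b.equivFun.symm.map_ne_zero_iff.2 hy))

open Matrix in
/-- One step of Hermite reduction. -/
theorem IsPosGram.exists_reduction {k : ℕ} {H : Matrix (Fin (k + 1)) (Fin (k + 1)) ℤ}
    (hH : IsPosGram H) :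
    ∃ (m : ℤ) (H' : Matrix (Fin k) (Fin k) ℤ) (e : (Fin (k + 1) → ℤ) ≃ ℤ × (Fin k → ℤ))
      (l : (Fin k → ℤ) → ℤ),
      0 < m ∧ (∃ v, v ≠ 0 ∧ v ⬝ᵥ (H *ᵥ v) = m) ∧ IsPosGram H' ∧ H'.det * m = m ^ k * H.det ∧
      (∀ y, y ≠ 0 → 3 * m ^ 2 ≤ 4 * (y ⬝ᵥ (H' *ᵥ y))) ∧
      ∀ x, m * (x ⬝ᵥ (H *ᵥ x)) = (m * (e x).1 + l (e x).2) ^ 2 +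
        (e x).2 ⬝ᵥ (H' *ᵥ (e x).2) := by
  obtain ⟨G, e, hG, hdet, hval, hmin⟩ := hH.exists_equiv
  have hs : (Pi.single 0 1 : Fin (k + 1) → ℤ) ≠ 0 := by simp
  have hs0 : (Pi.single 0 1 : Fin (k + 1) → ℤ) ⬝ᵥ (G *ᵥ Pi.single 0 1) = G 0 0 := by simp
  have hm : 0 < G 0 0 := hs0 ▸ hG.2 _ hs
  have hlow : ∀ y, y ≠ 0 → 3 * G 0 0 ^ 2 ≤ 4 * (y ⬝ᵥ (schurInt G *ᵥ y)) := by
    intro y hy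
    obtain ⟨t, ht⟩ := exists_two_mul_abs_le (G 0 0) (∑ i, G 0 i.succ * y i) hm
    have h1 := mul_gram_cons G hG.1 t y
    have h2 : (Fin.cons t y : Fin (k + 1) → ℤ) ≠ 0 := by
      intro h
      apply hy
      ext i
      simpa using congrFun h i.succ
    have h3 := hmin _ h2
    nlinarith
  refine ⟨G 0 0, schurInt G, e.toEquiv.trans (Fin.consEquiv fun _ => ℤ).symm,
    fun y => ∑ i, G 0 i.succ * y i, hm, ⟨e.symm (Pi.single 0 1), ?_, ?_⟩, ⟨?_, ?_⟩, ?_, hlow, ?_⟩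
  · simp
  · rw [← hval, e.apply_symm_apply, hs0]
  · ext i j
    simp only [transpose_apply, schurInt, of_apply, hG.1.apply j.succ i.succ,
      hG.1.apply 0 i.succ, hG.1.apply 0 j.succ]
    have h1 := hG.1.apply i.succ j.succ
    have h2 := hG.1.apply i.succ 0
    have h3 := hG.1.apply j.succ 0
    grind
  · intro y hy
    have := hlow y hy
    have := pow_pos hm 2
    omega
  · rw [schurInt_det G, hdet]
  · intro x
    rw [← hval, ← mul_gram_cons G hG.1]
    have : (Fin.cons (e x 0) (Fin.tail (e x)) : Fin (k + 1) → ℤ) = e x := Fin.cons_self_tail _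
    rw [← this]
    rfl

theorem finite_and_ncard_linear_sq_le (m l B : ℤ) (hm : 0 < m) :
    {t : ℤ | (m * t + l) ^ 2 ≤ B}.Finite ∧
      ({t : ℤ | (m * t + l) ^ 2 ≤ B}.ncard : ℝ) ≤ 1 + 2 * √(B : ℝ) / m := by
  have hm' : (0 : ℝ) < m := by exact_mod_cast hm
  set s := √(B : ℝ)
  have hsub : {t : ℤ | (m * t + l) ^ 2 ≤ B} ⊆
      (Finset.Icc ⌈(-s - l) / m⌉ ⌊(s - l) / m⌋ : Finset ℤ) := by
    intro t ht
    have h1 : ((m * t + l : ℝ)) ^ 2 ≤ B := by exact_mod_cast ht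
    have h2 := Real.abs_le_sqrt h1
    rw [abs_le] at h2
    simp only [Finset.coe_Icc, Set.mem_Icc, Int.ceil_le, Int.le_floor, div_le_iff₀ hm',
      le_div_iff₀ hm']
    constructor <;> nlinarith
  refine ⟨(Finset.finite_toSet _).subset hsub, ?_⟩
  have h3 := Set.ncard_le_ncard hsub (Finset.finite_toSet _)
  rw [Set.ncard_coe_finset, Int.card_Icc] at h3
  have h4 : ((⌊(s - l) / m⌋ + 1 - ⌈(-s - l) / m⌉).toNat : ℝ) ≤ 1 + 2 * s / m := by
    have hs : 0 ≤ s := Real.sqrt_nonneg _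
    rcases le_total 0 (⌊(s - l) / m⌋ + 1 - ⌈(-s - l) / m⌉) with h | h
    · have h5 : ((⌊(s - l) / m⌋ + 1 - ⌈(-s - l) / m⌉).toNat : ℝ) =
          ((⌊(s - l) / m⌋ + 1 - ⌈(-s - l) / m⌉ : ℤ) : ℝ) := by
        exact_mod_cast Int.toNat_of_nonneg h
      rw [h5]
      push_cast
      have h6 := Int.floor_le ((s - l) / m)
      have h7 := Int.le_ceil ((-s - l) / m)
      have h8 : (s - l) / m - (-s - l) / m = 2 * s / m := by ring
      linarith
    · rw [Int.toNat_of_nonpos h, Nat.cast_zero]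
      positivity
  exact le_trans (by exact_mod_cast h3) h4

theorem ncard_linear_sq_eq_le (m l B : ℤ) (hm : 0 < m) :
    ({t : ℤ | (m * t + l) ^ 2 = B}.ncard : ℝ) ≤ 2 := by
  by_cases h : ∃ t₀, (m * t₀ + l) ^ 2 = B
  · obtain ⟨t₀, rfl⟩ := h
    have hinj : Set.InjOn (fun t => m * t + l) {t : ℤ | (m * t + l) ^ 2 = (m * t₀ + l) ^ 2} := by
      intro a _ b _ hab
      simpa [hm.ne'] using hab
    have h1 := Set.ncard_le_ncard_of_injOn (t := {m * t₀ + l, -(m * t₀ + l)}) _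
      (fun t ht => by simpa using sq_eq_sq_iff_eq_or_eq_neg.1 ht) hinj (Set.toFinite _)
    exact_mod_cast h1.trans (Set.ncard_insert_le _ _ |>.trans (by simp))
  · have : {t : ℤ | (m * t + l) ^ 2 = B} = ∅ := by
      ext t
      simpa using fun ht => h ⟨t, ht⟩
    simp [this]

theorem finite_and_ncard_le_of_fibers {X Y : Type*} {S : Set (X × Y)} {T : Set Y} {c : ℝ}
    (hc : 0 ≤ c) (hT : T.Finite) (hST : ∀ p ∈ S, p.2 ∈ T)
    (hfin : ∀ y, {x | (x, y) ∈ S}.Finite) (hcard : ∀ y, ({x | (x, y) ∈ S}.ncard : ℝ) ≤ c) :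
    S.Finite ∧ (S.ncard : ℝ) ≤ c * T.ncard := by
  classical
  have hS : S.Finite := by
    have : S ⊆ ⋃ y ∈ T, (fun x => (x, y)) '' {x | (x, y) ∈ S} := by
      rintro ⟨x, y⟩ h
      simp only [Set.mem_iUnion]
      exact ⟨y, hST _ h, x, h, rfl⟩
    exact (hT.biUnion fun y _ => (hfin y).image _).subset this
  refine ⟨hS, ?_⟩
  have h1 : hS.toFinset.card ≤ ⌊c⌋₊ * hT.toFinset.card := by
    refine Finset.card_le_mul_card_image_of_maps_to (f := Prod.snd)
      (by simpa using fun a b => hST (a, b)) _ fun y _ => ?_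
    refine le_trans ?_ (Nat.le_floor (hcard y))
    rw [Set.ncard_eq_toFinset_card _ (hfin y)]
    refine Finset.card_le_card_of_injOn Prod.fst ?_ ?_
    · rintro ⟨a, b⟩ h
      simp only [Finset.coe_filter, Set.Finite.mem_toFinset, Set.mem_ofPred_eq] at h
      simpa [← h.2] using h.1
    · rintro ⟨a, b⟩ h ⟨a', b'⟩ h' haa
      simp only [Finset.coe_filter, Set.Finite.mem_toFinset, Set.mem_ofPred_eq] at h h'
      exact Prod.ext haa (h.2.trans h'.2.symm)
  rw [Set.ncard_eq_toFinset_card _ hS, Set.ncard_eq_toFinset_card _ hT]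
  calc (hS.toFinset.card : ℝ) ≤ (⌊c⌋₊ : ℝ) * hT.toFinset.card := by exact_mod_cast h1
    _ ≤ _ := by gcongr; exact Nat.floor_le hc

theorem Equiv.finite_and_ncard_preimage {X Y : Type*} (e : X ≃ Y) {S : Set Y} (hS : S.Finite) :
    (e ⁻¹' S).Finite ∧ (e ⁻¹' S).ncard = S.ncard := by
  rw [← e.image_symm_eq_preimage]
  exact ⟨hS.image _, Set.ncard_image_of_injective _ e.symm.injective⟩

theorem sqrt_mul_div_self (m R : ℝ) (hm : 0 < m) : √(m * R) / m = √(R / m) := by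
  have : R / m = m * R / m ^ 2 := by field_simp
  rw [this, Real.sqrt_div' _ (sq_nonneg m), Real.sqrt_sq hm.le]

open Matrix in
/-- Counting short vectors of an integral lattice through a reduced basis: the numbers `t i` are
the squared lengths of the Gram-Schmidt vectors. -/
theorem IsPosGram.exists_ball_bound {k : ℕ} : ∀ {H : Matrix (Fin k) (Fin k) ℤ}, IsPosGram H →
    ∃ t : Fin k → ℝ, (∀ i, 0 < t i) ∧ ∏ i, t i = H.det ∧
      (∀ m : ℝ, (∀ x, x ≠ 0 → m ≤ (x ⬝ᵥ (H *ᵥ x) : ℤ)) →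
        ∀ i : Fin k, (3 / 4 : ℝ) ^ (i : ℕ) * m ≤ t i) ∧
      ∀ R : ℤ, {x | x ⬝ᵥ (H *ᵥ x) ≤ R}.Finite ∧
        ({x | x ⬝ᵥ (H *ᵥ x) ≤ R}.ncard : ℝ) ≤ ∏ i, (1 + 2 * √((R : ℝ) / t i)) := by
  induction k with
  | zero =>
    intro H _
    refine ⟨fun _ => 1, fun i => i.elim0, by simp, fun _ _ i => i.elim0, fun R =>
      ⟨Set.toFinite _, ?_⟩⟩
    have : {x : Fin 0 → ℤ | x ⬝ᵥ (H *ᵥ x) ≤ R}.ncard ≤ 1 :=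
      Set.ncard_le_one_of_subsingleton _
    simpa using this
  | succ k ih =>
    intro H hH
    obtain ⟨m, H', e, l, hm, ⟨v, hv, hvm⟩, hH', hdet, hlow, hval⟩ := hH.exists_reduction
    obtain ⟨t, htpos, htprod, htlow, htcount⟩ := ih hH'
    have hm' : (0 : ℝ) < m := by exact_mod_cast hm
    refine ⟨Fin.cons (m : ℝ) fun i => t i / m, ?_, ?_, ?_, ?_⟩
    · intro i
      refine Fin.cases (by simpa using hm') (fun i => ?_) i
      simpa using div_pos (htpos i) hm'
    · have hd : (H'.det : ℝ) * m = m ^ k * H.det := by exact_mod_cast hdet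
      simp only [Fin.prod_univ_succ, Fin.cons_zero, Fin.cons_succ, Finset.prod_div_distrib, htprod,
        Finset.prod_const, Finset.card_univ, Fintype.card_fin]
      field_simp
      linarith
    · intro r hr i
      have hrm : r ≤ m := by
        have := hr v hv
        rwa [hvm] at this
      refine Fin.cases (by simpa using hrm) (fun i => ?_) i
      have h1 := htlow (3 / 4 * (m : ℝ) ^ 2) (fun y hy => by
        have : (3 * m ^ 2 : ℝ) ≤ 4 * ((y ⬝ᵥ (H' *ᵥ y) : ℤ) : ℝ) := by exact_mod_cast hlow y hy
        linarith) i
      rw [Fin.cons_succ, le_div_iff₀ hm', Fin.val_succ, pow_succ]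
      refine le_trans ?_ h1
      have : (0 : ℝ) < (3 / 4) ^ (i : ℕ) := by positivity
      calc (3 / 4 : ℝ) ^ (i : ℕ) * (3 / 4) * r * m
          = (3 / 4 : ℝ) ^ (i : ℕ) * (3 / 4) * m * r := by ring
        _ ≤ (3 / 4 : ℝ) ^ (i : ℕ) * (3 / 4) * m * m := by gcongr
        _ = _ := by ring
    · intro R
      obtain ⟨hT, hTc⟩ := htcount (m * R)
      obtain ⟨hS, hSc⟩ := finite_and_ncard_le_of_fibers
        (S := {p : ℤ × (Fin k → ℤ) | (m * p.1 + l p.2) ^ 2 + p.2 ⬝ᵥ (H' *ᵥ p.2) ≤ m * R})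
        (c := 1 + 2 * √((m * R : ℤ) : ℝ) / m) (by positivity) hT
        (fun p hp => by
          have := sq_nonneg (m * p.1 + l p.2)
          simp only [Set.mem_ofPred_eq] at hp ⊢
          linarith)
        (fun y => (finite_and_ncard_linear_sq_le m (l y) (m * R) hm).1.subset fun x hx => by
          have := hH'.nonneg y
          simp only [Set.mem_ofPred_eq] at hx ⊢
          linarith)
        (fun y => by
          obtain ⟨h1, h2⟩ := finite_and_ncard_linear_sq_le m (l y) (m * R) hm
          refine le_trans ?_ h2
          refine Nat.cast_le.2 (Set.ncard_le_ncard (fun x hx => ?_) h1)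
          have := hH'.nonneg y
          simp only [Set.mem_ofPred_eq] at hx ⊢
          linarith)
      have heq : {x | x ⬝ᵥ (H *ᵥ x) ≤ R} = e ⁻¹'
          {p : ℤ × (Fin k → ℤ) | (m * p.1 + l p.2) ^ 2 + p.2 ⬝ᵥ (H' *ᵥ p.2) ≤ m * R} := by
        ext x
        simp only [Set.mem_ofPred_eq, Set.mem_preimage, ← hval]
        exact (mul_le_mul_iff_right₀ hm).symm
      obtain ⟨h1, h2⟩ := e.finite_and_ncard_preimage hS
      rw [heq]
      refine ⟨h1, ?_⟩
      rw [h2, Fin.prod_univ_succ]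
      refine hSc.trans (mul_le_mul ?_ (hTc.trans_eq ?_) (by positivity) (by positivity))
      · rw [Fin.cons_zero, mul_div_assoc]
        push_cast
        rw [sqrt_mul_div_self _ _ hm']
      · refine Finset.prod_congr rfl fun i _ => ?_
        rw [Fin.cons_succ]
        push_cast
        congr 3
        field_simp

open Matrix in
/-- Counting vectors of given length through a reduced basis. -/
theorem IsPosGram.exists_sphere_bound {k : ℕ} {H : Matrix (Fin (k + 1)) (Fin (k + 1)) ℤ}
    (hH : IsPosGram H) :
    ∃ (m : ℝ) (t : Fin k → ℝ), 1 ≤ m ∧ m * ∏ i, t i = H.det ∧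
      (∀ i, (3 / 4 : ℝ) ^ k * m ≤ t i) ∧
      ∀ R : ℤ, ({x | x ⬝ᵥ (H *ᵥ x) = R}.ncard : ℝ) ≤ 2 * ∏ i, (1 + 2 * √((R : ℝ) / t i)) := by
  obtain ⟨m, H', e, l, hm, -, hH', hdet, hlow, hval⟩ := hH.exists_reduction
  obtain ⟨t, htpos, htprod, htlow, htcount⟩ := hH'.exists_ball_bound
  have hm' : (0 : ℝ) < m := by exact_mod_cast hm
  refine ⟨m, fun i => t i / m, by exact_mod_cast hm, ?_, ?_, ?_⟩
  · have hd : (H'.det : ℝ) * m = m ^ k * H.det := by exact_mod_cast hdet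
    simp only [Finset.prod_div_distrib, htprod, Finset.prod_const, Finset.card_univ,
      Fintype.card_fin]
    field_simp
    linarith
  · intro i
    have h1 := htlow (3 / 4 * (m : ℝ) ^ 2) (fun y hy => by
      have : (3 * m ^ 2 : ℝ) ≤ 4 * ((y ⬝ᵥ (H' *ᵥ y) : ℤ) : ℝ) := by exact_mod_cast hlow y hy
      linarith) i
    rw [le_div_iff₀ hm']
    refine le_trans ?_ h1
    calc (3 / 4 : ℝ) ^ k * m * m = (3 / 4 : ℝ) ^ k * m ^ 2 := by ring
      _ ≤ (3 / 4 : ℝ) ^ ((i : ℕ) + 1) * m ^ 2 := by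
        gcongr ?_ * _
        exact pow_le_pow_of_le_one (by norm_num) (by norm_num) i.2
      _ = _ := by ring
  · intro R
    obtain ⟨hT, hTc⟩ := htcount (m * R)
    have hsub : ∀ y, {x | (x, y) ∈
        {p : ℤ × (Fin k → ℤ) | (m * p.1 + l p.2) ^ 2 + p.2 ⬝ᵥ (H' *ᵥ p.2) = m * R}} =
        {x | (m * x + l y) ^ 2 = m * R - y ⬝ᵥ (H' *ᵥ y)} := by
      intro y
      ext x
      simp only [Set.mem_ofPred_eq]
      exact eq_sub_iff_add_eq.symm
    obtain ⟨hS, hSc⟩ := finite_and_ncard_le_of_fibers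
      (S := {p : ℤ × (Fin k → ℤ) | (m * p.1 + l p.2) ^ 2 + p.2 ⬝ᵥ (H' *ᵥ p.2) = m * R})
      (c := 2) (by positivity) hT
      (fun p hp => by
        have := sq_nonneg (m * p.1 + l p.2)
        simp only [Set.mem_ofPred_eq] at hp ⊢
        linarith)
      (fun y => by
        rw [hsub]
        exact (finite_and_ncard_linear_sq_le m (l y) _ hm).1.subset fun x hx => le_of_eq hx)
      (fun y => by
        rw [hsub]
        exact ncard_linear_sq_eq_le m (l y) _ hm)
    have heq : {x | x ⬝ᵥ (H *ᵥ x) = R} = e ⁻¹'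
        {p : ℤ × (Fin k → ℤ) | (m * p.1 + l p.2) ^ 2 + p.2 ⬝ᵥ (H' *ᵥ p.2) = m * R} := by
      ext x
      simp only [Set.mem_ofPred_eq, Set.mem_preimage, ← hval]
      exact (mul_right_inj' hm.ne').symm
    rw [heq, (e.finite_and_ncard_preimage hS).2]
    refine hSc.trans (mul_le_mul_of_nonneg_left (hTc.trans_eq ?_) (by positivity))
    refine Finset.prod_congr rfl fun i _ => ?_
    push_cast
    congr 3
    field_simp

open Matrix in
theorem qfHess_value {k : ℕ} (a : Fin k → Fin k → ℤ) (x : Fin k → ℤ) :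
    x ⬝ᵥ (qfHess a *ᵥ x) = 2 * qfVal a x := by
  have h1 : ∀ i j, x i * (qfHess a i j * x j) =
      (if i ≤ j then a i j * x i * x j else 0) + (if j ≤ i then a j i * x j * x i else 0) := by
    intro i j
    rcases lt_trichotomy i j with h | rfl | h
    · simp [qfHess, h.ne, h, h.le, h.not_ge]
      ring
    · simp [qfHess]
      ring
    · simp [qfHess, h.ne', h.not_gt, h.le, h.not_ge]
      ring
  simp only [dotProduct, mulVec, Finset.mul_sum, h1, Finset.sum_add_distrib, qfVal]
  rw [Finset.sum_comm (f := fun i j => if j ≤ i then a j i * x j * x i else 0)]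
  simp only [← Finset.mul_sum]
  ring

theorem isPosGram_qfHess {k : ℕ} {a : Fin k → Fin k → ℤ} (ha : qfPosDef a) :
    IsPosGram (qfHess a) := by
  constructor
  · ext i j
    rcases lt_trichotomy i j with h | rfl | h
    · simp [qfHess, h.ne, h.ne', h, h.not_gt]
    · simp [qfHess]
    · simp [qfHess, h.ne, h.ne', h, h.not_gt]
  · intro x hx
    rw [qfHess_value]
    have := ha x hx
    omega

/-- Expanding `∏ (1 + b i)` into its top term and a bound for all other terms. -/
theorem prod_one_add_le {k : ℕ} (b : Fin (k + 1) → ℝ) {A : ℝ} (hA : 1 ≤ A) (h0 : ∀ i, 0 ≤ b i)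
    (hb : ∀ i, b i ≤ A) : ∏ i, (1 + b i) ≤ ∏ i, b i + 2 ^ (k + 1) * A ^ k := by
  classical
  rw [Finset.prod_one_add, ← Finset.add_sum_erase _ _ (Finset.mem_powerset_self Finset.univ)]
  gcongr
  have h1 : ∀ s ∈ (Finset.univ : Finset (Fin (k + 1))).powerset.erase Finset.univ,
      ∏ i ∈ s, b i ≤ A ^ k := by
    intro s hs
    have hs' : s.card < k + 1 := by
      exact (Finset.card_lt_card (Finset.ssubset_univ_iff.2 (Finset.ne_of_mem_erase hs))).trans_eq
        (by simp)
    calc ∏ i ∈ s, b i ≤ ∏ _i ∈ s, A := Finset.prod_le_prod (fun i _ => h0 i) fun i _ => hb i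
      _ = A ^ s.card := by simp
      _ ≤ A ^ k := pow_le_pow_right₀ hA (by omega)
  refine (Finset.sum_le_card_nsmul _ _ _ h1).trans ?_
  rw [nsmul_eq_mul]
  gcongr
  have := Finset.card_erase_le (a := Finset.univ)
    (s := (Finset.univ : Finset (Fin (k + 1))).powerset)
  rw [Finset.card_powerset, Finset.card_univ, Fintype.card_fin] at this
  exact_mod_cast this

theorem inv_sqrt_le_rpow {j : ℕ} {c m P : ℝ} (hc : 0 < c) (hm : 0 < m)
    (hP : (c * m) ^ (j + 1) ≤ P) :
    (√P)⁻¹ ≤ c ^ (-(((j : ℝ) + 1) / (2 * (j + 2)))) *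
      (m * P) ^ (-(((j : ℝ) + 1) / (2 * (j + 2)))) := by
  have hP0 : 0 < P := lt_of_lt_of_le (by positivity) hP
  have h1 : (c * (m * P)) ^ (j + 1) ≤ P ^ (j + 2) := by
    calc (c * (m * P)) ^ (j + 1) = (c * m) ^ (j + 1) * P ^ (j + 1) := by ring
      _ ≤ P * P ^ (j + 1) := by gcongr
      _ = _ := by ring
  have hj : (0 : ℝ) < 2 * (j + 2) := by positivity
  have h2 : (c * (m * P)) ^ (((j : ℝ) + 1) / (2 * (j + 2))) ≤ √P := by
    have h3 := Real.rpow_le_rpow (by positivity) h1 (inv_nonneg.2 hj.le)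
    rw [← Real.rpow_natCast, ← Real.rpow_natCast, ← Real.rpow_mul (by positivity),
      ← Real.rpow_mul hP0.le] at h3
    push_cast at h3
    rw [Real.sqrt_eq_rpow]
    have h4 : ((j : ℝ) + 2) * (2 * ((j : ℝ) + 2))⁻¹ = 1 / 2 := by field_simp
    rwa [h4, ← div_eq_mul_inv] at h3
  rw [← Real.mul_rpow hc.le (by positivity), Real.rpow_neg (by positivity)]
  exact inv_anti₀ (by positivity) h2

/-- The representation bound in rank `j + 2`, with explicit constants. -/
theorem qfRep_le {j : ℕ} {a : Fin (j + 2) → Fin (j + 2) → ℤ} (ha : qfPosDef a) {c : ℝ}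
    (hc : c = (3 / 4) ^ (j + 1)) {n : ℕ} (hn : 0 < n) :
    (qfRep a (n : ℤ) : ℝ) ≤
      2 * (2 * √2) ^ (j + 1) * c ^ (-(((j : ℝ) + 1) / (2 * (j + 2)))) *
          (√(n : ℝ) ^ (j + 1) * (qfDisc a : ℝ) ^ (-(((j : ℝ) + 1) / (2 * (j + 2))))) +
        2 * 2 ^ (j + 1) * (2 * √(2 / c)) ^ j * √(n : ℝ) ^ j := by
  obtain ⟨m, t, hm, hmt, htlow, hcount⟩ := (isPosGram_qfHess ha).exists_sphere_bound
  rw [← hc] at htlow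
  have hc0 : 0 < c := by rw [hc]; positivity
  have hc1 : c ≤ 1 := by rw [hc]; exact pow_le_one₀ (by norm_num) (by norm_num)
  have hm0 : 0 < m := by linarith
  have hn1 : (1 : ℝ) ≤ n := by exact_mod_cast hn
  have hcm : 0 < c * m := by positivity
  have htpos : ∀ i, 0 < t i := fun i => hcm.trans_le (htlow i)
  have htc : ∀ i, c ≤ t i := fun i => le_trans (by nlinarith) (htlow i)
  have hset : {x | qfVal a x = (n : ℤ)} = {x | x ⬝ᵥ (qfHess a).mulVec x = 2 * (n : ℤ)} := by
    ext x
    simp only [Set.mem_ofPred_eq, qfHess_value]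
    omega
  have h1 := hcount (2 * (n : ℤ))
  rw [← hset] at h1
  push_cast at h1
  have hA : 1 ≤ 2 * √(2 * (n : ℝ) / c) := by
    have : 1 ≤ √(2 * (n : ℝ) / c) := by
      rw [Real.one_le_sqrt, le_div_iff₀ hc0]
      linarith
    linarith
  have h2 := prod_one_add_le (fun i => 2 * √(2 * (n : ℝ) / t i)) hA (fun i => by positivity)
    (fun i => by
      have := htc i
      gcongr)
  have h3 : ∏ i, 2 * √(2 * (n : ℝ) / t i) =
      (2 * √2) ^ (j + 1) * √(n : ℝ) ^ (j + 1) * (√(∏ i, t i))⁻¹ := by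
    have : ∀ i, 2 * √(2 * (n : ℝ) / t i) = (2 * √2) * √(n : ℝ) * (√(t i))⁻¹ := fun i => by
      rw [Real.sqrt_div' _ (htpos i).le, Real.sqrt_mul (by norm_num)]
      ring
    simp only [this, Finset.prod_mul_distrib, Finset.prod_const, Finset.card_univ,
      Fintype.card_fin, Finset.prod_inv_distrib]
    rw [Real.sqrt_prod _ fun i _ => (htpos i).le, mul_pow]
  have hP : (c * m) ^ (j + 1) ≤ ∏ i, t i := by
    calc (c * m) ^ (j + 1) = ∏ _i : Fin (j + 1), c * m := by simp
      _ ≤ _ := Finset.prod_le_prod (fun _ _ => hcm.le) fun i _ => htlow i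
  have h4 := inv_sqrt_le_rpow hc0 hm0 hP
  rw [hmt] at h4
  have h5 : 2 * √(2 * (n : ℝ) / c) = 2 * √(2 / c) * √(n : ℝ) := by
    rw [mul_assoc, ← Real.sqrt_mul (by positivity)]
    congr 2
    ring
  rw [h3, h5, mul_pow _ √(n : ℝ)] at h2
  have h6 : (2 * √2) ^ (j + 1) * √(n : ℝ) ^ (j + 1) * (√(∏ i, t i))⁻¹ ≤
      (2 * √2) ^ (j + 1) * √(n : ℝ) ^ (j + 1) * (c ^ (-(((j : ℝ) + 1) / (2 * (j + 2)))) *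
      (qfDisc a : ℝ) ^ (-(((j : ℝ) + 1) / (2 * (j + 2))))) := by
    gcongr
    exact h4
  unfold qfRep
  linarith

/-- Uniform upper bound on representation numbers: for every `k ≥ 2` there is a
constant `C(k) > 0` such that for every positive definite integral form `L` of rank
`k` and every positive integer `n`,
`r(n, L) ≤ C(k) · (n^{(k-1)/2} · (dL)^{-(k-1)/2k} + ∑_{i=1}^{k-1} n^{(k-1-i)/2})`. -/
theorem stmt_10 (k : ℕ) (hk : 2 ≤ k) :
    ∃ C : ℝ, 0 < C ∧ ∀ a : Fin k → Fin k → ℤ, qfPosDef a → ∀ n : ℕ, 0 < n →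
      (qfRep a (n : ℤ) : ℝ) ≤
        C * ((n : ℝ) ^ (((k : ℝ) - 1) / 2) *
              (qfDisc a : ℝ) ^ (-(((k : ℝ) - 1) / (2 * (k : ℝ)))) +
            ∑ i ∈ Finset.Icc 1 (k - 1), (n : ℝ) ^ (((k : ℝ) - 1 - (i : ℝ)) / 2)) := by
  obtain ⟨j, rfl⟩ : ∃ j, k = j + 2 := ⟨k - 2, by omega⟩
  set c : ℝ := (3 / 4) ^ (j + 1) with hc
  have hc0 : 0 < c := by positivity
  set C₁ := 2 * (2 * √2) ^ (j + 1) * c ^ (-(((j : ℝ) + 1) / (2 * (j + 2)))) with hC₁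
  set C₂ := 2 * 2 ^ (j + 1) * (2 * √(2 / c)) ^ j with hC₂
  have hC₁0 : 0 < C₁ := by positivity
  have hC₂0 : 0 < C₂ := by positivity
  refine ⟨C₁ + C₂, by positivity, fun a ha n hn => (qfRep_le ha hc hn).trans ?_⟩
  rw [← hC₁, ← hC₂]
  have hn0 : (0 : ℝ) ≤ n := Nat.cast_nonneg n
  have hpow : ∀ i : ℕ, √(n : ℝ) ^ i = (n : ℝ) ^ ((i : ℝ) / 2) := fun i => by
    rw [Real.sqrt_eq_rpow, ← Real.rpow_natCast, ← Real.rpow_mul hn0]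
    congr 1
    ring
  have hexp : (((j + 2 : ℕ) : ℝ) - 1) = (j : ℝ) + 1 := by
    push_cast
    ring
  have hterm : √(n : ℝ) ^ j ≤ ∑ i ∈ Finset.Icc 1 (j + 2 - 1),
      (n : ℝ) ^ ((((j + 2 : ℕ) : ℝ) - 1 - (i : ℝ)) / 2) := by
    refine le_trans (le_of_eq ?_) (Finset.single_le_sum (fun i _ => Real.rpow_nonneg hn0 _)
      (Finset.mem_Icc.2 ⟨le_rfl, by omega⟩ : 1 ∈ Finset.Icc 1 (j + 2 - 1)))
    rw [hpow, hexp]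
    push_cast
    congr 1
    ring
  have hdisc : (0 : ℝ) ≤ (qfDisc a : ℝ) ^ (-(((j : ℝ) + 1) / (2 * (j + 2)))) := by
    obtain ⟨t, ht, hprod, -⟩ := (isPosGram_qfHess ha).exists_ball_bound
    refine Real.rpow_nonneg ?_ _
    rw [qfDisc, ← hprod]
    exact Finset.prod_nonneg fun i _ => (ht i).le
  have hmain : (n : ℝ) ^ ((((j + 2 : ℕ) : ℝ) - 1) / 2) *
      (qfDisc a : ℝ) ^ (-((((j + 2 : ℕ) : ℝ) - 1) / (2 * ((j + 2 : ℕ) : ℝ)))) =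
      √(n : ℝ) ^ (j + 1) * (qfDisc a : ℝ) ^ (-(((j : ℝ) + 1) / (2 * (j + 2)))) := by
    rw [hpow, hexp]
    push_cast
    rfl
  rw [hmain]
  set X := √(n : ℝ) ^ (j + 1) * (qfDisc a : ℝ) ^ (-(((j : ℝ) + 1) / (2 * (j + 2))))
  have hX : 0 ≤ X := by positivity
  have hY : 0 ≤ √(n : ℝ) ^ j := by positivity
  nlinarith [mul_le_mul_of_nonneg_left hterm hC₂0.le, mul_nonneg hC₂0.le hX,
    mul_nonneg hC₁0.le (hY.trans hterm)]
end
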